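/- arXiv:2105.00018 — 2 statements merged into one kernel-verified Lean document; each statement's English description precedes it below -/
import Mathlib

section
/- Let Z be a positive random variable such that 𝚣 = log Z has mean zero, exponentially decaying tails, and a uniformly Hölder continuous density. Then there exist constants κ₁ > 0, κ₂ ∈ ℝ and η ∈ (0,1), depending only on the law of Z, such that the top Lyapunov exponent satisfies 𝓛_Z(ε) = κ₁ / (log(1/|ε|) + κ₂) + O(|ε|^η) as ε → 0. -/
open MeasureTheory ProbabilityTheory Real Filter Set
open scoped ENNReal

noncomputable def hkfun (k x : ℝ) : ℝ :=
  Real.log ((Real.exp (-k) + Real.exp x) / (1 + Real.exp (x - k)))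

noncomputable def Mmat (ε zv : ℝ) : Matrix (Fin 2) (Fin 2) ℝ :=
  !![1, ε; ε * zv, zv]

noncomputable def matNorm (A : Matrix (Fin 2) (Fin 2) ℝ) : ℝ :=
  ∑ i : Fin 2, ∑ j : Fin 2, |A i j|

noncomputable def prodMat (ε : ℝ) (zs : ℕ → ℝ) (n : ℕ) : Matrix (Fin 2) (Fin 2) ℝ :=
  ((List.range n).map (fun i => Mmat ε (Real.exp (zs i)))).prod

namespace BalancedLyapunov

section Basics

lemma abs_pow_le_exp {γ : ℝ} (hγ : 0 < γ) (n : ℕ) (x : ℝ) :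
    |x| ^ n ≤ (n.factorial / γ ^ n) * Real.exp (γ * |x|) := by
  have h := Real.pow_div_factorial_le_exp (γ * |x|) (by positivity) n
  rw [mul_pow, div_le_iff₀ (by positivity)] at h
  rw [div_mul_eq_mul_div, le_div_iff₀ (by positivity)]
  linarith

lemma one_add_abs_le_exp {γ : ℝ} (hγ : 0 < γ) (x : ℝ) :
    1 + |x| ≤ (1 + 1 / γ) * Real.exp (γ * |x|) := by
  have h := abs_pow_le_exp hγ 1 x
  have h1 : 1 ≤ Real.exp (γ * |x|) := Real.one_le_exp (by positivity)
  simp only [pow_one, Nat.factorial_one, Nat.cast_one] at h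
  linarith

lemma exp_mul_abs_add_le {η : ℝ} (hη : 0 ≤ η) (x y : ℝ) :
    Real.exp (η * |x + y|) ≤ Real.exp (η * |x|) * Real.exp (η * |y|) := by
  rw [← Real.exp_add]
  apply Real.exp_le_exp.2
  nlinarith [abs_add_le x y]

lemma exp_mul_le_exp_mul_abs {η : ℝ} (hη : 0 ≤ η) (x : ℝ) :
    Real.exp (η * x) ≤ Real.exp (η * |x|) :=
  Real.exp_le_exp.2 (mul_le_mul_of_nonneg_left (le_abs_self x) hη)

lemma integrable_of_abs_le_exp {m : Measure ℝ} {γ C : ℝ}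
    (hexp : Integrable (fun x => Real.exp (γ * |x|)) m) {F : ℝ → ℝ}
    (hF : AEStronglyMeasurable F m) (hb : ∀ x, |F x| ≤ C * Real.exp (γ * |x|)) :
    Integrable F m :=
  (hexp.const_mul C).mono' hF (ae_of_all _ hb)

lemma integrable_exp_abs_of_le {m : Measure ℝ} {γ η : ℝ}
    (hexp : Integrable (fun x => Real.exp (γ * |x|)) m) (h : η ≤ γ) :
    Integrable (fun x => Real.exp (η * |x|)) m := by
  refine integrable_of_abs_le_exp (C := 1) hexp (by fun_prop) fun x => ?_
  rw [abs_of_pos (Real.exp_pos _), one_mul]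
  exact Real.exp_le_exp.2 (mul_le_mul_of_nonneg_right h (abs_nonneg x))

lemma abs_add_le_exp {γ C : ℝ} (hγ : 0 ≤ γ) {F : ℝ → ℝ}
    (hb : ∀ x, |F x| ≤ C * Real.exp (γ * |x|)) (y x : ℝ) :
    |F (y + x)| ≤ (C * Real.exp (γ * |y|)) * Real.exp (γ * |x|) := by
  have hC : 0 ≤ C := by
    have := (abs_nonneg _).trans (hb 0)
    simpa using this
  refine (hb _).trans ?_
  rw [mul_assoc]
  exact mul_le_mul_of_nonneg_left (exp_mul_abs_add_le hγ _ _) hC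

lemma integrable_shift {m : Measure ℝ} {γ C : ℝ} (hγ : 0 ≤ γ)
    (hexp : Integrable (fun x => Real.exp (γ * |x|)) m) {F : ℝ → ℝ}
    (hF : Measurable F) (hb : ∀ x, |F x| ≤ C * Real.exp (γ * |x|)) (y : ℝ) :
    Integrable (fun x => F (y + x)) m :=
  integrable_of_abs_le_exp hexp (hF.comp (measurable_const_add y)).aestronglyMeasurable
    (abs_add_le_exp hγ hb y)

/-- Differentiation under the integral sign for translates of functions of exponential growth. -/
lemma hasDerivAt_integral_shift {m : Measure ℝ} {γ C C' : ℝ} (hγ : 0 ≤ γ)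
    (hexp : Integrable (fun x => Real.exp (γ * |x|)) m) {F F' : ℝ → ℝ}
    (hF : ∀ x, HasDerivAt F (F' x) x) (hF' : Measurable F')
    (hb : ∀ x, |F x| ≤ C * Real.exp (γ * |x|)) (hb' : ∀ x, |F' x| ≤ C' * Real.exp (γ * |x|))
    (y : ℝ) :
    HasDerivAt (fun y => ∫ x, F (y + x) ∂m) (∫ x, F' (y + x) ∂m) y := by
  have hFc : Continuous F := continuous_iff_continuousAt.2 fun x => (hF x).continuousAt
  have hC' : 0 ≤ C' := by
    have := (abs_nonneg _).trans (hb' 0)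
    simpa using this
  refine (hasDerivAt_integral_of_dominated_loc_of_deriv_le
    (F := fun y x => F (y + x)) (F' := fun y x => F' (y + x))
    (bound := fun x => (C' * Real.exp (γ * (|y| + 1))) * Real.exp (γ * |x|))
    (Metric.ball_mem_nhds y one_pos) ?_ ?_ ?_ ?_ ?_ ?_).2
  · exact Eventually.of_forall fun u =>
      (hFc.measurable.comp (measurable_const_add u)).aestronglyMeasurable
  · exact integrable_shift hγ hexp hFc.measurable hb y
  · exact (hF'.comp (measurable_const_add y)).aestronglyMeasurable
  · refine ae_of_all _ fun x u hu => ?_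
    rw [Real.norm_eq_abs]
    refine (abs_add_le_exp hγ hb' u x).trans ?_
    have hu' : |u| ≤ |y| + 1 := by
      rw [Metric.mem_ball, Real.dist_eq] at hu
      have := abs_sub_abs_le_abs_sub u y
      linarith
    gcongr
  · exact hexp.const_mul _
  · refine ae_of_all _ fun x u _ => ?_
    simpa using (hF (u + x)).comp_add_const u x

/-- A function whose derivative is `O(exp (γ y))` is within `O(exp (γ y))` of a constant. -/
lemma exists_abs_sub_le_of_deriv_le {γ C : ℝ} (hγ : 0 < γ) {g g' : ℝ → ℝ}
    (hg : ∀ y, HasDerivAt g (g' y) y) (hb : ∀ y, |g' y| ≤ C * Real.exp (γ * y)) :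
    ∃ b, ∀ y, |g y - b| ≤ C / γ * Real.exp (γ * y) := by
  have hC : 0 ≤ C := by
    have := (abs_nonneg _).trans (hb 0)
    simpa using this
  have he : ∀ y, HasDerivAt (fun y => C / γ * Real.exp (γ * y)) (C * Real.exp (γ * y)) y := by
    intro y
    have := (((hasDerivAt_id y).const_mul γ).exp).const_mul (C / γ)
    refine this.congr_deriv ?_
    simp only [id]
    field_simp
  have hl : Antitone fun y => g y - C / γ * Real.exp (γ * y) := by
    refine antitone_of_hasDerivAt_nonpos (fun y => (hg y).sub (he y)) fun y => ?_
    have := (abs_le.1 (hb y)).2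
    simp only [Pi.zero_apply]
    linarith
  have hu : Monotone fun y => g y + C / γ * Real.exp (γ * y) := by
    refine monotone_of_hasDerivAt_nonneg (fun y => (hg y).add (he y)) fun y => ?_
    have := (abs_le.1 (hb y)).1
    simp only [Pi.zero_apply]
    linarith
  have hpos : ∀ y, 0 ≤ C / γ * Real.exp (γ * y) := fun y => by positivity
  have hlu : ∀ x y, g x - C / γ * Real.exp (γ * x) ≤ g y + C / γ * Real.exp (γ * y) := by
    intro x y
    rcases le_total x y with h | h
    · have := hu h
      have := hpos x
      simp only at *
      linarith
    · have := hl h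
      have := hpos y
      simp only at *
      linarith
  refine ⟨⨆ x, (g x - C / γ * Real.exp (γ * x)), fun y => ?_⟩
  have h1 : g y - C / γ * Real.exp (γ * y) ≤ ⨆ x, (g x - C / γ * Real.exp (γ * x)) :=
    le_ciSup (f := fun x => g x - C / γ * Real.exp (γ * x))
      ⟨g 0 + C / γ * Real.exp (γ * 0), by rintro _ ⟨x, rfl⟩; exact hlu x 0⟩ y
  have h2 : (⨆ x, (g x - C / γ * Real.exp (γ * x))) ≤ g y + C / γ * Real.exp (γ * y) :=
    ciSup_le fun x => hlu x y
  rw [abs_le]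
  constructor <;> linarith

/-- Exponential moments of a weighted measure are continuous at `0`. -/
lemma exists_integral_mul_exp_abs_lt {m : Measure ℝ} {γ c : ℝ} (hγ : 0 < γ) {w : ℝ → ℝ}
    (hw : Measurable w) (hw0 : ∀ x, 0 ≤ w x)
    (hexp : Integrable (fun x => w x * Real.exp (γ * |x|)) m) (hc : ∫ x, w x ∂m < c) :
    ∃ η₀, 0 < η₀ ∧ η₀ ≤ γ ∧ ∀ η, 0 < η → η ≤ η₀ →
      Integrable (fun x => w x * Real.exp (η * |x|)) m ∧
        ∫ x, w x * Real.exp (η * |x|) ∂m < c := by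
  have hint : ∀ η ≤ γ, Integrable (fun x => w x * Real.exp (η * |x|)) m := by
    intro η hη
    refine hexp.mono' (by fun_prop) (ae_of_all _ fun x => ?_)
    rw [Real.norm_eq_abs, abs_of_nonneg (mul_nonneg (hw0 x) (Real.exp_pos _).le)]
    exact mul_le_mul_of_nonneg_left
      (Real.exp_le_exp.2 (mul_le_mul_of_nonneg_right hη (abs_nonneg x))) (hw0 x)
  have hlim : Tendsto (fun η => ∫ x, w x * Real.exp (η * |x|) ∂m) (nhdsWithin 0 (Ioi 0))
      (nhds (∫ x, w x ∂m)) := by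
    refine tendsto_integral_filter_of_dominated_convergence
      (fun x => w x * Real.exp (γ * |x|)) ?_ ?_ hexp ?_
    · exact Eventually.of_forall fun η => by fun_prop
    · filter_upwards [Ioo_mem_nhdsGT hγ] with η hη
      refine ae_of_all _ fun x => ?_
      rw [Real.norm_eq_abs, abs_of_nonneg (mul_nonneg (hw0 x) (Real.exp_pos _).le)]
      exact mul_le_mul_of_nonneg_left
        (Real.exp_le_exp.2 (mul_le_mul_of_nonneg_right hη.2.le (abs_nonneg x))) (hw0 x)
    · refine ae_of_all _ fun x => ?_
      have : Continuous fun η : ℝ => w x * Real.exp (η * |x|) := by fun_prop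
      have h := this.tendsto 0
      simp only [zero_mul, Real.exp_zero, mul_one] at h
      exact h.mono_left nhdsWithin_le_nhds
  obtain ⟨η₀, hη₀, h₁⟩ :=
    ((hlim.eventually (gt_mem_nhds hc)).and (Ioo_mem_nhdsGT hγ)).exists
  refine ⟨η₀, h₁.1, h₁.2.le, fun η _ hη => ⟨hint η (hη.trans h₁.2.le), lt_of_le_of_lt ?_ hη₀⟩⟩
  refine integral_mono (hint η (hη.trans h₁.2.le)) (hint _ h₁.2.le) fun x => ?_
  exact mul_le_mul_of_nonneg_left
    (Real.exp_le_exp.2 (mul_le_mul_of_nonneg_right hη (abs_nonneg x))) (hw0 x)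

end Basics

/-- A centred law with finite exponential moments and a Hölder continuous density. -/
structure IsBalancedLaw (μ : Measure ℝ) (ζ : ℝ → ℝ) (γ θ Cθ : ℝ) : Prop where
  prob : IsProbabilityMeasure μ
  meas : Measurable ζ
  nonneg : ∀ x, 0 ≤ ζ x
  law : μ = volume.withDensity fun x => ENNReal.ofReal (ζ x)
  mean : ∫ x, x ∂μ = 0
  γ_pos : 0 < γ
  exp_int : Integrable (fun x => Real.exp (γ * |x|)) μ
  θ_pos : 0 < θ
  θ_le : θ ≤ 1
  holder : ∀ x y, |ζ x - ζ y| ≤ Cθ * |x - y| ^ θ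

namespace IsBalancedLaw

variable {μ : Measure ℝ} {ζ : ℝ → ℝ} {γ θ Cθ : ℝ}

lemma abs_cont (h : IsBalancedLaw μ ζ γ θ Cθ) : μ ≪ volume := by
  rw [h.law]; exact withDensity_absolutelyContinuous _ _

lemma noAtoms (h : IsBalancedLaw μ ζ γ θ Cθ) : NullSingletonClass μ :=
  ⟨fun x => h.abs_cont (measure_singleton x)⟩

lemma integral_eq (h : IsBalancedLaw μ ζ γ θ Cθ) (F : ℝ → ℝ) :
    ∫ x, F x ∂μ = ∫ x, ζ x * F x := by
  rw [h.law, integral_withDensity_eq_integral_toReal_smul h.meas.ennreal_ofReal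
    (ae_of_all _ fun x => ENNReal.ofReal_lt_top)]
  refine integral_congr_ae (ae_of_all _ fun x => ?_)
  simp [ENNReal.toReal_ofReal (h.nonneg x)]

lemma integrable_iff (h : IsBalancedLaw μ ζ γ θ Cθ) (F : ℝ → ℝ) :
    Integrable F μ ↔ Integrable (fun x => ζ x * F x) := by
  rw [h.law, integrable_withDensity_iff_integrable_smul' h.meas.ennreal_ofReal
    (ae_of_all _ fun x => ENNReal.ofReal_lt_top)]
  refine integrable_congr (ae_of_all _ fun x => ?_)
  simp [ENNReal.toReal_ofReal (h.nonneg x)]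

lemma Cθ_nonneg (h : IsBalancedLaw μ ζ γ θ Cθ) : 0 ≤ Cθ := by
  have := (abs_nonneg _).trans (h.holder 1 0)
  simpa using this

lemma continuous (h : IsBalancedLaw μ ζ γ θ Cθ) : Continuous ζ := by
  rw [continuous_iff_continuousAt]
  intro x
  rw [ContinuousAt, tendsto_iff_dist_tendsto_zero]
  have hlim : Tendsto (fun y => Cθ * |y - x| ^ θ) (nhds x) (nhds 0) := by
    have hc : Continuous fun y : ℝ => Cθ * |y - x| ^ θ := by
      have := h.θ_pos.le
      exact continuous_const.mul ((by fun_prop : Continuous fun y : ℝ => |y - x|).rpow_const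
        fun _ => Or.inr this)
    have := hc.tendsto x
    simpa [Real.zero_rpow h.θ_pos.ne'] using this
  exact squeeze_zero (fun _ => dist_nonneg) (fun y => by
    rw [Real.dist_eq]; exact h.holder y x) hlim

lemma reflect (h : IsBalancedLaw μ ζ γ θ Cθ) :
    IsBalancedLaw (μ.map Neg.neg) (fun x => ζ (-x)) γ θ Cθ where
  prob := by
    have := h.prob
    exact Measure.isProbabilityMeasure_map measurable_neg.aemeasurable
  meas := h.meas.comp measurable_neg
  nonneg x := h.nonneg _
  law := by
    rw [h.law]
    ext s hs
    rw [Measure.map_apply measurable_neg hs, withDensity_apply _ (measurable_neg hs),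
      withDensity_apply _ hs]
    have := (Measure.measurePreserving_neg (volume : Measure ℝ)).setLIntegral_comp_preimage
      hs (f := fun x => ENNReal.ofReal (ζ (-x))) ((h.meas.comp measurable_neg).ennreal_ofReal)
    simpa using this
  mean := by
    rw [integral_map measurable_neg.aemeasurable (by fun_prop), integral_neg, h.mean, neg_zero]
  γ_pos := h.γ_pos
  exp_int := by
    rw [integrable_map_measure (by fun_prop) measurable_neg.aemeasurable]
    simpa [Function.comp_def] using h.exp_int
  θ_pos := h.θ_pos
  θ_le := h.θ_le
  holder x y := by
    refine (h.holder _ _).trans_eq ?_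
    rw [← abs_neg (-x - -y)]
    ring_nf

lemma exp_int_of_le (h : IsBalancedLaw μ ζ γ θ Cθ) {η : ℝ} (hη : η ≤ γ) :
    Integrable (fun x => Real.exp (η * |x|)) μ :=
  integrable_exp_abs_of_le h.exp_int hη

lemma integrable_abs_pow (h : IsBalancedLaw μ ζ γ θ Cθ) (n : ℕ) :
    Integrable (fun x => |x| ^ n) μ :=
  integrable_of_abs_le_exp h.exp_int (by fun_prop) fun x => by
    rw [abs_of_nonneg (by positivity)]; exact abs_pow_le_exp h.γ_pos n x

lemma integrable_id (h : IsBalancedLaw μ ζ γ θ Cθ) : Integrable (fun x => x) μ := by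
  have := h.integrable_abs_pow 1
  simp only [pow_one] at this
  exact this.mono' (by fun_prop) (ae_of_all _ fun x => le_rfl)

lemma integrable_sq (h : IsBalancedLaw μ ζ γ θ Cθ) : Integrable (fun x => x ^ 2) μ := by
  simpa using h.integrable_abs_pow 2

lemma variance_pos (h : IsBalancedLaw μ ζ γ θ Cθ) : 0 < ∫ x, x ^ 2 ∂μ := by
  have := h.prob
  have := h.noAtoms
  rw [integral_pos_iff_support_of_nonneg (fun x => sq_nonneg x) h.integrable_sq]
  have hs : Function.support (fun x : ℝ => x ^ 2) = {0}ᶜ := by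
    ext x; simp
  rw [hs, prob_compl_eq_one_sub (measurableSet_singleton 0), measure_singleton]
  simp

end IsBalancedLaw

section Wall

/-- The one-sided limit of `hkfun`, seen from the wall. -/
noncomputable def wall (y : ℝ) : ℝ := y - Real.log (1 + Real.exp y)

/-- The derivative of `wall`. -/
noncomputable def surv (y : ℝ) : ℝ := (1 + Real.exp y)⁻¹

lemma one_add_exp_pos (y : ℝ) : 0 < 1 + Real.exp y := by positivity

lemma surv_pos (y : ℝ) : 0 < surv y := inv_pos.2 (one_add_exp_pos y)

lemma surv_le_one (y : ℝ) : surv y ≤ 1 :=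
  inv_le_one_of_one_le₀ (by linarith [Real.exp_pos y])

lemma surv_antitone : Antitone surv := fun x y h => by
  unfold surv
  gcongr

lemma exp_wall (y : ℝ) : Real.exp (wall y) = 1 - surv y := by
  have := one_add_exp_pos y
  rw [wall, Real.exp_sub, Real.exp_log this, surv]
  field_simp
  ring

lemma log_one_add_exp_pos (y : ℝ) : 0 < Real.log (1 + Real.exp y) :=
  Real.log_pos (by linarith [Real.exp_pos y])

lemma wall_le (y : ℝ) : wall y ≤ y := by
  have := log_one_add_exp_pos y
  unfold wall
  linarith

lemma wall_neg (y : ℝ) : wall y < 0 := by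
  have h : Real.exp (wall y) < 1 := by
    rw [exp_wall]; linarith [surv_pos y]
  simpa using h

lemma hasDerivAt_log_one_add_exp (y : ℝ) :
    HasDerivAt (fun y => Real.log (1 + Real.exp y)) (Real.exp y / (1 + Real.exp y)) y :=
  ((Real.hasDerivAt_exp y).const_add 1).log (one_add_exp_pos y).ne'

lemma hasDerivAt_wall (y : ℝ) : HasDerivAt wall (surv y) y := by
  refine ((hasDerivAt_id y).sub (hasDerivAt_log_one_add_exp y)).congr_deriv ?_
  have := one_add_exp_pos y
  rw [surv]
  field_simp
  ring

lemma continuous_wall : Continuous wall :=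
  continuous_iff_continuousAt.2 fun y => (hasDerivAt_wall y).continuousAt

lemma continuous_surv : Continuous surv :=
  Continuous.inv₀ (by fun_prop) fun y => (one_add_exp_pos y).ne'

lemma wall_monotone : Monotone wall :=
  monotone_of_hasDerivAt_nonneg hasDerivAt_wall fun y => (surv_pos y).le

lemma log_one_add_exp_le (y : ℝ) : Real.log (1 + Real.exp y) ≤ max y 0 + 1 := by
  have h1 : 1 + Real.exp y ≤ 2 * Real.exp (max y 0) := by
    have h1 := Real.exp_le_exp.2 (le_max_left y 0)
    have h2 := Real.exp_le_exp.2 (le_max_right y 0)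
    rw [Real.exp_zero] at h2
    linarith
  have h2 := Real.log_le_log (one_add_exp_pos y) h1
  rw [Real.log_mul two_ne_zero (Real.exp_pos _).ne', Real.log_exp] at h2
  linarith [Real.log_two_lt_d9]

lemma abs_wall_le (y : ℝ) : |wall y| ≤ |y| + 1 := by
  rw [abs_of_neg (wall_neg y)]
  have h := log_one_add_exp_le y
  unfold wall
  rcases le_total y 0 with hy | hy
  · rw [max_eq_right hy] at h
    rw [abs_of_nonpos hy]
    linarith
  · rw [max_eq_left hy] at h
    rw [abs_of_nonneg hy]
    linarith

lemma log_one_add_exp_le_exp {η : ℝ} (hη : 0 < η) (hη1 : η ≤ 1) (x : ℝ) :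
    Real.log (1 + Real.exp x) ≤ Real.exp (η * x) / η := by
  have h1 : (1 + Real.exp x) ^ η ≤ 1 + Real.exp (η * x) := by
    have := Real.rpow_add_le_add_rpow zero_le_one (Real.exp_pos x).le hη.le hη1
    rw [Real.one_rpow, ← Real.exp_mul] at this
    rwa [mul_comm η x]
  have h2 := Real.log_le_log (by have := one_add_exp_pos x; positivity) h1
  rw [Real.log_rpow (one_add_exp_pos x)] at h2
  have h3 := Real.log_le_sub_one_of_pos (one_add_exp_pos (η * x))
  rw [le_div_iff₀ hη]
  linarith

lemma exp_mul_wall_ge {η : ℝ} (hη : 0 < η) (hη1 : η ≤ 1) (x : ℝ) :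
    Real.exp (η * x) - Real.exp (2 * η * x) ≤ Real.exp (η * wall x) := by
  have h1 := log_one_add_exp_le_exp hη hη1 x
  rw [le_div_iff₀ hη] at h1
  have h2 := Real.add_one_le_exp (-(η * Real.log (1 + Real.exp x)))
  have h3 : Real.exp (η * wall x)
      = Real.exp (η * x) * Real.exp (-(η * Real.log (1 + Real.exp x))) := by
    rw [← Real.exp_add, wall]; ring_nf
  have h4 : Real.exp (2 * η * x) = Real.exp (η * x) * Real.exp (η * x) := by
    rw [← Real.exp_add]; ring_nf
  rw [h3, h4]
  have := Real.exp_pos (η * x)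
  nlinarith

end Wall

namespace IsBalancedLaw

variable {μ : Measure ℝ} {ζ : ℝ → ℝ} {γ θ Cθ : ℝ}

lemma integrable_exp_mul (h : IsBalancedLaw μ ζ γ θ Cθ) {η : ℝ} (h0 : 0 ≤ η) (hη : η ≤ γ) :
    Integrable (fun x => Real.exp (η * x)) μ :=
  (h.exp_int_of_le hη).mono' (by fun_prop) (ae_of_all _ fun x => by
    rw [Real.norm_eq_abs, abs_of_pos (Real.exp_pos _)]; exact exp_mul_le_exp_mul_abs h0 x)

lemma one_lt_integral_exp (h : IsBalancedLaw μ ζ γ θ Cθ) {η : ℝ} (h0 : 0 < η) (hη : η ≤ γ) :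
    1 < ∫ x, Real.exp (η * x) ∂μ := by
  have := h.prob
  have := h.noAtoms
  have hi := h.integrable_exp_mul h0.le hη
  have hi2 : Integrable (fun x => 1 + η * x) μ :=
    (integrable_const 1).add (h.integrable_id.const_mul η)
  have hpos : 0 < ∫ x, (Real.exp (η * x) - (1 + η * x)) ∂μ := by
    have hi3 : Integrable (fun x => Real.exp (η * x) - (1 + η * x)) μ := hi.sub hi2
    rw [integral_pos_iff_support_of_nonneg
      (fun x => by simp only [Pi.zero_apply]; linarith [Real.add_one_le_exp (η * x)]) hi3]
    have hs : ({0}ᶜ : Set ℝ) ⊆ Function.support (fun x => Real.exp (η * x) - (1 + η * x)) := by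
      intro x hx
      have hx' : η * x ≠ 0 := mul_ne_zero h0.ne' hx
      have := Real.add_one_lt_exp hx'
      exact ne_of_gt (by linarith)
    refine lt_of_lt_of_le ?_ (measure_mono hs)
    rw [prob_compl_eq_one_sub (measurableSet_singleton 0), measure_singleton]
    simp
  rw [integral_sub hi hi2, integral_add (integrable_const 1) (h.integrable_id.const_mul η),
    integral_const_mul, h.mean] at hpos
  simp at hpos
  linarith

lemma integral_comb (h : IsBalancedLaw μ ζ γ θ Cθ) {η : ℝ} (h0 : 0 < η) (hη : 2 * η ≤ γ)
    (A B D F : ℝ) :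
    Integrable (fun x => A + B * x + D * Real.exp (η * x) + F * Real.exp (2 * η * x)) μ ∧
      ∫ x, (A + B * x + D * Real.exp (η * x) + F * Real.exp (2 * η * x)) ∂μ
        = A + D * ∫ x, Real.exp (η * x) ∂μ + F * ∫ x, Real.exp (2 * η * x) ∂μ := by
  have := h.prob
  have h1 : Integrable (fun x => A + B * x) μ :=
    (integrable_const A).add (h.integrable_id.const_mul B)
  have h2 := (h.integrable_exp_mul h0.le (by linarith : η ≤ γ)).const_mul D
  have h3 := (h.integrable_exp_mul (by linarith : 0 ≤ 2 * η) hη).const_mul F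
  have h12 : Integrable (fun x => A + B * x + D * Real.exp (η * x)) μ := h1.add h2
  refine ⟨h12.add h3, ?_⟩
  rw [integral_add h12 h3, integral_add h1 h2,
    integral_add (integrable_const A) (h.integrable_id.const_mul B), integral_const_mul,
    integral_const_mul, integral_const_mul, h.mean]
  simp

end IsBalancedLaw

/-- The transfer operator of the walk reflected at `wall`. -/
noncomputable def wallOp (μ : Measure ℝ) (F : ℝ → ℝ) (y : ℝ) : ℝ :=
  surv y * ∫ x, F (wall y + x) ∂μ

lemma wallOp_mono {μ : Measure ℝ} {F G : ℝ → ℝ} (hF : ∀ s, Integrable (fun x => F (s + x)) μ)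
    (hG : ∀ s, Integrable (fun x => G (s + x)) μ) (hFG : ∀ x, F x ≤ G x) (y : ℝ) :
    wallOp μ F y ≤ wallOp μ G y :=
  mul_le_mul_of_nonneg_left (integral_mono (hF _) (hG _) fun _ => hFG _) (surv_pos y).le

lemma wallOp_nonneg {μ : Measure ℝ} {F : ℝ → ℝ} (hF : ∀ x, 0 ≤ F x) (y : ℝ) :
    0 ≤ wallOp μ F y :=
  mul_nonneg (surv_pos y).le (integral_nonneg fun _ => hF _)

lemma wallOp_antitone {μ : Measure ℝ} {F : ℝ → ℝ} (hF : ∀ s, Integrable (fun x => F (s + x)) μ)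
    (h0 : ∀ x, 0 ≤ F x) (ha : Antitone F) : Antitone (wallOp μ F) := fun a b hab => by
  refine mul_le_mul (surv_antitone hab) ?_ (integral_nonneg fun _ => h0 _) (surv_pos a).le
  exact integral_mono (hF _) (hF _) fun x => ha (by linarith [wall_monotone hab])

/-- An antitone nonnegative supersolution above a subsolution yields a fixed point in between. -/
lemma exists_wallOp_fixedPoint {μ : Measure ℝ} {W w : ℝ → ℝ}
    (hW : ∀ s, Integrable (fun x => W (s + x)) μ) (hw : ∀ s, Integrable (fun x => w (s + x)) μ)
    (hWa : Antitone W) (hw0 : ∀ x, 0 ≤ w x) (hwW : ∀ x, w x ≤ W x)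
    (hsup : ∀ y, wallOp μ W y ≤ W y) (hsub : ∀ y, w y ≤ wallOp μ w y) :
    ∃ V : ℝ → ℝ, Antitone V ∧ (∀ y, w y ≤ V y) ∧ (∀ y, V y ≤ W y) ∧
      ∀ y, V y = wallOp μ V y := by
  set v : ℕ → ℝ → ℝ := fun n => (wallOp μ)^[n] W with hv
  have hvs : ∀ n, v (n + 1) = wallOp μ (v n) := fun n => Function.iterate_succ_apply' _ _ _
  have hint : ∀ F : ℝ → ℝ, Antitone F → (∀ x, 0 ≤ F x) → (∀ x, F x ≤ W x) →
      ∀ s, Integrable (fun x => F (s + x)) μ := by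
    intro F ha h0 h1 s
    refine (hW s).mono' (ha.measurable.comp (measurable_const_add s)).aestronglyMeasurable
      (ae_of_all _ fun x => ?_)
    rw [Real.norm_eq_abs, abs_of_nonneg (h0 _)]
    exact h1 _
  have key : ∀ n, Antitone (v n) ∧ (∀ x, w x ≤ v n x) ∧ (∀ x, v n x ≤ W x) := by
    intro n
    induction n with
    | zero => exact ⟨hWa, hwW, fun x => le_rfl⟩
    | succ n ih =>
      obtain ⟨ha, h1, h2⟩ := ih
      have h0 : ∀ x, 0 ≤ v n x := fun x => (hw0 x).trans (h1 x)
      have hi := hint _ ha h0 h2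
      rw [hvs]
      exact ⟨wallOp_antitone hi h0 ha, fun x => (hsub x).trans (wallOp_mono hw hi h1 x),
        fun x => (wallOp_mono hi hW h2 x).trans (hsup x)⟩
  have hi : ∀ n s, Integrable (fun x => v n (s + x)) μ := fun n =>
    hint _ (key n).1 (fun x => (hw0 x).trans ((key n).2.1 x)) (key n).2.2
  have hdec : ∀ n x, v (n + 1) x ≤ v n x := by
    intro n
    induction n with
    | zero => intro x; rw [hvs]; exact hsup x
    | succ n ih =>
      intro x
      have := wallOp_mono (hi (n + 1)) (hi n) ih x
      rwa [← hvs (n + 1), ← hvs n] at this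
  have hlim : ∀ x, Tendsto (fun n => v n x) atTop (nhds (⨅ n, v n x)) := fun x =>
    tendsto_atTop_ciInf (antitone_nat_of_succ_le fun n => hdec n x)
      ⟨w x, by rintro _ ⟨n, rfl⟩; exact (key n).2.1 x⟩
  refine ⟨fun x => ⨅ n, v n x, fun a b hab => ?_, fun y => ?_, fun y => ?_, fun y => ?_⟩
  · exact le_of_tendsto_of_tendsto' (hlim b) (hlim a) fun n => (key n).1 hab
  · exact ge_of_tendsto' (hlim y) fun n => (key n).2.1 y
  · exact le_of_tendsto' (hlim y) fun n => (key n).2.2 y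
  · refine tendsto_nhds_unique ((hlim y).comp (tendsto_add_atTop_nat 1)) ?_
    have : Tendsto (fun n => ∫ x, v n (wall y + x) ∂μ) atTop
        (nhds (∫ x, (⨅ n, v n (wall y + x)) ∂μ)) := by
      refine tendsto_integral_of_dominated_convergence (fun x => W (wall y + x))
        (fun n => (hi n _).aestronglyMeasurable) (hW _) (fun n => ae_of_all _ fun x => ?_)
        (ae_of_all _ fun x => hlim _)
      rw [Real.norm_eq_abs, abs_of_nonneg ((hw0 _).trans ((key n).2.1 _))]
      exact (key n).2.2 _
    simp only [Function.comp_def, hvs]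
    exact this.const_mul (surv y)

namespace IsBalancedLaw

variable {μ : Measure ℝ} {ζ : ℝ → ℝ} {γ θ Cθ : ℝ}

lemma integrable_shift_wall (h : IsBalancedLaw μ ζ γ θ Cθ) (s : ℝ) :
    Integrable (fun x => wall (s + x)) μ := by
  refine integrable_shift (C := 1 + 1 / γ) h.γ_pos.le h.exp_int continuous_wall.measurable
    (fun x => ?_) s
  have := abs_wall_le x
  have := one_add_abs_le_exp h.γ_pos x
  linarith

lemma integrable_shift_exp_wall (h : IsBalancedLaw μ ζ γ θ Cθ) {η : ℝ} (hη : 0 ≤ η) (s : ℝ) :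
    Integrable (fun x => Real.exp (η * wall (s + x))) μ := by
  have := h.prob
  have hm : Measurable fun x => Real.exp (η * wall (s + x)) :=
    ((continuous_wall.measurable.comp (measurable_const_add s)).const_mul η).exp
  refine (integrable_const (1 : ℝ)).mono' hm.aestronglyMeasurable (ae_of_all _ fun x => ?_)
  rw [Real.norm_eq_abs, abs_of_pos (Real.exp_pos _), Real.exp_le_one_iff]
  exact mul_nonpos_of_nonneg_of_nonpos hη (wall_neg _).le

lemma exp_mul_add_eq (η s x : ℝ) :
    Real.exp (η * (s + x)) = Real.exp (η * s) * Real.exp (η * x) := by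
  rw [← Real.exp_add]; ring_nf

lemma exp_two_mul (η s : ℝ) : Real.exp (2 * η * s) = Real.exp (η * s) ^ 2 := by
  rw [← Real.exp_nat_mul]; push_cast; ring_nf

/-- A supersolution for `wallOp`, equal to `-wall` up to a bounded correction. -/
lemma wallOp_super_le (h : IsBalancedLaw μ ζ γ θ Cθ) {η m₁ m₂ b b' e₀ : ℝ} (h0 : 0 < η)
    (hη2 : η ≤ 1 / 2) (hηγ : 2 * η ≤ γ) (hm₁ : m₁ = ∫ x, Real.exp (η * x) ∂μ)
    (hm₂ : m₂ = ∫ x, Real.exp (2 * η * x) ∂μ) (hb' : 0 < b') (hb0 : 0 ≤ b) (he₀ : 0 < e₀)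
    (hbd : b' * (m₁ - 1) = 2 * m₁ / η) (he : η * (b' * m₂ * e₀) = m₁) (hm₂0 : 0 < m₂)
    (hbq : b' * m₂ ≤ e₀ ^ (1 / η) * b) (y : ℝ) :
    wallOp μ (fun y => -wall y + b + b' * (1 - Real.exp (η * wall y))) y
      ≤ -wall y + b + b' * (1 - Real.exp (η * wall y)) := by
  have := h.prob
  set s := wall y with hs
  set E := Real.exp (η * s) with hE
  have hEpos : 0 < E := Real.exp_pos _
  have hE1 : E ≤ 1 := by
    rw [hE, Real.exp_le_one_iff]
    exact mul_nonpos_of_nonneg_of_nonpos h0.le (wall_neg y).le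
  have hE2 : Real.exp (2 * η * s) = E ^ 2 := exp_two_mul η s
  obtain ⟨hi, hv⟩ := h.integral_comb h0 hηγ (-s + b + b') (-1) (E / η - b' * E) (b' * E ^ 2)
  have hle : ∫ x, (-wall (s + x) + b + b' * (1 - Real.exp (η * wall (s + x)))) ∂μ
      ≤ (-s + b + b') + (E / η - b' * E) * m₁ + (b' * E ^ 2) * m₂ := by
    rw [hm₁, hm₂, ← hv]
    have hi1 : Integrable (fun x => -wall (s + x) + b) μ :=
      (h.integrable_shift_wall s).neg.add (integrable_const b)
    have hi2 : Integrable (fun x => b' * (1 - Real.exp (η * wall (s + x)))) μ :=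
      ((integrable_const 1).sub (h.integrable_shift_exp_wall h0.le s)).const_mul b'
    refine integral_mono (hi1.add hi2) hi fun x => ?_
    have h1 := log_one_add_exp_le_exp h0 (by linarith) (s + x)
    have h2 := exp_mul_wall_ge h0 (by linarith) (s + x)
    have h3 : wall (s + x) = s + x - Real.log (1 + Real.exp (s + x)) := rfl
    rw [exp_mul_add_eq] at h1
    rw [exp_mul_add_eq, exp_mul_add_eq (2 * η), hE2] at h2
    have h4 := mul_le_mul_of_nonneg_left h2 hb'.le
    have h5 : Real.exp (η * s) * Real.exp (η * x) / η = E / η * Real.exp (η * x) := by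
      rw [← hE]; ring
    simp only
    nlinarith
  have hW : 0 ≤ b' * (1 - E) := mul_nonneg hb'.le (by linarith)
  have hs0 : s < 0 := wall_neg y
  set X := -s + b + b' * (1 - E) with hX
  have hX0 : b ≤ X := by linarith
  have hint : ∫ x, (-wall (s + x) + b + b' * (1 - Real.exp (η * wall (s + x)))) ∂μ
      ≤ X + (b' * m₂ * E ^ 2 - m₁ / η * E) := by
    refine hle.trans_eq ?_
    have : b' * m₁ = b' + 2 * m₁ / η := by linarith
    rw [hX]
    linear_combination (-E) * this
  unfold wallOp
  rw [← hs]
  refine (mul_le_mul_of_nonneg_left hint (surv_pos y).le).trans ?_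
  have hm₁' : m₁ / η = b' * m₂ * e₀ := by rw [← he]; field_simp
  rw [hm₁']
  rcases le_total E e₀ with hc | hc
  · have : b' * m₂ * E ^ 2 - b' * m₂ * e₀ * E ≤ 0 := by
      have : 0 ≤ b' * m₂ * E * (e₀ - E) :=
        mul_nonneg (by positivity) (by linarith)
      nlinarith
    calc surv y * (X + (b' * m₂ * E ^ 2 - b' * m₂ * e₀ * E)) ≤ surv y * X :=
          mul_le_mul_of_nonneg_left (by linarith) (surv_pos y).le
      _ ≤ 1 * X := mul_le_mul_of_nonneg_right (surv_le_one y) (by linarith)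
      _ = X := one_mul X
  · have hq : e₀ ^ (1 / η) ≤ 1 - surv y := by
      rw [← exp_wall, ← hs]
      have : Real.exp s = E ^ (1 / η) := by
        rw [hE, ← Real.exp_mul]; field_simp
      rw [this]
      exact Real.rpow_le_rpow he₀.le hc (by positivity)
    have h1 : b' * m₂ * E ^ 2 - b' * m₂ * e₀ * E ≤ b' * m₂ := by
      have h1 : E ^ 2 ≤ 1 := by nlinarith
      have h2 : 0 ≤ b' * m₂ := by positivity
      have h3 : 0 ≤ b' * m₂ * e₀ * E := by positivity
      nlinarith
    have h2 : b' * m₂ ≤ e₀ ^ (1 / η) * X :=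
      hbq.trans (mul_le_mul_of_nonneg_left hX0 (by positivity))
    have h3 : 0 ≤ e₀ ^ (1 / η) := by positivity
    have h4 : e₀ ^ (1 / η) * X ≤ (1 - surv y) * X :=
      mul_le_mul_of_nonneg_right hq (by linarith)
    have h5 := surv_pos y
    have h6 : surv y * (X + (b' * m₂ * E ^ 2 - b' * m₂ * e₀ * E)) ≤ surv y * X + b' * m₂ := by
      have h7 : surv y * (b' * m₂ * E ^ 2 - b' * m₂ * e₀ * E) ≤ surv y * (b' * m₂) :=
        mul_le_mul_of_nonneg_left h1 h5.le
      have h8 : surv y * (b' * m₂) ≤ 1 * (b' * m₂) :=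
        mul_le_mul_of_nonneg_right (surv_le_one y) (by positivity)
      linarith
    linarith

/-- A subsolution for `wallOp`, equal to `-wall` up to a bounded correction. -/
lemma le_wallOp_sub (h : IsBalancedLaw μ ζ γ θ Cθ) {η m₁ m₂ b : ℝ} (h0 : 0 < η)
    (hη2 : η ≤ 1 / 2) (hηγ : 2 * η ≤ γ) (hm₁ : m₁ = ∫ x, Real.exp (η * x) ∂μ)
    (hm₂ : m₂ = ∫ x, Real.exp (2 * η * x) ∂μ) (hm₁1 : 1 < m₁) (hb : 1 ≤ b)
    (hbS : ∀ S, b - 1 ≤ S → Real.exp (-S) ≤ 1 / 2 ∧ m₂ * Real.exp (-(η * S)) ≤ (m₁ - 1) / 2 ∧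
      S * Real.exp (-S / 2) ≤ (m₁ - 1) / 4) (y : ℝ) :
    max (-wall y - b + Real.exp (η * wall y)) 0
      ≤ wallOp μ (fun y => max (-wall y - b + Real.exp (η * wall y)) 0) y := by
  have := h.prob
  rcases le_or_gt (-wall y - b + Real.exp (η * wall y)) 0 with hX | hX
  · rw [max_eq_right hX]
    exact wallOp_nonneg (fun x => le_max_right _ _) y
  rw [max_eq_left hX.le]
  set s := wall y with hs
  set E := Real.exp (η * s) with hE
  have hEpos : 0 < E := Real.exp_pos _
  have hs0 : s < 0 := wall_neg y
  have hE1 : E ≤ 1 := by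
    rw [hE, Real.exp_le_one_iff]
    exact mul_nonpos_of_nonneg_of_nonpos h0.le hs0.le
  have hE2 : Real.exp (2 * η * s) = E ^ 2 := exp_two_mul η s
  obtain ⟨hi, hv⟩ := h.integral_comb h0 hηγ (-s - b) (-1) E (-E ^ 2)
  have hi1 : Integrable (fun x => -wall (s + x) - b + Real.exp (η * wall (s + x))) μ :=
    ((h.integrable_shift_wall s).neg.sub (integrable_const b)).add
      (h.integrable_shift_exp_wall h0.le s)
  have hle : (-s - b) + E * m₁ + (-E ^ 2) * m₂
      ≤ ∫ x, max (-wall (s + x) - b + Real.exp (η * wall (s + x))) 0 ∂μ := by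
    rw [hm₁, hm₂, ← hv]
    refine integral_mono hi hi1.pos_part fun x => le_max_of_le_left ?_
    have h2 := exp_mul_wall_ge h0 (by linarith) (s + x)
    have h3 := wall_le (s + x)
    rw [exp_mul_add_eq, exp_mul_add_eq (2 * η), hE2] at h2
    simp only
    linarith
  unfold wallOp
  rw [← hs]
  refine le_trans ?_ (mul_le_mul_of_nonneg_left hle (surv_pos y).le)
  obtain ⟨h1, h2, h3⟩ := hbS (-s) (by linarith)
  have hsv : surv y = 1 - Real.exp s := by rw [hs, exp_wall]; ring
  rw [neg_neg] at h1 h3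
  have h2' : m₂ * E ≤ (m₁ - 1) / 2 := by
    rw [hE]; convert h2 using 3; ring
  have h4 : Real.exp s ≤ Real.exp (s / 2) * E := by
    rw [hE, ← Real.exp_add]
    apply Real.exp_le_exp.2
    nlinarith
  have h5 : Real.exp s * (-s - b + E) ≤ (m₁ - 1) / 4 * E := by
    calc Real.exp s * (-s - b + E) ≤ (Real.exp (s / 2) * E) * (-s) := by
          apply mul_le_mul h4 (by linarith) hX.le (by positivity)
      _ = (-s * Real.exp (s / 2)) * E := by ring
      _ ≤ _ := mul_le_mul_of_nonneg_right h3 hEpos.le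
  have h6 : (m₁ - 1) / 4 * E ≤ (1 - Real.exp s) * (E * ((m₁ - 1) - m₂ * E)) := by
    have h7 : E * ((m₁ - 1) / 2) ≤ E * ((m₁ - 1) - m₂ * E) :=
      mul_le_mul_of_nonneg_left (by linarith) hEpos.le
    have h8 : 0 ≤ E * ((m₁ - 1) / 2) := by
      have : 0 < m₁ - 1 := by linarith
      positivity
    have h9 : 1 / 2 ≤ 1 - Real.exp s := by linarith
    nlinarith
  rw [hsv]
  nlinarith

/-- The transfer operator reflected at the wall has a positive fixed point asymptotic to `-y`. -/
theorem exists_fixedPoint (h : IsBalancedLaw μ ζ γ θ Cθ) :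
    ∃ (V : ℝ → ℝ) (C : ℝ), Antitone V ∧ (∀ y, 0 ≤ V y) ∧
      (∀ y, V y = surv y * ∫ x, V (wall y + x) ∂μ) ∧ ∀ y, |V y + wall y| ≤ C := by
  have := h.prob
  have hγ := h.γ_pos
  set η := min (1 / 2) (γ / 2) with hη
  have h0 : 0 < η := by positivity
  have hη2 : η ≤ 1 / 2 := min_le_left _ _
  have hηγ : 2 * η ≤ γ := by have := min_le_right (1 / 2) (γ / 2); linarith
  set m₁ := ∫ x, Real.exp (η * x) ∂μ with hm₁
  set m₂ := ∫ x, Real.exp (2 * η * x) ∂μ with hm₂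
  have hm₁1 : 1 < m₁ := h.one_lt_integral_exp h0 (by linarith)
  have hm₂1 : 1 < m₂ := h.one_lt_integral_exp (by linarith) hηγ
  set b' := 2 * m₁ / η / (m₁ - 1) with hb'
  have hd : 0 < m₁ - 1 := by linarith
  have hb'0 : 0 < b' := by positivity
  set e₀ := m₁ / (η * b' * m₂) with he₀
  have he₀0 : 0 < e₀ := by positivity
  set b := b' * m₂ / e₀ ^ (1 / η) with hb
  have hb0 : 0 ≤ b := by positivity
  have hsup := h.wallOp_super_le (b := b) h0 hη2 hηγ hm₁ hm₂ hb'0 hb0 he₀0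
    (by rw [hb']; field_simp) (by rw [he₀]; field_simp) (by linarith)
    (by rw [hb]; field_simp; exact le_rfl)
  obtain ⟨b₂, hb₂1, hbS⟩ : ∃ b, 1 ≤ b ∧ ∀ S, b - 1 ≤ S → Real.exp (-S) ≤ 1 / 2 ∧
      m₂ * Real.exp (-(η * S)) ≤ (m₁ - 1) / 2 ∧ S * Real.exp (-S / 2) ≤ (m₁ - 1) / 4 := by
    have t1 : Tendsto (fun S : ℝ => Real.exp (-S)) atTop (nhds 0) :=
      Real.tendsto_exp_neg_atTop_nhds_zero
    have t2 : Tendsto (fun S : ℝ => m₂ * Real.exp (-(η * S))) atTop (nhds 0) := by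
      have := (t1.comp (tendsto_id.const_mul_atTop h0)).const_mul m₂
      simpa using this
    have t3 : Tendsto (fun S : ℝ => S * Real.exp (-S / 2)) atTop (nhds 0) := by
      have := ((Real.tendsto_pow_mul_exp_neg_atTop_nhds_zero 1).comp
        (tendsto_id.const_mul_atTop (by norm_num : (0 : ℝ) < 1 / 2))).const_mul 2
      rw [mul_zero] at this
      refine this.congr fun S => ?_
      simp only [Function.comp, id, pow_one]
      ring_nf
    obtain ⟨S₀, hS₀⟩ := eventually_atTop.1
      (((t1.eventually (ge_mem_nhds (by norm_num : (0 : ℝ) < 1 / 2))).and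
        ((t2.eventually (ge_mem_nhds (by linarith : 0 < (m₁ - 1) / 2))).and
        (t3.eventually (ge_mem_nhds (by linarith : 0 < (m₁ - 1) / 4))))))
    exact ⟨max S₀ 0 + 1, by linarith [le_max_right S₀ 0], fun S hS =>
      hS₀ S (by linarith [le_max_left S₀ 0])⟩
  have hsub := h.le_wallOp_sub h0 hη2 hηγ hm₁ hm₂ hm₁1 hb₂1 hbS
  have hexp1 : ∀ y, Real.exp (η * wall y) ≤ 1 := fun y => by
    rw [Real.exp_le_one_iff]
    exact mul_nonpos_of_nonneg_of_nonpos h0.le (wall_neg y).le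
  obtain ⟨V, hVa, hwV, hVW, hV⟩ := exists_wallOp_fixedPoint (μ := μ)
    (W := fun y => -wall y + b + b' * (1 - Real.exp (η * wall y)))
    (w := fun y => max (-wall y - b₂ + Real.exp (η * wall y)) 0)
    (fun s => ((h.integrable_shift_wall s).neg.add (integrable_const b)).add
      (((integrable_const 1).sub (h.integrable_shift_exp_wall h0.le s)).const_mul b'))
    (fun s => (((h.integrable_shift_wall s).neg.sub (integrable_const b₂)).add
      (h.integrable_shift_exp_wall h0.le s)).pos_part)
    (fun x y hxy => by
      have h1 := wall_monotone hxy
      have h2 : Real.exp (η * wall x) ≤ Real.exp (η * wall y) :=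
        Real.exp_le_exp.2 (mul_le_mul_of_nonneg_left h1 h0.le)
      have h3 := mul_le_mul_of_nonneg_left h2 hb'0.le
      simp only
      linarith)
    (fun x => le_max_right _ _)
    (fun x => by
      have h1 := wall_neg x
      have h2 := hexp1 x
      have h3 : 0 ≤ b' * (1 - Real.exp (η * wall x)) := mul_nonneg hb'0.le (by linarith)
      exact max_le (by linarith) (by linarith))
    hsup hsub
  refine ⟨V, b₂ + b + b', hVa, fun y => (le_max_right _ _).trans (hwV y), hV, fun y => ?_⟩
  have h1 := (le_max_left _ _).trans (hwV y)
  have h2 := hVW y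
  have h3 := Real.exp_pos (η * wall y)
  have h4 : b' * (1 - Real.exp (η * wall y)) ≤ b' := by nlinarith
  rw [abs_le]
  constructor <;> linarith

end IsBalancedLaw

namespace IsBalancedLaw

variable {μ : Measure ℝ} {ζ : ℝ → ℝ} {γ θ Cθ : ℝ}

lemma integrable_mul_sqrt_density (h : IsBalancedLaw μ ζ γ θ Cθ) :
    Integrable fun x => (1 + |x|) * √(ζ x) := by
  have h1 : Integrable fun x => ζ x * (1 + |x|) ^ 4 := by
    rw [← h.integrable_iff]
    refine integrable_of_abs_le_exp (C := 1 + 4 * (1 / γ) + 6 * (2 / γ ^ 2) + 4 * (6 / γ ^ 3)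
      + 24 / γ ^ 4) h.exp_int (by fun_prop) fun x => ?_
    rw [abs_of_nonneg (by positivity)]
    have e0 : 1 ≤ Real.exp (γ * |x|) :=
      Real.one_le_exp (mul_nonneg h.γ_pos.le (abs_nonneg x))
    have e1 := abs_pow_le_exp h.γ_pos 1 x
    have e2 := abs_pow_le_exp h.γ_pos 2 x
    have e3 := abs_pow_le_exp h.γ_pos 3 x
    have e4 := abs_pow_le_exp h.γ_pos 4 x
    norm_num [Nat.factorial] at e1 e2 e3 e4
    have e5 : (1 + |x|) ^ 4 = 1 + 4 * |x| + 6 * x ^ 2 + 4 * |x| ^ 3 + |x| ^ 4 := by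
      rw [← sq_abs x]; ring
    rw [e5]
    have e4' : |x| ^ 4 ≤ 24 / γ ^ 4 * Real.exp (γ * |x|) := by simpa using e4
    rw [inv_eq_one_div] at e1
    linarith
  have h2 : Integrable fun x : ℝ => (1 + ‖x‖) ^ (-2 : ℝ) :=
    integrable_one_add_norm (by simp)
  refine (h1.add h2).mono' (by have := h.meas; fun_prop) (ae_of_all _ fun x => ?_)
  have hx : 0 < 1 + |x| := by positivity
  rw [Real.norm_eq_abs, abs_of_nonneg (by positivity)]
  simp only [Pi.add_apply, Real.norm_eq_abs]
  rw [Real.rpow_neg hx.le, Real.rpow_two]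
  have hs := Real.sq_sqrt (h.nonneg x)
  set a := (1 + |x|) ^ 2 * √(ζ x) with ha
  have e1 : ζ x * (1 + |x|) ^ 4 = a ^ 2 := by rw [ha, mul_pow, hs]; ring
  have e2 : (1 + |x|) * √(ζ x) = a * (1 + |x|)⁻¹ := by rw [ha]; field_simp
  rw [e1, e2, ← inv_pow]
  have : 0 ≤ a * (1 + |x|)⁻¹ := by positivity
  nlinarith [sq_nonneg (a - (1 + |x|)⁻¹)]

/-- Averaging against a law with Hölder density regularises functions of linear growth. -/
lemma exists_integral_shift_holder (h : IsBalancedLaw μ ζ γ θ Cθ) {V : ℝ → ℝ}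
    (hV : Measurable V) {C : ℝ} (hb : ∀ x, |V x| ≤ C * (1 + |x|)) :
    ∃ C', 0 ≤ C' ∧ ∀ s t, |s - t| ≤ 1 →
      |∫ x, V (s + x) ∂μ - ∫ x, V (t + x) ∂μ| ≤ C' * (1 + |s|) * |s - t| ^ (θ / 2) := by
  have hC : 0 ≤ C := by
    have := (abs_nonneg _).trans (hb 0)
    simpa using this
  have hγ := h.γ_pos
  set Φ : ℝ → ℝ := fun x => (1 + |x|) * √(ζ x) with hΦ
  have hΦi : Integrable Φ := h.integrable_mul_sqrt_density
  have hI : 0 ≤ ∫ x, Φ x := integral_nonneg fun x => by positivity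
  refine ⟨C * √Cθ * (3 * ∫ x, Φ x), by positivity, fun s t hst => ?_⟩
  have hexp : ∀ x, |V x| ≤ (C * (1 + 1 / γ)) * Real.exp (γ * |x|) := fun x => by
    have := mul_le_mul_of_nonneg_left (one_add_abs_le_exp hγ x) hC
    linarith [hb x]
  have hint : ∀ u, Integrable fun x => ζ x * V (u + x) := fun u => by
    rw [← h.integrable_iff (fun x => V (u + x))]
    exact integrable_shift hγ.le h.exp_int hV hexp u
  have hshift : ∀ x, (fun x => ζ x * V (t + x)) (x + (s - t)) = ζ (x + (s - t)) * V (s + x) :=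
    fun x => by
      change ζ (x + (s - t)) * V (t + (x + (s - t))) = _
      congr 2; ring
  have e2 : ∫ x, ζ x * V (t + x) = ∫ x, ζ (x + (s - t)) * V (s + x) := by
    rw [← integral_add_right_eq_self _ (s - t)]
    exact integral_congr_ae (ae_of_all _ hshift)
  have hint2 : Integrable fun x => ζ (x + (s - t)) * V (s + x) := by
    have := (hint t).comp_add_right (s - t)
    exact this.congr (ae_of_all _ hshift)
  rw [h.integral_eq, h.integral_eq, e2, ← integral_sub (hint s) hint2]
  set τ := s - t with hτ
  set D := C * (1 + |s|) * (√Cθ * |τ| ^ (θ / 2)) with hD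
  have hD0 : 0 ≤ D := by positivity
  have hΦ2 : Integrable fun x => D * (2 * Φ (x + τ) + Φ x) :=
    (((hΦi.comp_add_right τ).const_mul 2).add hΦi).const_mul D
  have hbound : ∀ x, ‖ζ x * V (s + x) - ζ (x + τ) * V (s + x)‖ ≤ D * (2 * Φ (x + τ) + Φ x) := by
    intro x
    rw [← sub_mul, Real.norm_eq_abs, abs_mul]
    have e1 : |V (s + x)| ≤ C * ((1 + |s|) * (1 + |x|)) := by
      refine (hb _).trans (mul_le_mul_of_nonneg_left ?_ hC)
      nlinarith [abs_add_le s x, mul_nonneg (abs_nonneg s) (abs_nonneg x)]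
    have e3 : |ζ x - ζ (x + τ)| ≤ (√Cθ * |τ| ^ (θ / 2)) * (√(ζ (x + τ)) + √(ζ x)) := by
      have f1 : |ζ x - ζ (x + τ)| ≤ Cθ * |τ| ^ θ := by
        refine (h.holder _ _).trans_eq ?_
        rw [← abs_neg]; ring_nf
      have f2 : |ζ x - ζ (x + τ)| ≤ (√(ζ (x + τ)) + √(ζ x)) ^ 2 := by
        have g1 := Real.sq_sqrt (h.nonneg x)
        have g2 := Real.sq_sqrt (h.nonneg (x + τ))
        have g3 : 0 ≤ √(ζ (x + τ)) * √(ζ x) := by positivity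
        rw [abs_le]
        constructor <;> nlinarith [h.nonneg x, h.nonneg (x + τ)]
      have f3 : (√Cθ * |τ| ^ (θ / 2)) ^ 2 = Cθ * |τ| ^ θ := by
        rw [mul_pow, Real.sq_sqrt h.Cθ_nonneg, ← Real.rpow_natCast, ← Real.rpow_mul (abs_nonneg _)]
        norm_num
      refine abs_le_of_sq_le_sq' ?_ (by positivity) |>.2
      rw [mul_pow, f3, sq]
      exact mul_le_mul f1 f2 (abs_nonneg _) (by have := h.Cθ_nonneg; positivity)
    have e4 : 1 + |x| ≤ 2 * (1 + |x + τ|) := by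
      have := abs_sub_abs_le_abs_sub x (x + τ)
      rw [show x - (x + τ) = -τ by ring, abs_neg] at this
      linarith [abs_nonneg (x + τ)]
    calc |ζ x - ζ (x + τ)| * |V (s + x)|
        ≤ ((√Cθ * |τ| ^ (θ / 2)) * (√(ζ (x + τ)) + √(ζ x))) * (C * ((1 + |s|) * (1 + |x|))) :=
          mul_le_mul e3 e1 (abs_nonneg _) (by positivity)
      _ = D * ((1 + |x|) * √(ζ (x + τ)) + Φ x) := by rw [hD, hΦ]; ring
      _ ≤ D * (2 * (1 + |x + τ|) * √(ζ (x + τ)) + Φ x) := by gcongr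
      _ = D * (2 * Φ (x + τ) + Φ x) := by rw [hΦ]; ring
  refine (norm_integral_le_of_norm_le hΦ2 (ae_of_all _ hbound)).trans_eq ?_
  rw [integral_const_mul, integral_add ((hΦi.comp_add_right τ).const_mul 2) hΦi,
    integral_const_mul, integral_add_right_eq_self Φ τ, hD]
  ring

section FixedPoint

variable {V : ℝ → ℝ} {C : ℝ}

lemma abs_le_of_fixedPoint (hVw : ∀ y, |V y + wall y| ≤ C) (y : ℝ) :
    |V y| ≤ (C + 1) * (1 + |y|) := by
  have h1 := abs_sub_abs_le_abs_sub (V y) (-wall y)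
  rw [sub_neg_eq_add, abs_neg] at h1
  have h2 := abs_wall_le y
  have h3 := hVw y
  have h4 := (abs_nonneg _).trans h3
  nlinarith [abs_nonneg y]

lemma abs_add_id_le_of_fixedPoint (hVw : ∀ y, |V y + wall y| ≤ C) (y : ℝ) :
    |V y + y| ≤ (C + 1) + max y 0 := by
  have h1 := abs_add_le (V y + wall y) (Real.log (1 + Real.exp y))
  have h2 : V y + wall y + Real.log (1 + Real.exp y) = V y + y := by rw [wall]; ring
  rw [h2, abs_of_pos (log_one_add_exp_pos y)] at h1
  linarith [hVw y, log_one_add_exp_le y]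

lemma continuous_fixedPoint (h : IsBalancedLaw μ ζ γ θ Cθ) (hVm : Measurable V)
    (hV : ∀ y, V y = surv y * ∫ x, V (wall y + x) ∂μ) (hVw : ∀ y, |V y + wall y| ≤ C) :
    Continuous V := by
  obtain ⟨C', _, hH⟩ := h.exists_integral_shift_holder hVm (abs_le_of_fixedPoint hVw)
  have hθ := h.θ_pos
  have hU : Continuous fun s => ∫ x, V (s + x) ∂μ := by
    rw [continuous_iff_continuousAt]
    intro s
    rw [ContinuousAt, tendsto_iff_dist_tendsto_zero]
    have hlim : Tendsto (fun t => C' * (1 + |s|) * |s - t| ^ (θ / 2)) (nhds s) (nhds 0) := by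
      have hc : Continuous fun t : ℝ => C' * (1 + |s|) * |s - t| ^ (θ / 2) :=
        continuous_const.mul ((by fun_prop : Continuous fun t : ℝ => |s - t|).rpow_const
          fun _ => Or.inr (by positivity))
      have := hc.tendsto s
      simpa [Real.zero_rpow (by positivity : θ / 2 ≠ 0)] using this
    refine squeeze_zero' (Eventually.of_forall fun _ => dist_nonneg) ?_ hlim
    filter_upwards [Metric.ball_mem_nhds s one_pos] with t ht
    rw [Metric.mem_ball, dist_comm, Real.dist_eq] at ht
    rw [dist_comm, Real.dist_eq]
    exact hH s t ht.le
  have : V = fun y => surv y * ∫ x, V (wall y + x) ∂μ := funext hV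
  rw [this]
  exact continuous_surv.mul (hU.comp continuous_wall)

lemma abs_integral_shift_le (h : IsBalancedLaw μ ζ γ θ Cθ) {A : ℝ}
    (hb : ∀ x, |V x| ≤ A * (1 + |x|)) (s : ℝ) :
    |∫ x, V (s + x) ∂μ| ≤ A * (1 + ∫ x, |x| ∂μ) * (1 + |s|) := by
  have := h.prob
  have hA : 0 ≤ A := by
    have := (abs_nonneg _).trans (hb 0)
    simpa using this
  have hi : Integrable (fun x => |x|) μ := h.integrable_id.abs
  have hi2 : Integrable (fun x => A * (1 + |s|) * (1 + |x|)) μ :=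
    ((integrable_const 1).add hi).const_mul _
  have hle : ∀ x, ‖V (s + x)‖ ≤ A * (1 + |s|) * (1 + |x|) := fun x => by
    refine (hb _).trans ?_
    rw [mul_assoc]
    refine mul_le_mul_of_nonneg_left ?_ hA
    nlinarith [abs_add_le s x, mul_nonneg (abs_nonneg s) (abs_nonneg x)]
  refine (norm_integral_le_of_norm_le hi2 (ae_of_all _ hle)).trans_eq ?_
  rw [integral_const_mul, integral_add (integrable_const 1) hi]
  simp
  ring

/-- The defect of harmonicity of `V y + y` for the free walk decays exponentially at `-∞`. -/
lemma exists_defect_le (h : IsBalancedLaw μ ζ γ θ Cθ) (hVm : Measurable V)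
    (hV : ∀ y, V y = surv y * ∫ x, V (wall y + x) ∂μ) (hVw : ∀ y, |V y + wall y| ≤ C) :
    ∃ γ₀, 0 < γ₀ ∧ ∀ η, 0 < η → η ≤ γ₀ → ∃ D, ∀ y,
      |V y + y| ≤ D * Real.exp (η * max y 0) ∧
      |(V y + y) - ∫ x, (V (y + x) + (y + x)) ∂μ| ≤ D * Real.exp (η * y) := by
  have := h.prob
  have hθ := h.θ_pos
  have hθ1 := h.θ_le
  have hγ := h.γ_pos
  have hlin := abs_le_of_fixedPoint hVw
  set A := C + 1 with hA
  have hC0 : 0 ≤ C := (abs_nonneg _).trans (hVw 0)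
  have hA0 : 0 ≤ A := by linarith
  obtain ⟨C', hC', hH⟩ := h.exists_integral_shift_holder hVm hlin
  set B := A * (1 + ∫ x, |x| ∂μ) with hB
  have hM : 0 ≤ ∫ x, |x| ∂μ := integral_nonneg fun x => abs_nonneg x
  have hB0 : 0 ≤ B := by positivity
  have hU := h.abs_integral_shift_le hlin
  have hr : ∀ y, (V y + y) - ∫ x, (V (y + x) + (y + x)) ∂μ = V y - ∫ x, V (y + x) ∂μ := by
    intro y
    have i1 : Integrable (fun x => V (y + x)) μ := by
      refine integrable_shift (C := A * (1 + 1 / γ)) hγ.le h.exp_int hVm (fun x => ?_) y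
      have := mul_le_mul_of_nonneg_left (one_add_abs_le_exp hγ x) hA0
      linarith [hlin x]
    have i2 : Integrable (fun x => y + x) μ := (integrable_const y).add h.integrable_id
    rw [integral_add i1 i2, integral_add (integrable_const y) h.integrable_id, h.mean]
    simp
  have hneg : ∀ y ≤ 0, |V y - ∫ x, V (y + x) ∂μ|
      ≤ (C' + B) * ((1 + 1 / (θ / 4)) * 2) * Real.exp (θ / 4 * y) := by
    intro y hy
    have e1 := hH (wall y) y (by
      rw [abs_sub_comm, abs_of_nonneg (by linarith [wall_le y])]
      have := Real.log_le_sub_one_of_pos (one_add_exp_pos y)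
      have := Real.exp_le_one_iff.2 hy
      unfold wall
      linarith)
    have e2 : |wall y - y| ≤ Real.exp y := by
      rw [abs_sub_comm, abs_of_nonneg (by linarith [wall_le y])]
      have := Real.log_le_sub_one_of_pos (one_add_exp_pos y)
      unfold wall
      linarith
    have e3 : |wall y - y| ^ (θ / 2) ≤ Real.exp (θ / 2 * y) := by
      refine (Real.rpow_le_rpow (abs_nonneg _) e2 (by positivity)).trans_eq ?_
      rw [← Real.exp_mul]; ring_nf
    have e4 : 1 - surv y ≤ Real.exp (θ / 2 * y) := by
      rw [← exp_wall]
      apply Real.exp_le_exp.2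
      nlinarith [wall_le y]
    have e5 : 1 + |wall y| ≤ (1 + 1 / (θ / 4)) * 2 * Real.exp (-(θ / 4) * y) := by
      have g1 := one_add_abs_le_exp (by positivity : 0 < θ / 4) y
      rw [abs_of_nonpos hy] at g1
      have g2 := abs_wall_le y
      rw [abs_of_nonpos hy] at g2
      have g3 : Real.exp (-(θ / 4) * y) = Real.exp (θ / 4 * -y) := by ring_nf
      rw [g3]
      linarith
    have e6 : V y - ∫ x, V (y + x) ∂μ = (∫ x, V (wall y + x) ∂μ - ∫ x, V (y + x) ∂μ)
        - (1 - surv y) * ∫ x, V (wall y + x) ∂μ := by rw [hV y]; ring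
    have e7 := surv_le_one y
    rw [e6]
    refine (abs_sub _ _).trans ?_
    rw [abs_mul, abs_of_nonneg (by linarith : 0 ≤ 1 - surv y)]
    have e8 : (1 + |wall y|) * Real.exp (θ / 2 * y)
        ≤ (1 + 1 / (θ / 4)) * 2 * Real.exp (θ / 4 * y) := by
      refine (mul_le_mul_of_nonneg_right e5 (Real.exp_pos _).le).trans_eq ?_
      rw [mul_assoc, ← Real.exp_add]
      ring_nf
    calc _ ≤ C' * (1 + |wall y|) * Real.exp (θ / 2 * y)
          + Real.exp (θ / 2 * y) * (B * (1 + |wall y|)) := by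
          refine add_le_add (e1.trans ?_) ?_
          · exact mul_le_mul_of_nonneg_left e3 (by positivity)
          · exact mul_le_mul e4 (hU _) (abs_nonneg _) (Real.exp_pos _).le
      _ = (C' + B) * ((1 + |wall y|) * Real.exp (θ / 2 * y)) := by ring
      _ ≤ (C' + B) * ((1 + 1 / (θ / 4)) * 2 * Real.exp (θ / 4 * y)) :=
          mul_le_mul_of_nonneg_left e8 (by positivity)
      _ = _ := by ring
  refine ⟨θ / 4, by positivity, fun η h0 hη => ?_⟩
  refine ⟨max (A * (1 + 1 / η) + (1 + 1 / η)) (max ((C' + B) * ((1 + 1 / (θ / 4)) * 2))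
    ((A + B) * (1 + 1 / η))), fun y => ⟨?_, ?_⟩⟩
  · refine (abs_add_id_le_of_fixedPoint hVw y).trans ?_
    have g1 := one_add_abs_le_exp h0 (max y 0)
    rw [abs_of_nonneg (le_max_right y 0)] at g1
    have g0 := le_max_right y 0
    refine le_trans ?_ (mul_le_mul_of_nonneg_right (le_max_left _ _) (Real.exp_pos _).le)
    have : A * (1 + max y 0) ≤ A * ((1 + 1 / η) * Real.exp (η * max y 0)) :=
      mul_le_mul_of_nonneg_left g1 hA0
    have : 0 ≤ A * max y 0 := by positivity
    linarith
  · rw [hr y]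
    refine le_trans ?_ (mul_le_mul_of_nonneg_right (le_max_right _ _) (Real.exp_pos _).le)
    rcases le_total y 0 with hy | hy
    · refine le_trans ?_ (mul_le_mul_of_nonneg_right (le_max_left _ _) (Real.exp_pos _).le)
      refine (hneg y hy).trans (mul_le_mul_of_nonneg_left ?_ (by positivity))
      exact Real.exp_le_exp.2 (by nlinarith)
    · refine le_trans ?_ (mul_le_mul_of_nonneg_right (le_max_right _ _) (Real.exp_pos _).le)
      have g1 := one_add_abs_le_exp h0 y
      rw [abs_of_nonneg hy] at g1
      have g2 := hlin y
      have g3 := hU y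
      rw [abs_of_nonneg hy] at g2 g3
      refine (abs_sub _ _).trans ?_
      have : (A + B) * (1 + y) ≤ (A + B) * ((1 + 1 / η) * Real.exp (η * y)) :=
        mul_le_mul_of_nonneg_left g1 (by positivity)
      linarith

end FixedPoint

end IsBalancedLaw

section Taylor

/-- The measure `𝐊` with `∫ H'' (y + x) d𝐊 = ∫ (H (y + z) - H y - z H' y) dμ`. -/
noncomputable def taylorMeasure (μ : Measure ℝ) : Measure ℝ :=
  ((μ.prod (volume.restrict (Icc (0 : ℝ) 1))).withDensity
    fun q => ENNReal.ofReal (q.1 ^ 2 * (1 - q.2))).map fun q => q.2 * q.1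

lemma measurable_taylorDensity :
    Measurable fun q : ℝ × ℝ => ENNReal.ofReal (q.1 ^ 2 * (1 - q.2)) := by fun_prop

lemma taylorMeasure_absolutelyContinuous {μ : Measure ℝ} [SFinite μ] [NullSingletonClass μ] :
    taylorMeasure μ ≪ volume := by
  refine Measure.AbsolutelyContinuous.mk fun N hN h0 => ?_
  have hm : Measurable fun q : ℝ × ℝ => q.2 * q.1 := by fun_prop
  rw [taylorMeasure, Measure.map_apply hm hN]
  refine withDensity_absolutelyContinuous _ _ ?_
  rw [Measure.measure_prod_null (hm hN)]
  have hne : ∀ᵐ x ∂μ, x ≠ 0 := by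
    rw [ae_iff]
    simp
  filter_upwards [hne] with x hx
  refine Measure.restrict_le_self.absolutelyContinuous ?_
  change volume ((fun t => t * x) ⁻¹' N) = 0
  rw [Real.volume_preimage_mul_right hx, h0, mul_zero]

namespace IsBalancedLaw

variable {μ : Measure ℝ} {ζ : ℝ → ℝ} {γ θ Cθ : ℝ}

lemma taylor_integrand (h : IsBalancedLaw μ ζ γ θ Cθ) {F : ℝ → ℝ} (hF : Measurable F) {C η : ℝ}
    (hη0 : 0 ≤ η) (hη : 2 * η ≤ γ) (hb : ∀ x, |F x| ≤ C * Real.exp (η * |x|)) :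
    Integrable (fun q : ℝ × ℝ => q.1 ^ 2 * (1 - q.2) * F (q.2 * q.1))
      (μ.prod (volume.restrict (Icc (0 : ℝ) 1))) := by
  have := h.prob
  have hγ := h.γ_pos
  have hC : 0 ≤ C := by
    have := (abs_nonneg _).trans (hb 0)
    simpa using this
  have hi : Integrable (fun x => (2 / (γ / 2) ^ 2) * C * Real.exp (γ * |x|)) μ :=
    h.exp_int.const_mul _
  refine (hi.comp_fst (volume.restrict (Icc (0 : ℝ) 1))).mono' (by fun_prop) ?_
  have hae : ∀ᵐ q : ℝ × ℝ ∂(μ.prod (volume.restrict (Icc (0 : ℝ) 1))), q.2 ∈ Icc (0 : ℝ) 1 := by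
    have := Measure.quasiMeasurePreserving_snd (μ := μ) (ν := volume.restrict (Icc (0 : ℝ) 1))
    exact this.ae (ae_restrict_mem measurableSet_Icc)
  filter_upwards [hae] with q hq
  rw [Real.norm_eq_abs, abs_mul, abs_of_nonneg (mul_nonneg (sq_nonneg _) (by linarith [hq.2]))]
  have e1 : q.1 ^ 2 * (1 - q.2) ≤ 2 / (γ / 2) ^ 2 * Real.exp (γ / 2 * |q.1|) := by
    have := abs_pow_le_exp (by positivity : 0 < γ / 2) 2 q.1
    norm_num at this
    have h2 : q.1 ^ 2 * (1 - q.2) ≤ q.1 ^ 2 * 1 :=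
      mul_le_mul_of_nonneg_left (by linarith [hq.1]) (sq_nonneg _)
    linarith
  have e2 : |F (q.2 * q.1)| ≤ C * Real.exp (γ / 2 * |q.1|) := by
    refine (hb _).trans (mul_le_mul_of_nonneg_left (Real.exp_le_exp.2 ?_) hC)
    rw [abs_mul, abs_of_nonneg hq.1]
    have : q.2 * |q.1| ≤ 1 * |q.1| := mul_le_mul_of_nonneg_right hq.2 (abs_nonneg _)
    nlinarith [abs_nonneg q.1]
  refine (mul_le_mul e1 e2 (abs_nonneg _) (by positivity)).trans_eq ?_
  have : Real.exp (γ * |q.1|) = Real.exp (γ / 2 * |q.1|) * Real.exp (γ / 2 * |q.1|) := by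
    rw [← Real.exp_add]; ring_nf
  rw [this]
  ring

lemma integrable_taylorMeasure (h : IsBalancedLaw μ ζ γ θ Cθ) {F : ℝ → ℝ} (hF : Measurable F)
    {C η : ℝ} (hη0 : 0 ≤ η) (hη : 2 * η ≤ γ) (hb : ∀ x, |F x| ≤ C * Real.exp (η * |x|)) :
    Integrable F (taylorMeasure μ) ∧ ∫ x, F x ∂(taylorMeasure μ)
      = ∫ z, (∫ t in Icc (0 : ℝ) 1, z ^ 2 * (1 - t) * F (t * z)) ∂μ := by
  have := h.prob
  have hm : Measurable fun q : ℝ × ℝ => q.2 * q.1 := by fun_prop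
  have hi := h.taylor_integrand hF hη0 hη hb
  have hae : ∀ᵐ q : ℝ × ℝ ∂(μ.prod (volume.restrict (Icc (0 : ℝ) 1))), q.2 ∈ Icc (0 : ℝ) 1 := by
    have := Measure.quasiMeasurePreserving_snd (μ := μ) (ν := volume.restrict (Icc (0 : ℝ) 1))
    exact this.ae (ae_restrict_mem measurableSet_Icc)
  have heq : (fun q : ℝ × ℝ => (ENNReal.ofReal (q.1 ^ 2 * (1 - q.2))).toReal • F (q.2 * q.1))
      =ᵐ[μ.prod (volume.restrict (Icc (0 : ℝ) 1))]
        fun q => q.1 ^ 2 * (1 - q.2) * F (q.2 * q.1) := by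
    filter_upwards [hae] with q hq
    rw [ENNReal.toReal_ofReal (mul_nonneg (sq_nonneg _) (by linarith [hq.2])), smul_eq_mul]
  constructor
  · rw [taylorMeasure, integrable_map_measure hF.aestronglyMeasurable hm.aemeasurable,
      integrable_withDensity_iff_integrable_smul' measurable_taylorDensity
      (ae_of_all _ fun _ => ENNReal.ofReal_lt_top)]
    exact hi.congr heq.symm
  · rw [taylorMeasure, integral_map hm.aemeasurable hF.aestronglyMeasurable,
      integral_withDensity_eq_integral_toReal_smul measurable_taylorDensity
      (ae_of_all _ fun _ => ENNReal.ofReal_lt_top), integral_congr_ae heq, integral_prod _ hi]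

lemma integral_taylorMeasure_shift (h : IsBalancedLaw μ ζ γ θ Cθ) {F G H : ℝ → ℝ}
    (hF : Continuous F) {C η : ℝ} (hη0 : 0 ≤ η) (hη : 2 * η ≤ γ)
    (hb : ∀ x, |F x| ≤ C * Real.exp (η * |x|)) (hG : ∀ x, HasDerivAt G (F x) x)
    (hH : ∀ x, HasDerivAt H (G x) x) (y : ℝ) :
    Integrable (fun x => F (y + x)) (taylorMeasure μ) ∧
      ∫ x, F (y + x) ∂(taylorMeasure μ) = ∫ z, (H (y + z) - H y - z * G y) ∂μ := by
  obtain ⟨h1, h2⟩ := h.integrable_taylorMeasure (F := fun x => F (y + x))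
    (hF.measurable.comp (measurable_const_add y)) hη0 hη (abs_add_le_exp hη0 hb y)
  refine ⟨h1, h2.trans (integral_congr_ae (ae_of_all _ fun z => ?_))⟩
  simp only
  rw [integral_Icc_eq_integral_Ioc, ← intervalIntegral.integral_of_le zero_le_one]
  have hd : ∀ t ∈ uIcc (0 : ℝ) 1, HasDerivAt
      (fun t => (1 - t) * (z * G (y + t * z)) + H (y + t * z))
      (z ^ 2 * (1 - t) * F (y + t * z)) t := by
    intro t _
    have e1 : HasDerivAt (fun t : ℝ => y + t * z) z t := by
      simpa using ((hasDerivAt_id t).mul_const z).const_add y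
    have e2 := ((hG (y + t * z)).comp t e1).const_mul z
    have e3 := (hH (y + t * z)).comp t e1
    have e4 : HasDerivAt (fun t : ℝ => 1 - t) (-1) t := by
      simpa using (hasDerivAt_id t).const_sub 1
    refine ((e4.mul e2).add e3).congr_deriv ?_
    simp only [Function.comp]
    ring
  rw [intervalIntegral.integral_eq_sub_of_hasDerivAt hd
    (Continuous.intervalIntegrable (by fun_prop) _ _)]
  simp
  ring

/-- A function that is nearly harmonic for the free walk has a nearly constant average against
`taylorMeasure`. -/
lemma exists_taylor_average (h : IsBalancedLaw μ ζ γ θ Cθ) {η D : ℝ} (h0 : 0 < η)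
    (hη : 3 * η ≤ γ) {f : ℝ → ℝ} (hf : Continuous f)
    (hb : ∀ y, |f y| ≤ D * Real.exp (η * max y 0))
    (hr : ∀ y, |f y - ∫ x, f (y + x) ∂μ| ≤ D * Real.exp (η * y)) :
    ∃ a, ∀ y, |∫ x, f (y + x) ∂(taylorMeasure μ) - a| ≤ D / η / η * Real.exp (η * y) := by
  have := h.prob
  have hD : 0 ≤ D := by
    have := (abs_nonneg _).trans (hb 0)
    simpa using this
  have hmax : ∀ y : ℝ, max y 0 ≤ |y| := fun y => max_le (le_abs_self y) (abs_nonneg y)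
  have hfb : ∀ y, |f y| ≤ D * Real.exp (η * |y|) := fun y =>
    (hb y).trans (mul_le_mul_of_nonneg_left (Real.exp_le_exp.2
      (mul_le_mul_of_nonneg_left (hmax y) h0.le)) hD)
  set G : ℝ → ℝ := fun y => ∫ t in (0 : ℝ)..y, f t with hGdef
  have hG : ∀ x, HasDerivAt G (f x) x := fun x => hf.integral_hasStrictDerivAt 0 x |>.hasDerivAt
  have hGc : Continuous G := continuous_iff_continuousAt.2 fun x => (hG x).continuousAt
  set H : ℝ → ℝ := fun y => ∫ t in (0 : ℝ)..y, G t with hHdef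
  have hH : ∀ x, HasDerivAt H (G x) x := fun x => hGc.integral_hasStrictDerivAt 0 x |>.hasDerivAt
  have hgrow : ∀ (F : ℝ → ℝ) (c κ : ℝ), 0 ≤ c → 0 ≤ κ → (∀ x, |F x| ≤ c * Real.exp (κ * |x|)) →
      ∀ y, |∫ t in (0 : ℝ)..y, F t| ≤ (c / η) * Real.exp ((κ + η) * |y|) := by
    intro F c κ hc hκ hFb y
    have e1 : ∀ t ∈ Set.uIoc 0 y, ‖F t‖ ≤ c * Real.exp (κ * |y|) := by
      intro t ht
      refine (hFb t).trans (mul_le_mul_of_nonneg_left (Real.exp_le_exp.2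
        (mul_le_mul_of_nonneg_left ?_ hκ)) hc)
      rcases le_total 0 y with hy | hy
      · rw [uIoc_of_le hy] at ht
        rw [abs_of_pos ht.1, abs_of_nonneg hy]; exact ht.2
      · rw [uIoc_of_ge hy] at ht
        rw [abs_of_nonpos ht.2, abs_of_nonpos hy]; linarith [ht.1]
    have e2 := intervalIntegral.norm_integral_le_of_norm_le_const e1
    rw [Real.norm_eq_abs, sub_zero] at e2
    have e3 := abs_pow_le_exp h0 1 y
    simp only [pow_one, Nat.factorial_one, Nat.cast_one] at e3
    refine e2.trans ?_
    calc c * Real.exp (κ * |y|) * |y| ≤ c * Real.exp (κ * |y|) * (1 / η * Real.exp (η * |y|)) :=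
          mul_le_mul_of_nonneg_left e3 (by positivity)
      _ = c / η * (Real.exp (κ * |y|) * Real.exp (η * |y|)) := by ring
      _ = _ := by rw [← Real.exp_add]; ring_nf
  have hGb := hgrow f D η hD h0.le hfb
  have hHb := hgrow G (D / η) (η + η) (by positivity) (by positivity) hGb
  have e3 := h.exp_int_of_le (by linarith : η + η + η ≤ γ)
  have e2 := h.exp_int_of_le (by linarith : η + η ≤ γ)
  have hle : ∀ (F : ℝ → ℝ) (c κ κ' : ℝ), 0 ≤ c → κ ≤ κ' → (∀ x, |F x| ≤ c * Real.exp (κ * |x|)) →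
      ∀ x, |F x| ≤ c * Real.exp (κ' * |x|) := fun F c κ κ' hc hk hF x =>
    (hF x).trans (mul_le_mul_of_nonneg_left (Real.exp_le_exp.2
      (mul_le_mul_of_nonneg_right hk (abs_nonneg x))) hc)
  have hk : ∀ y, ∫ x, f (y + x) ∂(taylorMeasure μ) = ∫ z, H (y + z) ∂μ - H y := by
    intro y
    rw [(h.integral_taylorMeasure_shift hf h0.le (by linarith) hfb hG hH y).2]
    have i1 : Integrable (fun z => H (y + z)) μ :=
      integrable_shift (by positivity) e3
        (continuous_iff_continuousAt.2 fun x => (hH x).continuousAt).measurable hHb y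
    have i2 : Integrable (fun z => H (y + z) - H y) μ := i1.sub (integrable_const _)
    rw [integral_sub i2 (h.integrable_id.mul_const _), integral_sub i1 (integrable_const _),
      integral_mul_const, h.mean]
    simp
  have hk1 : ∀ y, HasDerivAt (fun y => ∫ x, f (y + x) ∂(taylorMeasure μ))
      (∫ z, G (y + z) ∂μ - G y) y := by
    intro y
    refine ((hasDerivAt_integral_shift (by positivity) e3 hH hGc.measurable hHb
      (hle _ _ _ _ (by positivity) (by linarith) hGb) y).sub (hH y)).congr_of_eventuallyEq ?_
    exact Eventually.of_forall hk
  have hk2 : ∀ y, HasDerivAt (fun y => ∫ z, G (y + z) ∂μ - G y) (∫ z, f (y + z) ∂μ - f y) y :=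
    fun y => (hasDerivAt_integral_shift (by positivity) e2 hG hf.measurable hGb
      (hle _ _ _ _ hD (by linarith) hfb) y).sub (hG y)
  obtain ⟨b, hbb⟩ := exists_abs_sub_le_of_deriv_le h0 hk2 fun y => by
    rw [abs_sub_comm]; exact hr y
  have hk3 : ∀ y, HasDerivAt (fun y => ∫ x, f (y + x) ∂(taylorMeasure μ) - b * y)
      (∫ z, G (y + z) ∂μ - G y - b) y := fun y => by
    have := (hk1 y).sub ((hasDerivAt_id y).const_mul b)
    rw [mul_one] at this
    exact this
  obtain ⟨a, ha⟩ := exists_abs_sub_le_of_deriv_le h0 hk3 hbb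
  set M := ∫ x, D * Real.exp (η * |x|) ∂(taylorMeasure μ) with hM
  have hMi : Integrable (fun x => D * Real.exp (η * |x|)) (taylorMeasure μ) :=
    (h.integrable_taylorMeasure (C := D) (by fun_prop) h0.le (by linarith) fun x => by
      rw [abs_of_nonneg (by positivity)]).1
  have hbdd : ∀ y ≤ 0, |∫ x, f (y + x) ∂(taylorMeasure μ)| ≤ M := by
    intro y hy
    have hle : ∀ x, ‖f (y + x)‖ ≤ D * Real.exp (η * |x|) := fun x => by
      refine (hb _).trans (mul_le_mul_of_nonneg_left (Real.exp_le_exp.2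
        (mul_le_mul_of_nonneg_left ?_ h0.le)) hD)
      exact max_le (by linarith [le_abs_self x]) (abs_nonneg x)
    exact norm_integral_le_of_norm_le hMi (ae_of_all _ hle)
  have hb0 : b = 0 := by
    by_contra hne
    have hpos : 0 < |b| := abs_pos.2 hne
    set K := M + |a| + D / η / η with hK
    have hK0 : 0 ≤ K := by
      have := (abs_nonneg _).trans (hbdd 0 le_rfl)
      positivity
    have hy : -((K + 1) / |b|) ≤ 0 := by
      have : 0 ≤ (K + 1) / |b| := by positivity
      linarith
    have g1 := hbdd _ hy
    have g2 := ha (-((K + 1) / |b|))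
    have g3 : Real.exp (η * -((K + 1) / |b|)) ≤ 1 :=
      Real.exp_le_one_iff.2 (mul_nonpos_of_nonneg_of_nonpos h0.le hy)
    have g4 : |b * -((K + 1) / |b|)| = K + 1 := by
      rw [abs_mul, abs_neg, abs_of_nonneg (by positivity : 0 ≤ (K + 1) / |b|)]
      field_simp
    have g5 : D / η / η * Real.exp (η * -((K + 1) / |b|)) ≤ D / η / η * 1 :=
      mul_le_mul_of_nonneg_left g3 (by positivity)
    set I := ∫ x, f (-((K + 1) / |b|) + x) ∂(taylorMeasure μ)
    set B := b * -((K + 1) / |b|)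
    have g6 : |B| ≤ |I| + |a| + |I - B - a| := by
      have : B = I + -a + -(I - B - a) := by ring
      calc |B| = |I + -a + -(I - B - a)| := by rw [← this]
        _ ≤ _ := by
          refine (abs_add_le _ _).trans ?_
          rw [abs_neg]
          refine add_le_add ((abs_add_le _ _).trans ?_) le_rfl
          rw [abs_neg]
    linarith
  refine ⟨a, fun y => ?_⟩
  have := ha y
  rwa [hb0, zero_mul, sub_zero] at this

lemma taylorMeasure_isFinite (h : IsBalancedLaw μ ζ γ θ Cθ) :
    IsFiniteMeasure (taylorMeasure μ) ∧
      (taylorMeasure μ).real univ = (∫ x, x ^ 2 ∂μ) / 2 := by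
  have hc : ∀ x : ℝ, HasDerivAt (fun x => x ^ 2 / 2) x x := fun x => by
    have := (hasDerivAt_pow 2 x).div_const 2
    simpa using this
  have := h.integral_taylorMeasure_shift (F := fun _ => 1) (C := 1) (η := 0) continuous_const
    le_rfl (by linarith [h.γ_pos]) (fun x => by simp) (fun x => hasDerivAt_id x) hc 0
  obtain ⟨h1, h2⟩ := this
  refine ⟨by simpa [integrable_const_iff] using h1, ?_⟩
  simp only [integral_const, smul_eq_mul, mul_one] at h2
  rw [h2, ← integral_div]
  simp

end IsBalancedLaw

end Taylor

section ConvPow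

/-- `convPow μ n` is the `(n + 1)`-fold convolution power of `μ`. -/
noncomputable def convPow (μ : Measure ℝ) : ℕ → Measure ℝ
  | 0 => μ
  | n + 1 => convPow μ n ∗ μ

instance convPow_isProbabilityMeasure (μ : Measure ℝ) [IsProbabilityMeasure μ] (n : ℕ) :
    IsProbabilityMeasure (convPow μ n) := by
  induction n with
  | zero => assumption
  | succ n ih => rw [convPow]; infer_instance

lemma convPow_conv (μ : Measure ℝ) [IsProbabilityMeasure μ] (m n : ℕ) :
    convPow μ m ∗ convPow μ n = convPow μ (m + n + 1) := by
  induction n with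
  | zero => rfl
  | succ n ih =>
    calc convPow μ m ∗ (convPow μ n ∗ μ) = (convPow μ m ∗ convPow μ n) ∗ μ :=
          (Measure.conv_assoc _ _ _).symm
      _ = convPow μ (m + n + 1) ∗ μ := by rw [ih]

/-- The geometric mixture of the convolution powers of `μ`. -/
noncomputable def convMix (μ : Measure ℝ) : Measure ℝ :=
  Measure.sum fun n : ℕ => ENNReal.ofReal ((1 / 2) ^ (n + 1)) • convPow μ n

lemma convPow_absolutelyContinuous_convMix (μ : Measure ℝ) (n : ℕ) : convPow μ n ≪ convMix μ :=
  Measure.absolutelyContinuous_sum_right n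
    (Measure.absolutelyContinuous_smul (ENNReal.ofReal_pos.2 (by positivity)).ne')

lemma restrict_Ioo_absolutelyContinuous_conv {m₁ m₂ : Measure ℝ} [SFinite m₁] [SFinite m₂]
    {a b c d : ℝ} (hab : a < b) (hcd : c < d) (h₁ : volume.restrict (Ioo a b) ≪ m₁)
    (h₂ : volume.restrict (Ioo c d) ≪ m₂) :
    volume.restrict (Ioo (a + c) (b + d)) ≪ m₁ ∗ m₂ := by
  refine Measure.AbsolutelyContinuous.mk fun N hN h0 => ?_
  have hm : Measurable fun p : ℝ × ℝ => p.1 + p.2 := by fun_prop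
  rw [Measure.conv, Measure.map_apply hm hN, Measure.measure_prod_null (hm hN)] at h0
  have h3 : ∀ᵐ x ∂(volume.restrict (Ioo a b)), volume (N ∩ Ioo (x + c) (x + d)) = 0 := by
    filter_upwards [h₁.ae_le h0] with x hx
    have h4 := h₂ hx
    change volume.restrict (Ioo c d) ((fun y => x + y) ⁻¹' N) = 0 at h4
    rw [Measure.restrict_apply (measurable_const_add x hN)] at h4
    rw [← measure_preimage_add volume x]
    convert h4 using 2
    ext y
    simp [add_comm x]
  rw [Measure.restrict_apply hN]
  refine measure_null_of_locally_null _ fun w hw => ?_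
  obtain ⟨hwN, hw1, hw2⟩ := hw
  have hpos : volume.restrict (Ioo a b) (Ioo (max (w - d) a) (min (w - c) b)) ≠ 0 := by
    rw [Measure.restrict_apply measurableSet_Ioo, inter_eq_left.2, Real.volume_Ioo]
    · refine (ENNReal.ofReal_pos.2 (sub_pos.2 ?_)).ne'
      exact max_lt (lt_min (by linarith) (by linarith)) (lt_min (by linarith) hab)
    · exact Ioo_subset_Ioo (le_max_right _ _) (min_le_right _ _)
  obtain ⟨x, hx1, hx2⟩ : ∃ x ∈ Ioo (max (w - d) a) (min (w - c) b),
      volume (N ∩ Ioo (x + c) (x + d)) = 0 := by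
    by_contra hcon
    push Not at hcon
    exact hpos (measure_mono_null (fun x hx => hcon x hx) h3)
  refine ⟨N ∩ Ioo (x + c) (x + d), ?_, hx2⟩
  have g1 := (le_max_left _ _).trans_lt hx1.1
  have g2 := hx1.2.trans_le (min_le_left _ _)
  have : Ioo (x + c) (x + d) ∈ nhds w := Ioo_mem_nhds (by linarith) (by linarith)
  exact mem_nhdsWithin.2 ⟨Ioo (x + c) (x + d), isOpen_Ioo, ⟨by linarith, by linarith⟩,
    fun u hu => ⟨hu.2.1, hu.1⟩⟩

lemma restrict_Ioo_mul_absolutelyContinuous {μ : Measure ℝ} [IsProbabilityMeasure μ] {a b : ℝ}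
    (hab : a < b) {k : ℕ} (h : volume.restrict (Ioo a b) ≪ convPow μ k) (n : ℕ) :
    ∃ j, volume.restrict (Ioo ((n + 1 : ℝ) * a) ((n + 1 : ℝ) * b)) ≪ convPow μ j := by
  induction n with
  | zero => exact ⟨k, by simpa using h⟩
  | succ n ih =>
    obtain ⟨j, hj⟩ := ih
    refine ⟨j + k + 1, ?_⟩
    rw [← convPow_conv]
    have hn : (0 : ℝ) < n + 1 := by positivity
    convert restrict_Ioo_absolutelyContinuous_conv (mul_lt_mul_of_pos_left hab hn) hab hj h
      using 3 <;> push_cast <;> ring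

namespace IsBalancedLaw

variable {μ : Measure ℝ} {ζ : ℝ → ℝ} {γ θ Cθ : ℝ}

lemma exists_density_pos (h : IsBalancedLaw μ ζ γ θ Cθ) : ∃ x, 0 < x ∧ 0 < ζ x := by
  by_contra! hcon
  have hz : ∀ x, 0 < x → ζ x = 0 := fun x hx => le_antisymm (hcon x hx) (h.nonneg x)
  have h1 : ∫ x, -(ζ x * x) = 0 := by
    rw [integral_neg, ← h.integral_eq (fun x => x), h.mean, neg_zero]
  have hnn : ∀ x, 0 ≤ -(ζ x * x) := fun x => by
    rcases lt_or_ge 0 x with hx | hx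
    · rw [hz x hx]; simp
    · have := mul_nonpos_of_nonneg_of_nonpos (h.nonneg x) hx
      linarith
  have hi : Integrable fun x => -(ζ x * x) := ((h.integrable_iff fun x => x).1 h.integrable_id).neg
  rw [integral_eq_zero_iff_of_nonneg hnn hi] at h1
  have h2 : ∫ x, x ^ 2 ∂μ = 0 := by
    rw [h.integral_eq]
    refine integral_eq_zero_of_ae ?_
    filter_upwards [h1] with x hx
    simp only [Pi.zero_apply] at hx ⊢
    rw [sq, ← mul_assoc, neg_eq_zero.1 hx, zero_mul]
  exact h.variance_pos.ne' h2

lemma restrict_absolutelyContinuous (h : IsBalancedLaw μ ζ γ θ Cθ) {s : Set ℝ}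
    (hs : ∀ x ∈ s, 0 < ζ x) : volume.restrict s ≪ μ := by
  refine Measure.AbsolutelyContinuous.mk fun N hN h0 => ?_
  rw [h.law, withDensity_apply_eq_zero h.meas.ennreal_ofReal] at h0
  rw [Measure.restrict_apply hN]
  have hsub : N ∩ s ⊆ {x | ENNReal.ofReal (ζ x) ≠ 0} ∩ N := fun x hx =>
    ⟨(ENNReal.ofReal_pos.2 (hs x hx.2)).ne', hx.1⟩
  exact measure_mono_null hsub h0

lemma exists_Ioo_pos (h : IsBalancedLaw μ ζ γ θ Cθ) :
    ∃ a b, 0 < a ∧ a < b ∧ ∀ x ∈ Ioo a b, 0 < ζ x := by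
  obtain ⟨x, hx, hζx⟩ := h.exists_density_pos
  have hopen : IsOpen {y | 0 < ζ y ∧ 0 < y} :=
    (isOpen_lt continuous_const h.continuous).inter isOpen_Ioi
  obtain ⟨r, hr, hball⟩ := Metric.isOpen_iff.1 hopen x ⟨hζx, hx⟩
  refine ⟨x, x + r, hx, by linarith, fun y hy => (hball ?_).1⟩
  rw [Metric.mem_ball, Real.dist_eq, abs_lt]
  constructor <;> linarith [hy.1, hy.2]

/-- The convolution powers of `μ` eventually charge every set of positive Lebesgue measure. -/
lemma volume_absolutelyContinuous_convMix (h : IsBalancedLaw μ ζ γ θ Cθ) :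
    volume ≪ convMix μ := by
  have := h.prob
  obtain ⟨a₁, a₂, ha, ha', hpos⟩ := h.exists_Ioo_pos
  obtain ⟨b₁, b₂, hb, hb', hneg⟩ := h.reflect.exists_Ioo_pos
  have h1 : volume.restrict (Ioo a₁ a₂) ≪ convPow μ 0 := h.restrict_absolutelyContinuous hpos
  have h2 : volume.restrict (Ioo (-b₂) (-b₁)) ≪ convPow μ 0 :=
    h.restrict_absolutelyContinuous fun x hx => by
      simpa using hneg (-x) ⟨by linarith [hx.2], by linarith [hx.1]⟩
  have hlt : b₁ / a₂ < b₂ / a₁ := by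
    rw [div_lt_div_iff₀ (by linarith) ha]
    nlinarith
  obtain ⟨q, hq1, hq2⟩ := exists_rat_btwn hlt
  have hq0 : 0 < q := by
    have : (0 : ℝ) < q := lt_trans (div_pos hb (by linarith)) hq1
    exact_mod_cast this
  obtain ⟨m, hm⟩ : ∃ m : ℕ, (m + 1 : ℝ) = q.num := by
    have := Rat.num_pos.2 hq0
    refine ⟨(q.num - 1).toNat, ?_⟩
    have h3 : ((q.num - 1).toNat : ℤ) = q.num - 1 := Int.toNat_of_nonneg (by omega)
    have h4 : (((q.num - 1).toNat : ℤ) : ℝ) = q.num - 1 := by rw [h3]; push_cast; ring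
    rw [Int.cast_natCast] at h4
    linarith
  obtain ⟨n, hn⟩ : ∃ n : ℕ, (n + 1 : ℝ) = q.den := by
    have := q.den_pos
    refine ⟨q.den - 1, ?_⟩
    rw [Nat.cast_sub this]; simp
  have hqv : (q : ℝ) = (m + 1) / (n + 1) := by rw [hm, hn]; exact_mod_cast (Rat.num_div_den q).symm
  have hn0 : (0 : ℝ) < n + 1 := by positivity
  rw [hqv, div_lt_div_iff₀ (by linarith) hn0] at hq1
  rw [hqv, div_lt_div_iff₀ hn0 ha] at hq2
  obtain ⟨j₁, hj₁⟩ := restrict_Ioo_mul_absolutelyContinuous ha' h1 m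
  obtain ⟨j₂, hj₂⟩ := restrict_Ioo_mul_absolutelyContinuous (by linarith) h2 n
  have h3 := restrict_Ioo_absolutelyContinuous_conv
    (mul_lt_mul_of_pos_left ha' (by positivity : (0 : ℝ) < m + 1))
    (mul_lt_mul_of_pos_left (by linarith : -b₂ < -b₁) hn0) hj₁ hj₂
  rw [convPow_conv] at h3
  set c := (m + 1 : ℝ) * a₁ + (n + 1) * -b₂ with hc
  set d := (m + 1 : ℝ) * a₂ + (n + 1) * -b₁ with hd
  have hc0 : c < 0 := by rw [hc]; linarith
  have hd0 : 0 < d := by rw [hd]; linarith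
  refine Measure.AbsolutelyContinuous.mk fun N hN h0 => ?_
  refine measure_mono_null (t := ⋃ n : ℕ, N ∩ Ioo ((n + 1 : ℝ) * c) ((n + 1 : ℝ) * d)) ?_ ?_
  · intro x hx
    obtain ⟨k, hk⟩ := exists_nat_gt (max (x / c) (x / d))
    refine mem_iUnion.2 ⟨k, hx, ?_, ?_⟩
    · have := (le_max_left _ _).trans_lt hk
      rw [div_lt_iff_of_neg hc0] at this
      linarith
    · have := (le_max_right _ _).trans_lt hk
      rw [div_lt_iff₀ hd0] at this
      linarith
  · refine measure_iUnion_null fun k => ?_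
    obtain ⟨j, hj⟩ := restrict_Ioo_mul_absolutelyContinuous (hc0.trans hd0) h3 k
    rw [← Measure.restrict_apply hN]
    exact hj (convPow_absolutelyContinuous_convMix μ j h0)

end IsBalancedLaw

end ConvPow

section Renewal

lemma integrable_exp_convPow {μ : Measure ℝ} [IsProbabilityMeasure μ] {η M : ℝ} (hη : 0 ≤ η)
    (hexp : Integrable (fun x => Real.exp (η * |x|)) μ) (hM : ∫ x, Real.exp (η * |x|) ∂μ ≤ M)
    (n : ℕ) : Integrable (fun x => Real.exp (η * |x|)) (convPow μ n) ∧
      ∫ x, Real.exp (η * |x|) ∂(convPow μ n) ≤ M ^ (n + 1) := by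
  induction n with
  | zero => simpa [convPow] using ⟨hexp, hM⟩
  | succ n ih =>
    obtain ⟨ih1, ih2⟩ := ih
    have hm : Measurable fun p : ℝ × ℝ => p.1 + p.2 := by fun_prop
    have hprod := ih1.mul_prod hexp
    have hle : ∀ p : ℝ × ℝ, ‖Real.exp (η * |p.1 + p.2|)‖
        ≤ Real.exp (η * |p.1|) * Real.exp (η * |p.2|) := fun p => by
      rw [Real.norm_eq_abs, Real.abs_exp]
      exact exp_mul_abs_add_le hη _ _
    have hi : Integrable (fun p : ℝ × ℝ => Real.exp (η * |p.1 + p.2|)) ((convPow μ n).prod μ) :=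
      hprod.mono' (by fun_prop) (ae_of_all _ hle)
    constructor
    · rw [convPow, Measure.conv, integrable_map_measure (by fun_prop) hm.aemeasurable]
      exact hi
    · rw [convPow, Measure.conv, integral_map hm.aemeasurable (by fun_prop), pow_succ]
      refine (integral_mono hi hprod fun p => (le_abs_self _).trans (hle p)).trans ?_
      rw [integral_prod_mul (fun x : ℝ => Real.exp (η * |x|)) fun x : ℝ => Real.exp (η * |x|)]
      have h0 : 0 ≤ ∫ x, Real.exp (η * |x|) ∂μ := integral_nonneg fun x => (Real.exp_pos _).le
      have h1 : 0 ≤ ∫ x, Real.exp (η * |x|) ∂(convPow μ n) :=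
        integral_nonneg fun x => (Real.exp_pos _).le
      exact mul_le_mul ih2 hM h0 (h1.trans ih2)

lemma hasSum_mixWeight : HasSum (fun n : ℕ => ((1 / 2 : ℝ)) ^ (n + 1)) 1 := by
  have := (hasSum_geometric_of_lt_one
    (by norm_num : (0 : ℝ) ≤ 1 / 2) (by norm_num)).mul_left (1 / 2)
  norm_num only at this
  simpa only [pow_succ'] using this

lemma hasSum_mixMoment : HasSum (fun n : ℕ => ((1 / 2 : ℝ)) ^ (n + 1) * (3 / 2) ^ (n + 1)) 3 := by
  have := (hasSum_geometric_of_lt_one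
    (by norm_num : (0 : ℝ) ≤ 3 / 4) (by norm_num)).mul_left (3 / 4)
  norm_num only at this
  simp only [← mul_pow, ← pow_succ'] at this ⊢
  norm_num only at this ⊢
  exact this

instance convMix_isProbabilityMeasure (μ : Measure ℝ) [IsProbabilityMeasure μ] :
    IsProbabilityMeasure (convMix μ) := by
  constructor
  rw [convMix, Measure.sum_apply _ MeasurableSet.univ]
  simp only [Measure.smul_apply, measure_univ, smul_eq_mul, mul_one]
  rw [← ENNReal.ofReal_tsum_of_nonneg (fun n => by positivity) hasSum_mixWeight.summable,
    hasSum_mixWeight.tsum_eq, ENNReal.ofReal_one]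

lemma integrable_exp_convMix {μ : Measure ℝ} [IsProbabilityMeasure μ] {η : ℝ} (hη : 0 ≤ η)
    (hexp : Integrable (fun x => Real.exp (η * |x|)) μ)
    (hM : ∫ x, Real.exp (η * |x|) ∂μ ≤ 3 / 2) :
    Integrable (fun x => Real.exp (η * |x|)) (convMix μ) := by
  have key := integrable_exp_convPow hη hexp hM
  refine integrable_sum_measure (fun n => (key n).1.smul_measure ENNReal.ofReal_ne_top) ?_
  refine hasSum_mixMoment.summable.of_nonneg_of_le
    (fun n => integral_nonneg fun x => norm_nonneg _) fun n => ?_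
  rw [integral_smul_measure, ENNReal.toReal_ofReal (by positivity), smul_eq_mul]
  simp only [Real.norm_eq_abs, Real.abs_exp]
  exact mul_le_mul_of_nonneg_left (key n).2 (by positivity)

lemma exp_max_le {η : ℝ} (hη : 0 ≤ η) {C : ℝ} (hC : 0 ≤ C) (y : ℝ) :
    C * Real.exp (η * max y 0) ≤ C * Real.exp (η * |y|) :=
  mul_le_mul_of_nonneg_left (Real.exp_le_exp.2
    (mul_le_mul_of_nonneg_left (max_le (le_abs_self y) (abs_nonneg y)) hη)) hC

lemma abs_sub_integral_convPow_le {μ : Measure ℝ} [IsProbabilityMeasure μ] {η C D : ℝ}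
    (hη : 0 ≤ η) (hD : 0 ≤ D) (hexp : Integrable (fun x => Real.exp (η * |x|)) μ)
    (hM : ∫ x, Real.exp (η * |x|) ∂μ ≤ 3 / 2) {f : ℝ → ℝ} (hf : Measurable f)
    (hb : ∀ y, |f y| ≤ C * Real.exp (η * |y|))
    (hr : ∀ y, |f y - ∫ x, f (y + x) ∂μ| ≤ D * Real.exp (η * y)) (n : ℕ) (y : ℝ) :
    |f y - ∫ x, f (y + x) ∂(convPow μ n)| ≤ 2 * D * (3 / 2) ^ (n + 1) * Real.exp (η * y) := by
  have key := integrable_exp_convPow hη hexp hM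
  induction n generalizing y with
  | zero =>
    refine (hr y).trans (mul_le_mul_of_nonneg_right ?_ (Real.exp_pos _).le)
    norm_num; linarith
  | succ n ih =>
    have i1 := integrable_shift hη (key n).1 hf hb y
    have i2 := integrable_shift hη (key (n + 1)).1 hf hb y
    have e1 : ∫ x, f (y + x) ∂(convPow μ (n + 1)) = ∫ x, ∫ z, f (y + x + z) ∂μ ∂(convPow μ n) := by
      rw [convPow] at i2 ⊢
      rw [integral_conv i2]
      simp only [add_assoc]
    have i3 : Integrable (fun x => ∫ z, f (y + x + z) ∂μ) (convPow μ n) := by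
      have hm : Measurable fun p : ℝ × ℝ => p.1 + p.2 := by fun_prop
      rw [convPow, Measure.conv, integrable_map_measure
        (g := fun x => f (y + x))
        (hf.comp (measurable_const_add y)).aestronglyMeasurable hm.aemeasurable] at i2
      simpa only [Function.comp_def, add_assoc] using i2.integral_prod_left
    have hpt : ∀ x, ‖f (y + x) - ∫ z, f (y + x + z) ∂μ‖
        ≤ D * Real.exp (η * y) * Real.exp (η * |x|) := fun x => by
      refine (hr _).trans ?_
      rw [mul_add, Real.exp_add, ← mul_assoc]
      exact mul_le_mul_of_nonneg_left (exp_mul_le_exp_mul_abs hη x) (by positivity)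
    have e2 : |∫ x, (f (y + x) - ∫ z, f (y + x + z) ∂μ) ∂(convPow μ n)|
        ≤ D * Real.exp (η * y) * (3 / 2) ^ (n + 1) := by
      refine (norm_integral_le_of_norm_le ((key n).1.const_mul _) (ae_of_all _ hpt)).trans ?_
      rw [integral_const_mul]
      exact mul_le_mul_of_nonneg_left (key n).2 (by positivity)
    rw [integral_sub i1 i3] at e2
    rw [e1]
    have e3 := ih y
    have e4 := abs_sub_le (f y) (∫ x, f (y + x) ∂(convPow μ n))
      (∫ x, ∫ z, f (y + x + z) ∂μ ∂(convPow μ n))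
    rw [pow_succ _ (n + 1)]
    linarith

lemma abs_sub_integral_convMix_le {μ : Measure ℝ} [IsProbabilityMeasure μ] {η C D : ℝ}
    (hη : 0 ≤ η) (hD : 0 ≤ D) (hexp : Integrable (fun x => Real.exp (η * |x|)) μ)
    (hM : ∫ x, Real.exp (η * |x|) ∂μ ≤ 3 / 2) {f : ℝ → ℝ} (hf : Measurable f)
    (hb : ∀ y, |f y| ≤ C * Real.exp (η * |y|))
    (hr : ∀ y, |f y - ∫ x, f (y + x) ∂μ| ≤ D * Real.exp (η * y)) (y : ℝ) :
    |f y - ∫ x, f (y + x) ∂(convMix μ)| ≤ 6 * D * Real.exp (η * y) := by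
  have i1 := integrable_shift hη (integrable_exp_convMix hη hexp hM) hf hb y
  have h1 := hasSum_integral_measure i1
  simp only [integral_smul_measure, smul_eq_mul] at h1
  have h2 := (hasSum_mixWeight.mul_right (f y)).sub h1
  rw [one_mul] at h2
  have h3 := hasSum_mixMoment.mul_right (2 * D * Real.exp (η * y))
  refine (h2.norm_le_of_bounded h3 fun n => ?_).trans_eq (by ring)
  rw [ENNReal.toReal_ofReal (by positivity), ← mul_sub, norm_mul, Real.norm_eq_abs,
    Real.norm_eq_abs, abs_of_nonneg (by positivity), mul_assoc]
  refine mul_le_mul_of_nonneg_left ?_ (by positivity)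
  exact (abs_sub_integral_convPow_le hη hD hexp hM hf hb hr n y).trans_eq (by ring)

/-- A contraction principle for functions on the line that are controlled by their averages against
a weight of small exponential mass. -/
lemma abs_le_of_abs_le_integral {ν : Measure ℝ} {w F : ℝ → ℝ} {η q C₀ C₁ : ℝ} (hη : 0 ≤ η)
    (hC₀ : 0 ≤ C₀) (hC₁ : 0 ≤ C₁) (hw : ∀ x, 0 ≤ w x)
    (hwi : Integrable (fun x => w x * Real.exp (η * |x|)) ν)
    (hwq : ∫ x, w x * Real.exp (η * |x|) ∂ν = q) (hq : q < 1)
    (hb : ∀ y, |F y| ≤ C₀ * Real.exp (η * max y 0))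
    (hF : ∀ y, |F y| ≤ ∫ x, w x * |F (y + x)| ∂ν + C₁ * Real.exp (η * y)) (y : ℝ) :
    |F y| ≤ C₁ / (1 - q) * Real.exp (η * y) := by
  have hq0 : 0 ≤ q := hwq ▸ integral_nonneg fun x => mul_nonneg (hw x) (Real.exp_pos _).le
  have hq1 : 0 < 1 - q := by linarith
  set A := C₁ / (1 - q) with hA
  have hA0 : 0 ≤ A := by positivity
  have hAq : A * q + C₁ = A := by rw [hA]; field_simp; ring
  have key : ∀ n : ℕ, ∀ y, |F y| ≤ A * Real.exp (η * y) + q ^ n * C₀ * Real.exp (η * max y 0) := by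
    intro n
    induction n with
    | zero =>
      intro y
      have : 0 ≤ A * Real.exp (η * y) := by positivity
      have := hb y
      simp only [pow_zero, one_mul]
      linarith
    | succ n ih =>
      intro y
      set c := A * Real.exp (η * y) + q ^ n * C₀ * Real.exp (η * max y 0) with hc
      have hpt : ∀ x, w x * |F (y + x)| ≤ c * (w x * Real.exp (η * |x|)) := fun x => by
        have e1 : Real.exp (η * (y + x)) ≤ Real.exp (η * y) * Real.exp (η * |x|) := by
          rw [mul_add, Real.exp_add]
          exact mul_le_mul_of_nonneg_left (exp_mul_le_exp_mul_abs hη x) (Real.exp_pos _).le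
        have e2 : Real.exp (η * max (y + x) 0) ≤ Real.exp (η * max y 0) * Real.exp (η * |x|) := by
          rw [← Real.exp_add, ← mul_add]
          refine Real.exp_le_exp.2 (mul_le_mul_of_nonneg_left (max_le ?_ ?_) hη)
          · linarith [le_max_left y 0, le_abs_self x]
          · linarith [le_max_right y 0, abs_nonneg x]
        have e3 := mul_le_mul_of_nonneg_left e1 hA0
        have e4 := mul_le_mul_of_nonneg_left e2 (mul_nonneg (pow_nonneg hq0 n) hC₀)
        have e5 : |F (y + x)| ≤ c * Real.exp (η * |x|) := by
          rw [hc, add_mul]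
          linarith [ih (y + x)]
        calc w x * |F (y + x)| ≤ w x * (c * Real.exp (η * |x|)) :=
              mul_le_mul_of_nonneg_left e5 (hw x)
          _ = _ := by ring
      have e6 : ∫ x, w x * |F (y + x)| ∂ν ≤ c * q := by
        refine (integral_mono_of_nonneg (ae_of_all _ fun x => mul_nonneg (hw x) (abs_nonneg _))
          (hwi.const_mul c) (ae_of_all _ hpt)).trans_eq ?_
        rw [integral_const_mul, hwq]
      calc |F y| ≤ c * q + C₁ * Real.exp (η * y) := (hF y).trans (by linarith)
        _ = (A * q + C₁) * Real.exp (η * y) + q ^ (n + 1) * C₀ * Real.exp (η * max y 0) := by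
          rw [hc, pow_succ]; ring
        _ = _ := by rw [hAq]
  have hlim : Tendsto (fun n : ℕ => A * Real.exp (η * y) + q ^ n * C₀ * Real.exp (η * max y 0))
      atTop (nhds (A * Real.exp (η * y) + 0 * C₀ * Real.exp (η * max y 0))) :=
    (((tendsto_pow_atTop_nhds_zero_of_lt_one hq0 hq).mul_const _).mul_const _).const_add _
  rw [zero_mul, zero_mul, add_zero] at hlim
  exact ge_of_tendsto' hlim fun n => key n y

/-- Perturbing the constant `1` by a small multiple of a density of positive mass decreases the
mass. -/
lemma exists_integral_abs_one_sub_lt {ν : Measure ℝ} [IsProbabilityMeasure ν] {ρ : ℝ → ℝ}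
    (hρm : Measurable ρ) (hρ0 : ∀ x, 0 ≤ ρ x) (hρ : Integrable ρ ν) (hpos : 0 < ∫ x, ρ x ∂ν) :
    ∃ s, 0 < s ∧ ∫ x, |1 - s * ρ x| ∂ν < 1 := by
  set s : ℕ → ℝ := fun n => 1 / (n + 1) with hs
  have hs0 : ∀ n, 0 < s n := fun n => by positivity
  have hlim0 : Tendsto s atTop (nhds 0) := tendsto_one_div_add_atTop_nhds_zero_nat
  have hlim : Tendsto (fun n => ∫ x, (1 - |1 - s n * ρ x|) / s n ∂ν) atTop
      (nhds (∫ x, ρ x ∂ν)) := by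
    refine tendsto_integral_of_dominated_convergence ρ (fun n => by fun_prop) hρ
      (fun n => ae_of_all _ fun x => ?_) (ae_of_all _ fun x => ?_)
    · rw [Real.norm_eq_abs, abs_div, abs_of_pos (hs0 n), div_le_iff₀ (hs0 n)]
      have := abs_abs_sub_abs_le_abs_sub 1 (1 - s n * ρ x)
      rw [abs_one, sub_sub_cancel, abs_of_nonneg (mul_nonneg (hs0 n).le (hρ0 x))] at this
      linarith
    · refine tendsto_const_nhds.congr' ?_
      have h1 : Tendsto (fun n => s n * ρ x) atTop (nhds (0 * ρ x)) := hlim0.mul_const _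
      rw [zero_mul] at h1
      filter_upwards [h1.eventually_lt_const one_pos] with n hn
      rw [abs_of_nonneg (by linarith)]
      have := (hs0 n).ne'
      field_simp
      ring
  obtain ⟨n, hn⟩ := (hlim.eventually_const_lt hpos).exists
  refine ⟨s n, hs0 n, ?_⟩
  have hi : Integrable (fun x => |1 - s n * ρ x|) ν :=
    ((integrable_const _).sub (hρ.const_mul _)).abs
  rw [integral_div, integral_sub (integrable_const _) hi] at hn
  simp only [integral_const, probReal_univ, one_smul] at hn
  have := (div_pos_iff_of_pos_right (hs0 n)).1 hn
  linarith

namespace IsBalancedLaw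

variable {μ : Measure ℝ} {ζ : ℝ → ℝ} {γ θ Cθ : ℝ}

/-- A quantitative renewal theorem: functions of moderate growth that are harmonic for the free walk
up to an error `O(exp (η y))` converge exponentially fast at `-∞`. -/
theorem exists_renewal (h : IsBalancedLaw μ ζ γ θ Cθ) :
    ∃ η₁, 0 < η₁ ∧ η₁ ≤ γ ∧ ∀ η, 0 < η → η ≤ η₁ → ∀ (f : ℝ → ℝ) (D : ℝ), Continuous f →
      (∀ y, |f y| ≤ D * Real.exp (η * max y 0)) →
      (∀ y, |f y - ∫ x, f (y + x) ∂μ| ≤ D * Real.exp (η * y)) →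
      ∃ a C, ∀ y, |f y - a| ≤ C * Real.exp (η * y) := by
  have := h.prob
  have := h.noAtoms
  obtain ⟨hfin, hmass⟩ := h.taylorMeasure_isFinite
  have hmass0 : 0 < (taylorMeasure μ).real univ := by
    rw [hmass]; exact half_pos h.variance_pos
  have hac : taylorMeasure μ ≪ convMix μ :=
    taylorMeasure_absolutelyContinuous.trans h.volume_absolutelyContinuous_convMix
  obtain ⟨η₂, hη₂0, hη₂γ, hη₂⟩ := exists_integral_mul_exp_abs_lt (m := μ) (w := fun _ => 1)
    (c := 3 / 2) h.γ_pos measurable_const (fun _ => zero_le_one) (by simpa using h.exp_int)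
    (by norm_num)
  simp only [one_mul] at hη₂
  set ρ : ℝ → ℝ := fun x => ((taylorMeasure μ).rnDeriv (convMix μ) x).toReal with hρ
  have hρm : Measurable ρ := (Measure.measurable_rnDeriv _ _).ennreal_toReal
  have hρ0 : ∀ x, 0 ≤ ρ x := fun x => ENNReal.toReal_nonneg
  have hρint : ∀ F : ℝ → ℝ, ∫ x, ρ x * F x ∂(convMix μ) = ∫ x, F x ∂(taylorMeasure μ) :=
    fun F => integral_rnDeriv_smul hac
  have hρi : ∀ F : ℝ → ℝ, Integrable F (taylorMeasure μ) →
      Integrable (fun x => ρ x * F x) (convMix μ) :=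
    fun F hF => (integrable_rnDeriv_smul_iff hac).2 hF
  obtain ⟨s, hs0, hs⟩ := exists_integral_abs_one_sub_lt (ν := convMix μ) hρm hρ0
    (by simpa using hρi (fun _ => 1) (integrable_const _)) (by
      have := hρint fun _ => 1
      simp only [mul_one, integral_const, smul_eq_mul] at this
      rwa [this])
  set κ := min η₂ (γ / 3) with hκ
  have hκ0 : 0 < κ := lt_min hη₂0 (by linarith [h.γ_pos])
  have hκ2 : κ ≤ η₂ := min_le_left _ _
  have hκ3 : 3 * κ ≤ γ := by linarith [min_le_right η₂ (γ / 3)]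
  have hKexp : ∀ η, 0 ≤ η → η ≤ κ →
      Integrable (fun x => Real.exp (η * |x|)) (taylorMeasure μ) := fun η h0 hle =>
    (h.integrable_taylorMeasure (C := 1) (by fun_prop) h0 (by linarith) fun x => by
      rw [Real.abs_exp, one_mul]).1
  have hνexp : ∀ η, 0 < η → η ≤ κ → Integrable (fun x => Real.exp (η * |x|)) (convMix μ) :=
    fun η h0 hle => integrable_exp_convMix h0.le (hη₂ η h0 (hle.trans hκ2)).1
      (hη₂ η h0 (hle.trans hκ2)).2.le
  have hwexp : Integrable (fun x => |1 - s * ρ x| * Real.exp (κ * |x|)) (convMix μ) := by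
    have i1 : Integrable (fun x => Real.exp (κ * |x|) - s * (ρ x * Real.exp (κ * |x|)))
        (convMix μ) := (hνexp κ hκ0 le_rfl).sub ((hρi _ (hKexp κ hκ0.le le_rfl)).const_mul s)
    refine i1.abs.congr (ae_of_all _ fun x => ?_)
    simp only
    rw [← Real.abs_exp (κ * |x|), ← abs_mul, Real.abs_exp]
    ring_nf
  obtain ⟨η₁, hη₁0, hη₁κ, hη₁⟩ := exists_integral_mul_exp_abs_lt hκ0
    (w := fun x => |1 - s * ρ x|) (by fun_prop) (fun x => abs_nonneg _) hwexp hs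
  refine ⟨η₁, hη₁0, by linarith [h.γ_pos], fun η h0 hle f D hf hb hr => ?_⟩
  have hηκ : η ≤ κ := hle.trans hη₁κ
  have hD : 0 ≤ D := by
    have := (abs_nonneg _).trans (hb 0)
    simpa using this
  obtain ⟨a₀, ha₀⟩ := h.exists_taylor_average h0 (by linarith) hf hb hr
  set a := a₀ / (taylorMeasure μ).real univ with ha
  obtain ⟨hwi, hwq⟩ := hη₁ η h0 hle
  refine ⟨a, _, abs_le_of_abs_le_integral (F := fun y => f y - a) (C₀ := D + |a|)
    (C₁ := 6 * D + s * (D / η / η)) h0.le (by positivity) (by positivity) (fun x => abs_nonneg _)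
    hwi rfl hwq (fun y => ?_) fun y => ?_⟩
  · have e1 : 1 ≤ Real.exp (η * max y 0) :=
      Real.one_le_exp (mul_nonneg h0.le (le_max_right _ _))
    have e2 := mul_le_mul_of_nonneg_left e1 (abs_nonneg a)
    have e3 := abs_sub (f y) a
    linarith [hb y]
  · have hfb : ∀ x, |f x| ≤ D * Real.exp (η * |x|) := fun x =>
      (hb x).trans (exp_max_le h0.le hD x)
    have hexp := hη₂ η h0 (hηκ.trans hκ2)
    have d1 := abs_sub_integral_convMix_le h0.le hD hexp.1 hexp.2.le hf.measurable hfb hr y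
    have i1 := integrable_shift h0.le (hνexp η h0 hηκ) hf.measurable hfb y
    have i2 := integrable_shift h0.le (hKexp η h0.le hηκ) hf.measurable hfb y
    have i3 : Integrable (fun x => f (y + x) - a) (convMix μ) := i1.sub (integrable_const _)
    have i4 : Integrable (fun x => f (y + x) - a) (taylorMeasure μ) := i2.sub (integrable_const _)
    have i5 : Integrable (fun x => s * (ρ x * (f (y + x) - a))) (convMix μ) :=
      (hρi _ i4).const_mul s
    have i6 : Integrable (fun x => f (y + x) - a - s * (ρ x * (f (y + x) - a))) (convMix μ) :=
      i3.sub i5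
    have d2 : |∫ x, (f (y + x) - a - s * (ρ x * (f (y + x) - a))) ∂(convMix μ)|
        ≤ ∫ x, |1 - s * ρ x| * |f (y + x) - a| ∂(convMix μ) := by
      refine (abs_integral_le_integral_abs).trans_eq (integral_congr_ae (ae_of_all _ fun x => ?_))
      simp only
      rw [← abs_mul]
      ring_nf
    have d3 : |s * ∫ x, (f (y + x) - a) ∂(taylorMeasure μ)|
        ≤ s * (D / η / η * Real.exp (η * y)) := by
      rw [abs_mul, abs_of_pos hs0, integral_sub i2 (integrable_const _)]
      refine mul_le_mul_of_nonneg_left ?_ hs0.le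
      rw [integral_const, smul_eq_mul, ha, mul_div_cancel₀ _ hmass0.ne']
      exact ha₀ y
    rw [integral_sub i3 i5, integral_const_mul, hρint fun x => f (y + x) - a,
      integral_sub i1 (integrable_const _)] at d2
    simp only [integral_const, probReal_univ, one_smul] at d2
    set I₁ := ∫ x, f (y + x) ∂(convMix μ)
    set I₂ := ∫ x, (f (y + x) - a) ∂(taylorMeasure μ)
    set I₃ := ∫ x, |1 - s * ρ x| * |f (y + x) - a| ∂(convMix μ)
    have : f y - a = (f y - I₁) + (I₁ - a - s * I₂) + s * I₂ := by ring
    calc |f y - a| ≤ |f y - I₁| + |I₁ - a - s * I₂| + |s * I₂| := by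
          rw [this]
          exact abs_add_three _ _ _
      _ ≤ _ := by linarith

end IsBalancedLaw

end Renewal

section Profile

/-- `Ψ` solves the one-sided equation `Ψ y = E Ψ (wall y + z) - σ² / 2` and is exponentially close,
at `-∞`, to the parabola `y² / 2 - a y + b`. -/
structure IsProfile (μ : Measure ℝ) (Ψ : ℝ → ℝ) (a b C η : ℝ) : Prop where
  continuous : Continuous Ψ
  growth : ∀ y, |Ψ y| ≤ C * Real.exp (η * |y|)
  increment : ∀ u τ, 0 ≤ τ → |Ψ (u + τ) - Ψ u| ≤ τ * (C * Real.exp (η * |u|))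
  harmonic : ∀ y, Ψ y - ∫ x, Ψ (wall y + x) ∂μ = -((∫ x, x ^ 2 ∂μ) / 2)
  asymptotic : ∀ y, |Ψ y - (y ^ 2 / 2 - a * y + b)| ≤ C * Real.exp (η * y)

lemma IsProfile.const_nonneg {μ : Measure ℝ} {Ψ : ℝ → ℝ} {a b C η : ℝ}
    (hΨ : IsProfile μ Ψ a b C η) : 0 ≤ C := by
  have := (abs_nonneg _).trans (hΨ.growth 0)
  simpa using this

lemma abs_parabola_le {η : ℝ} (hη : 0 < η) (a b y : ℝ) :
    |y ^ 2 / 2 - a * y + b| ≤ (1 / η ^ 2 + |a| / η + |b|) * Real.exp (η * |y|) := by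
  have h1 := abs_pow_le_exp hη 1 y
  have h2 := abs_pow_le_exp hη 2 y
  have h3 : 1 ≤ Real.exp (η * |y|) := Real.one_le_exp (by positivity)
  norm_num at h1 h2
  calc |y ^ 2 / 2 - a * y + b| ≤ |y ^ 2 / 2| + |-(a * y)| + |b| := by
        rw [sub_eq_add_neg]
        exact abs_add_three _ _ _
    _ = y ^ 2 / 2 + |a| * |y| + |b| * 1 := by
        rw [abs_neg, abs_mul, abs_of_nonneg (by positivity : 0 ≤ y ^ 2 / 2), mul_one]
    _ ≤ (2 / η ^ 2 * Real.exp (η * |y|)) / 2 + |a| * (η⁻¹ * Real.exp (η * |y|))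
        + |b| * Real.exp (η * |y|) := by gcongr
    _ = _ := by ring

lemma eq_zero_of_abs_le_exp {η K c : ℝ} (hη : 0 < η)
    (h : ∀ y ≤ 0, |c| ≤ K * Real.exp (η * y)) : c = 0 := by
  have hlim : Tendsto (fun y : ℝ => K * Real.exp (η * y)) atBot (nhds (K * 0)) :=
    (Real.tendsto_exp_atBot.comp (tendsto_id.const_mul_atBot hη)).const_mul K
  rw [mul_zero] at hlim
  have := ge_of_tendsto hlim ((eventually_le_atBot 0).mono h)
  exact abs_nonpos_iff.1 this

namespace IsBalancedLaw

variable {μ : Measure ℝ} {ζ : ℝ → ℝ} {γ θ Cθ : ℝ}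

lemma integral_parabola (h : IsBalancedLaw μ ζ γ θ Cθ) (a b u : ℝ) :
    Integrable (fun x => (u + x) ^ 2 / 2 - a * (u + x) + b) μ ∧
      ∫ x, ((u + x) ^ 2 / 2 - a * (u + x) + b) ∂μ
        = u ^ 2 / 2 - a * u + b + (∫ x, x ^ 2 ∂μ) / 2 := by
  have := h.prob
  have i1 : Integrable (fun x => 2⁻¹ * x ^ 2) μ := h.integrable_sq.const_mul _
  have i2 : Integrable (fun x => (u - a) * x) μ := h.integrable_id.const_mul _
  have i3 : Integrable (fun x => 2⁻¹ * x ^ 2 + (u - a) * x) μ := i1.add i2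
  have i4 : Integrable (fun _ : ℝ => u ^ 2 / 2 - a * u + b) μ := integrable_const _
  have heq : (fun x => (u + x) ^ 2 / 2 - a * (u + x) + b)
      = fun x => 2⁻¹ * x ^ 2 + (u - a) * x + (u ^ 2 / 2 - a * u + b) := by
    funext x; ring
  rw [heq]
  refine ⟨i3.add i4, ?_⟩
  rw [integral_add i3 i4, integral_add i1 i2, integral_const_mul, integral_const_mul, h.mean]
  simp only [integral_const, probReal_univ, one_smul]
  ring

/-- The solution of the one-sided problem. -/
theorem exists_profile (h : IsBalancedLaw μ ζ γ θ Cθ) :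
    ∃ η₁, 0 < η₁ ∧ η₁ ≤ γ ∧ ∀ η, 0 < η → η ≤ η₁ → η ≤ 1 / 2 →
      ∃ Ψ a b C, IsProfile μ Ψ a b C η := by
  have := h.prob
  obtain ⟨V, C₀, hVa, hV0, hV, hVw⟩ := h.exists_fixedPoint
  have hVm : Measurable V := hVa.measurable
  have hVc := h.continuous_fixedPoint hVm hV hVw
  obtain ⟨η₀, hη₀, hdefect⟩ := h.exists_defect_le hVm hV hVw
  obtain ⟨η₁, hη₁, hη₁γ, hrenewal⟩ := h.exists_renewal
  refine ⟨min η₀ η₁, lt_min hη₀ hη₁, (min_le_right _ _).trans hη₁γ, fun η h0 hle hhalf => ?_⟩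
  obtain ⟨D, hD⟩ := hdefect η h0 (hle.trans (min_le_left _ _))
  obtain ⟨a, C₁, ha⟩ := hrenewal η h0 (hle.trans (min_le_right _ _)) (fun y => V y + y) D
    (hVc.add continuous_id) (fun y => (hD y).1) fun y => (hD y).2
  have hexp := h.exp_int_of_le ((hle.trans (min_le_right _ _)).trans hη₁γ)
  set Ψ : ℝ → ℝ := fun y => -∫ t in (0 : ℝ)..y, V t with hΨ
  have hΨd : ∀ y, HasDerivAt Ψ (-V y) y := fun y =>
    (hVc.integral_hasStrictDerivAt 0 y).hasDerivAt.neg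
  have hΨc : Continuous Ψ := continuous_iff_continuousAt.2 fun x => (hΨd x).continuousAt
  obtain ⟨b, hb⟩ := exists_abs_sub_le_of_deriv_le (g := fun y => Ψ y - (y ^ 2 / 2 - a * y))
    (g' := fun y => -(V y + y - a)) (C := C₁) h0 (fun y => by
      have e1 : HasDerivAt (fun y : ℝ => y ^ 2 / 2 - a * y) (y - a) y := by
        have := ((hasDerivAt_pow 2 y).div_const 2).sub ((hasDerivAt_id y).const_mul a)
        exact this.congr_deriv (by simp)
      refine ((hΨd y).sub e1).congr_deriv ?_
      ring) fun y => by rw [abs_neg]; exact ha y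
  have hC₀ : 0 ≤ C₀ := (abs_nonneg _).trans (hVw 0)
  have hC₁ : 0 ≤ C₁ := by
    have := (abs_nonneg _).trans (ha 0)
    simpa using this
  set CV := (C₀ + 1) * (1 + 1 / η) with hCV
  set CΨ := C₁ / η + (1 / η ^ 2 + |a| / η + |b|) with hCΨ
  have hCV0 : 0 ≤ CV := by positivity
  have hCΨ0 : 0 ≤ CΨ := by positivity
  have hVb : ∀ y, |V y| ≤ CV * Real.exp (η * |y|) := fun y => by
    refine (abs_le_of_fixedPoint hVw y).trans ?_
    rw [hCV, mul_assoc]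
    exact mul_le_mul_of_nonneg_left (one_add_abs_le_exp h0 y) (by linarith)
  have hasym : ∀ y, |Ψ y - (y ^ 2 / 2 - a * y + b)| ≤ C₁ / η * Real.exp (η * y) := fun y => by
    rw [← sub_sub]; exact hb y
  have hΨb : ∀ y, |Ψ y| ≤ CΨ * Real.exp (η * |y|) := fun y => by
    have e1 := hasym y
    have e2 := abs_parabola_le h0 a b y
    have e3 := mul_le_mul_of_nonneg_left (exp_mul_le_exp_mul_abs h0.le y)
      (by positivity : 0 ≤ C₁ / η)
    have e4 := abs_sub_abs_le_abs_sub (Ψ y) (y ^ 2 / 2 - a * y + b)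
    rw [hCΨ, add_mul]
    linarith
  have hinc : ∀ u τ, 0 ≤ τ → |Ψ (u + τ) - Ψ u| ≤ τ * (CV * Real.exp (η * |u|)) := by
    intro u τ hτ
    have e1 : Ψ (u + τ) - Ψ u = -∫ t in u..(u + τ), V t := by
      rw [← intervalIntegral.integral_interval_sub_left (hVc.intervalIntegrable 0 (u + τ))
        (hVc.intervalIntegrable 0 u), hΨ]
      ring
    have e2 : ∀ t ∈ Set.uIoc u (u + τ), ‖V t‖ ≤ V u := fun t ht => by
      rw [uIoc_of_le (by linarith)] at ht
      rw [Real.norm_eq_abs, abs_of_nonneg (hV0 t)]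
      exact hVa ht.1.le
    have e3 := intervalIntegral.norm_integral_le_of_norm_le_const e2
    rw [Real.norm_eq_abs, add_sub_cancel_left, abs_of_nonneg hτ] at e3
    rw [e1, abs_neg, mul_comm]
    refine e3.trans ?_
    rw [mul_comm, mul_comm _ τ]
    exact mul_le_mul_of_nonneg_left ((le_abs_self _).trans (hVb u)) hτ
  have hG : ∀ u, HasDerivAt (fun u => ∫ x, Ψ (u + x) ∂μ) (∫ x, -V (u + x) ∂μ) u := fun u =>
    hasDerivAt_integral_shift (F' := fun x => -V x) h0.le hexp hΨd hVm.neg hΨb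
      (fun x => by rw [abs_neg]; exact hVb x) u
  have hder : ∀ y, HasDerivAt (fun y => Ψ y - ∫ x, Ψ (wall y + x) ∂μ) 0 y := fun y => by
    refine ((hΨd y).sub ((hG (wall y)).comp y (hasDerivAt_wall y))).congr_deriv ?_
    rw [integral_neg, hV y]
    ring
  set c := Ψ 0 - ∫ x, Ψ (wall 0 + x) ∂μ with hc
  have hconst : ∀ y, Ψ y - ∫ x, Ψ (wall y + x) ∂μ = c := fun y =>
    is_const_of_deriv_eq_zero (fun y => (hder y).differentiableAt) (fun y => (hder y).deriv) y 0
  set σ := ∫ x, x ^ 2 ∂μ with hσ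
  set M := ∫ x, Real.exp (η * |x|) ∂μ with hM
  have hM0 : 0 ≤ M := integral_nonneg fun x => (Real.exp_pos _).le
  have hfree : ∀ u, |Ψ u - ∫ x, Ψ (u + x) ∂μ + σ / 2| ≤ C₁ / η * (1 + M) * Real.exp (η * u) := by
    intro u
    obtain ⟨i1, e1⟩ := h.integral_parabola a b u
    have i2 := integrable_shift h0.le hexp hΨc.measurable hΨb u
    have hpt : ∀ x, ‖Ψ (u + x) - ((u + x) ^ 2 / 2 - a * (u + x) + b)‖
        ≤ C₁ / η * Real.exp (η * u) * Real.exp (η * |x|) := fun x => by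
      refine (hasym (u + x)).trans ?_
      rw [mul_add, Real.exp_add, ← mul_assoc]
      exact mul_le_mul_of_nonneg_left (exp_mul_le_exp_mul_abs h0.le x) (by positivity)
    have e2 := norm_integral_le_of_norm_le (hexp.const_mul _) (ae_of_all _ hpt)
    rw [integral_sub i2 i1, integral_const_mul, e1, Real.norm_eq_abs] at e2
    have e3 := hasym u
    have e4 := abs_sub (Ψ u - (u ^ 2 / 2 - a * u + b))
      (∫ x, Ψ (u + x) ∂μ - (u ^ 2 / 2 - a * u + b + σ / 2))
    refine (le_of_eq (congrArg _ ?_)).trans (e4.trans ((add_le_add e3 e2).trans_eq ?_)) <;> ring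
  have hc0 : c + σ / 2 = 0 := by
    refine eq_zero_of_abs_le_exp h0 (K := CV * Real.exp η + C₁ / η * (1 + M)) fun y hy => ?_
    have e1 := hfree (wall y)
    have e2 := hinc (wall y) (Real.log (1 + Real.exp y)) (log_one_add_exp_pos y).le
    have e3 : wall y + Real.log (1 + Real.exp y) = y := by unfold wall; ring
    rw [e3] at e2
    have e4 : Real.exp (η * wall y) ≤ Real.exp (η * y) :=
      Real.exp_le_exp.2 (mul_le_mul_of_nonneg_left (wall_le y) h0.le)
    have e5 : Real.log (1 + Real.exp y) ≤ Real.exp y := by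
      have := Real.log_le_sub_one_of_pos (one_add_exp_pos y)
      linarith
    have e6 : Real.log (1 + Real.exp y) * (CV * Real.exp (η * |wall y|))
        ≤ CV * Real.exp η * Real.exp (η * y) := by
      calc Real.log (1 + Real.exp y) * (CV * Real.exp (η * |wall y|))
          ≤ Real.exp y * (CV * Real.exp (η * (|y| + 1))) := by
            gcongr
            exact abs_wall_le y
        _ = CV * Real.exp (y + η * (|y| + 1)) := by rw [Real.exp_add]; ring
        _ ≤ CV * Real.exp (η + η * y) := by
            refine mul_le_mul_of_nonneg_left (Real.exp_le_exp.2 ?_) hCV0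
            rw [abs_of_nonpos hy]
            nlinarith
        _ = _ := by rw [Real.exp_add]; ring
    have e7 : c + σ / 2 = (Ψ y - Ψ (wall y)) + (Ψ (wall y) - ∫ x, Ψ (wall y + x) ∂μ + σ / 2) := by
      rw [← hconst y]; ring
    have e8 : C₁ / η * (1 + M) * Real.exp (η * wall y) ≤ C₁ / η * (1 + M) * Real.exp (η * y) :=
      mul_le_mul_of_nonneg_left e4 (by positivity)
    rw [e7, add_mul]
    exact (abs_add_le _ _).trans (add_le_add (e2.trans e6) (e1.trans e8))
  have hmono : ∀ {A B t : ℝ}, A ≤ B → A * Real.exp t ≤ B * Real.exp t := fun hAB =>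
    mul_le_mul_of_nonneg_right hAB (Real.exp_pos _).le
  have hC₁η : 0 ≤ C₁ / η := by positivity
  refine ⟨Ψ, a, b, CV + CΨ, hΨc, fun y => (hΨb y).trans (hmono (by linarith)), fun u τ hτ =>
    (hinc u τ hτ).trans (mul_le_mul_of_nonneg_left (hmono (by linarith)) hτ), fun y => ?_,
    fun y => (hasym y).trans (hmono ?_)⟩
  · rw [hconst y]; linarith
  · have : 0 ≤ 1 / η ^ 2 + |a| / η + |b| := by positivity
    linarith

end IsBalancedLaw

end Profile

section Gluing

lemma hkfun_eq (k x : ℝ) :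
    hkfun k x = x + Real.log (1 + Real.exp (-x - k)) - Real.log (1 + Real.exp (x - k)) := by
  have e1 : Real.exp (-k) + Real.exp x = Real.exp x * (1 + Real.exp (-x - k)) := by
    rw [mul_add, ← Real.exp_add]; ring_nf
  rw [hkfun, e1, Real.log_div (mul_ne_zero (Real.exp_pos _).ne' (one_add_exp_pos _).ne')
    (one_add_exp_pos _).ne', Real.log_mul (Real.exp_pos _).ne' (one_add_exp_pos _).ne',
    Real.log_exp]

lemma hkfun_neg (k x : ℝ) : hkfun k (-x) = -hkfun k x := by
  rw [hkfun_eq, hkfun_eq, neg_neg]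
  ring

lemma continuous_hkfun (k : ℝ) : Continuous (hkfun k) := by
  rw [show hkfun k = fun x => _ from funext (hkfun_eq k)]
  have h1 : ∀ x, (1 : ℝ) + Real.exp (-x - k) ≠ 0 := fun x => (one_add_exp_pos _).ne'
  have h2 : ∀ x, (1 : ℝ) + Real.exp (x - k) ≠ 0 := fun x => (one_add_exp_pos _).ne'
  fun_prop (disch := assumption)

lemma hkfun_nonneg {k x : ℝ} (hk : 0 ≤ k) (hx : 0 ≤ x) : 0 ≤ hkfun k x := by
  refine Real.log_nonneg ((one_le_div (one_add_exp_pos _)).2 ?_)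
  rw [sub_eq_add_neg, Real.exp_add]
  nlinarith [Real.one_le_exp hx, Real.exp_le_one_iff.2 (neg_nonpos.2 hk)]

lemma abs_hkfun_le {k : ℝ} (hk : 0 ≤ k) (x : ℝ) : |hkfun k x| ≤ k := by
  have key : ∀ x, hkfun k x ≤ k := fun x => by
    have h1 : Real.exp (x - k) * Real.exp k = Real.exp x := by rw [← Real.exp_add]; ring_nf
    have h2 : Real.exp (-k) ≤ Real.exp k := Real.exp_le_exp.2 (by linarith)
    rw [hkfun, Real.log_le_iff_le_exp (by positivity), div_le_iff₀ (one_add_exp_pos _)]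
    linarith
  refine abs_le.2 ⟨?_, key x⟩
  have := key (-x)
  rw [hkfun_neg] at this
  linarith

lemma abs_wall_sub_le {k x : ℝ} (hk : 0 ≤ k) (hx : 0 ≤ x) : |wall (x - k)| ≤ k + 1 := by
  have h1 := wall_monotone (by linarith : -k ≤ x - k)
  have h2 := abs_wall_le (-k)
  rw [abs_of_neg (wall_neg _), abs_neg, abs_of_nonneg hk] at h2
  rw [abs_of_neg (wall_neg _)]
  linarith

lemma log_one_add_exp_le_exp_self (y : ℝ) : Real.log (1 + Real.exp y) ≤ Real.exp y := by
  have := Real.log_le_sub_one_of_pos (one_add_exp_pos y)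
  linarith

namespace IsProfile

variable {μ : Measure ℝ} {ζ : ℝ → ℝ} {γ θ Cθ : ℝ} {Ψ : ℝ → ℝ} {a b C η : ℝ}

/-- The two-sided equation on the half-line where the glued function is given by the profile. -/
lemma abs_defect_le (hΨ : IsProfile μ Ψ a b C η) (h : IsBalancedLaw μ ζ γ θ Cθ) (h0 : 0 < η)
    (hη : η ≤ γ) (hhalf : η ≤ 1 / 2) {k s β D : ℝ} (hk : 0 ≤ k) (hs0 : 0 ≤ s) (hs1 : s ≤ 1)
    {f : ℝ → ℝ} (hf : Measurable f)
    (hpos : ∀ t, 0 < t → f t = s * Ψ (t - k) + (t - k) / 2 + β)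
    (hclose : ∀ t, |f t - (s * Ψ (t - k) + (t - k) / 2 + β)|
      ≤ D * Real.exp (-η * k) * Real.exp (η * |t|)) {x : ℝ} (hx : 0 ≤ x)
    (hfx : f x = s * Ψ (x - k) + (x - k) / 2 + β) :
    |f x - ∫ t, f (t + hkfun k x) ∂μ - (Real.log (1 + Real.exp (x - k))
        + Real.log (1 + Real.exp (-x - k))) / 2 + s * ((∫ t, t ^ 2 ∂μ) / 2)|
      ≤ ((C * Real.exp η + D) * (∫ t, Real.exp (η * |t|) ∂μ) + 1) * Real.exp (-η * k) := by
  have := h.prob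
  have hexp := h.exp_int_of_le hη
  have hC := hΨ.const_nonneg
  have hD : 0 ≤ D := by
    have := (abs_nonneg _).trans (hclose 0)
    simp only [abs_zero, mul_zero, Real.exp_zero, mul_one] at this
    exact nonneg_of_mul_nonneg_left this (Real.exp_pos _)
  set M := ∫ t, Real.exp (η * |t|) ∂μ with hM
  have hM0 : 0 ≤ M := integral_nonneg fun t => (Real.exp_pos _).le
  set τ := Real.log (1 + Real.exp (-x - k)) with hτ
  have hτ0 : 0 ≤ τ := (log_one_add_exp_pos _).le
  have hτ1 : τ ≤ Real.exp (-k) :=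
    (log_one_add_exp_le_exp_self _).trans (Real.exp_le_exp.2 (by linarith))
  set w := wall (x - k) with hw
  have hhk : hkfun k x - k = w + τ := by
    rw [hkfun_eq, hw, wall]; ring
  have hh0 := hkfun_nonneg hk hx
  have hek : Real.exp (-k) ≤ Real.exp (-η * k) := Real.exp_le_exp.2 (by nlinarith)
  have i1 := integrable_shift h0.le hexp hΨ.continuous.measurable hΨ.growth (w + τ)
  have i2 := integrable_shift h0.le hexp hΨ.continuous.measurable hΨ.growth w
  set G₁ := ∫ t, Ψ (w + τ + t) ∂μ with hG₁
  set G₂ := ∫ t, Ψ (w + t) ∂μ with hG₂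
  have d1 : |G₁ - G₂| ≤ C * Real.exp η * M * Real.exp (-η * k) := by
    have hpt : ∀ t, ‖Ψ (w + τ + t) - Ψ (w + t)‖
        ≤ τ * (C * Real.exp (η * |w|)) * Real.exp (η * |t|) := fun t => by
      have e1 := hΨ.increment (w + t) τ hτ0
      have e2 : w + t + τ = w + τ + t := by ring
      rw [e2] at e1
      refine e1.trans ?_
      rw [mul_assoc, mul_assoc]
      exact mul_le_mul_of_nonneg_left (mul_le_mul_of_nonneg_left (exp_mul_abs_add_le h0.le _ _) hC)
        hτ0
    have e2 := norm_integral_le_of_norm_le (hexp.const_mul _) (ae_of_all _ hpt)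
    rw [integral_sub i1 i2, integral_const_mul] at e2
    refine e2.trans ?_
    have e3 : τ * Real.exp (η * |w|) ≤ Real.exp η * Real.exp (-η * k) := by
      calc τ * Real.exp (η * |w|) ≤ Real.exp (-k) * Real.exp (η * (k + 1)) := by
            gcongr
            exact abs_wall_sub_le hk hx
        _ = Real.exp (-k + η * (k + 1)) := (Real.exp_add _ _).symm
        _ ≤ Real.exp (η + -η * k) := Real.exp_le_exp.2 (by nlinarith)
        _ = _ := Real.exp_add _ _
    calc τ * (C * Real.exp (η * |w|)) * M = (C * M) * (τ * Real.exp (η * |w|)) := by ring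
      _ ≤ (C * M) * (Real.exp η * Real.exp (-η * k)) :=
        mul_le_mul_of_nonneg_left e3 (by positivity)
      _ = _ := by ring
  have hbase : ∀ t, s * Ψ (t + hkfun k x - k) + (t + hkfun k x - k) / 2 + β
      = s * Ψ (w + τ + t) + 2⁻¹ * t + ((w + τ) / 2 + β) := fun t => by
    have : t + hkfun k x - k = w + τ + t := by rw [← hhk]; ring
    rw [this]; ring
  have i3 : Integrable (fun t => s * Ψ (w + τ + t)) μ := i1.const_mul s
  have i4 : Integrable (fun t : ℝ => 2⁻¹ * t) μ := h.integrable_id.const_mul _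
  have i5 : Integrable (fun t => s * Ψ (w + τ + t) + 2⁻¹ * t) μ := i3.add i4
  have i6 : Integrable (fun t => s * Ψ (w + τ + t) + 2⁻¹ * t + ((w + τ) / 2 + β)) μ :=
    i5.add (integrable_const _)
  have hpt : ∀ t, ‖f (t + hkfun k x) - (s * Ψ (w + τ + t) + 2⁻¹ * t + ((w + τ) / 2 + β))‖
      ≤ D * Real.exp (-η * k) * Real.exp (η * |t|) := fun t => by
    rw [← hbase, Real.norm_eq_abs]
    rcases lt_or_ge 0 (t + hkfun k x) with ht | ht
    · rw [hpos _ ht, sub_self, abs_zero]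
      positivity
    · refine (hclose _).trans (mul_le_mul_of_nonneg_left (Real.exp_le_exp.2
        (mul_le_mul_of_nonneg_left ?_ h0.le)) (by positivity))
      rw [abs_of_nonpos ht, abs_of_nonpos (by linarith)]
      linarith
  have i7 : Integrable (fun t => f (t + hkfun k x)
      - (s * Ψ (w + τ + t) + 2⁻¹ * t + ((w + τ) / 2 + β))) μ :=
    (hexp.const_mul _).mono' ((hf.comp (measurable_add_const _)).aestronglyMeasurable.sub
      i6.aestronglyMeasurable) (ae_of_all _ hpt)
  have d2 := norm_integral_le_of_norm_le (hexp.const_mul _) (ae_of_all _ hpt)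
  have i8 : Integrable (fun t => f (t + hkfun k x)) μ := by
    refine (i7.add i6).congr (ae_of_all _ fun t => ?_)
    simp
  rw [integral_sub i8 i6, integral_add i5 (integrable_const _), integral_add i3 i4,
    integral_const_mul, integral_const_mul, integral_const_mul, h.mean, Real.norm_eq_abs] at d2
  simp only [integral_const, probReal_univ, one_smul] at d2
  have hharm : Ψ (x - k) - G₂ = -((∫ t, t ^ 2 ∂μ) / 2) := hΨ.harmonic (x - k)
  set I := ∫ t, f (t + hkfun k x) ∂μ
  have hLx : Real.log (1 + Real.exp (x - k)) = x - k - w := by rw [hw, wall]; ring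
  have hσ : (∫ t, t ^ 2 ∂μ) / 2 = G₂ - Ψ (x - k) := by linarith
  rw [hfx, hLx, hσ]
  have d3 : |-(s * (G₁ - G₂))| ≤ C * Real.exp η * M * Real.exp (-η * k) := by
    rw [abs_neg, abs_mul, abs_of_nonneg hs0]
    exact (mul_le_of_le_one_left (abs_nonneg _) hs1).trans d1
  have d4 : |-τ| ≤ Real.exp (-η * k) := by
    rw [abs_neg, abs_of_nonneg hτ0]
    exact hτ1.trans hek
  have d5 := abs_add_three (-(I - (s * G₁ + 2⁻¹ * 0 + ((w + τ) / 2 + β)))) (-(s * (G₁ - G₂))) (-τ)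
  rw [abs_neg] at d5
  refine (le_of_eq (congrArg _ ?_)).trans (d5.trans ((add_le_add_three d2 d3 d4).trans_eq ?_)) <;>
    ring

end IsProfile

namespace IsBalancedLaw

variable {μ : Measure ℝ} {ζ : ℝ → ℝ} {γ θ Cθ : ℝ}

/-- Approximate solutions of the Poisson equation of the projective chain. -/
theorem exists_approx_poisson (h : IsBalancedLaw μ ζ γ θ Cθ) :
    ∃ κ η K k₀, 0 < η ∧ η ≤ 1 / 2 ∧ η ≤ γ ∧ 0 ≤ k₀ ∧ ∀ k, k₀ ≤ k →
      ∃ (F : ℝ → ℝ) (C : ℝ), Measurable F ∧ (∀ t, |F t| ≤ C * Real.exp (η * |t|)) ∧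
        ∀ x, |F x - ∫ t, F (t + hkfun k x) ∂μ
        - Real.log (1 + Real.exp (x - k)) + (∫ t, t ^ 2 ∂μ) / 4 / (k + κ)|
          ≤ K * Real.exp (-η * k) := by
  have := h.prob
  have h' := h.reflect
  obtain ⟨η₁, hη₁, hη₁γ, hP₁⟩ := h.exists_profile
  obtain ⟨η₂, hη₂, hη₂γ, hP₂⟩ := h'.exists_profile
  set η := min (min η₁ η₂) (1 / 2) with hη
  have h0 : 0 < η := by positivity
  have hhalf : η ≤ 1 / 2 := min_le_right _ _
  have hle₁ : η ≤ η₁ := (min_le_left _ _).trans (min_le_left _ _)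
  have hle₂ : η ≤ η₂ := (min_le_left _ _).trans (min_le_right _ _)
  have hηγ : η ≤ γ := hle₁.trans hη₁γ
  obtain ⟨Ψ₁, a₁, b₁, C₁, hΨ₁⟩ := hP₁ η h0 hle₁ hhalf
  obtain ⟨Ψ₂, a₂, b₂, C₂, hΨ₂⟩ := hP₂ η h0 hle₂ hhalf
  have hC₁ := hΨ₁.const_nonneg
  have hC₂ := hΨ₂.const_nonneg
  have hexp := h.exp_int_of_le hηγ
  set M := ∫ t, Real.exp (η * |t|) ∂μ with hM
  have hM0 : 0 ≤ M := integral_nonneg fun t => (Real.exp_pos _).le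
  have hM' : ∫ t, Real.exp (η * |t|) ∂(μ.map Neg.neg) = M := by
    rw [integral_map measurable_neg.aemeasurable (by fun_prop)]
    simp [hM]
  have hσ' : ∫ t, t ^ 2 ∂(μ.map Neg.neg) = ∫ t, t ^ 2 ∂μ := by
    rw [integral_map measurable_neg.aemeasurable (by fun_prop)]
    simp
  refine ⟨(a₁ + a₂) / 2, η, ((C₁ + C₂) * Real.exp η + (C₁ + C₂)) * M + 1, |a₁ + a₂| + 1, h0, hhalf,
    hηγ, by positivity, fun k hk => ?_⟩
  have hk0 : 0 ≤ k := le_trans (by positivity) hk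
  have hden : 1 ≤ 2 * k + (a₁ + a₂) := by
    linarith [neg_abs_le (a₁ + a₂), abs_nonneg (a₁ + a₂)]
  set s := 1 / (2 * k + (a₁ + a₂)) with hs
  have hs0 : 0 ≤ s := by positivity
  have hs1 : s ≤ 1 := by rw [hs, div_le_one (by linarith)]; exact hden
  have hsd : s * (2 * k + (a₁ + a₂)) = 1 := by
    rw [hs]; field_simp
  set β := s * ((a₁ - a₂) * k + b₁ - b₂) with hβ
  set fR : ℝ → ℝ := fun x => s * Ψ₁ (x - k) + (x - k) / 2 + 0 with hfR
  set fL : ℝ → ℝ := fun x => s * Ψ₂ (-x - k) + (-x - k) / 2 + β with hfL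
  have hfRc : Continuous fR := by
    have := hΨ₁.continuous
    fun_prop
  have hfLc : Continuous fL := by
    have := hΨ₂.continuous
    fun_prop
  have hdiff : ∀ x, |fR x - fL x| ≤ (C₁ + C₂) * Real.exp (-η * k) * Real.exp (η * |x|) := by
    intro x
    have e1 := hΨ₁.asymptotic (x - k)
    have e2 := hΨ₂.asymptotic (-x - k)
    set A := Ψ₁ (x - k) - ((x - k) ^ 2 / 2 - a₁ * (x - k) + b₁)
    set B := Ψ₂ (-x - k) - ((-x - k) ^ 2 / 2 - a₂ * (-x - k) + b₂)
    have e3 : fR x - fL x = s * (A - B) + x * (1 - s * (2 * k + (a₁ + a₂))) := by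
      simp only [hfR, hfL, hβ, A, B]
      ring
    have e4 : ∀ u, u ≤ |x| → Real.exp (η * (u - k)) ≤ Real.exp (-η * k) * Real.exp (η * |x|) :=
      fun u hu => by
        rw [← Real.exp_add]
        refine Real.exp_le_exp.2 ?_
        nlinarith
    have e5 := mul_le_mul_of_nonneg_left (e4 x (le_abs_self x)) hC₁
    have e6 := mul_le_mul_of_nonneg_left (e4 (-x) (neg_le_abs x)) hC₂
    rw [e3, hsd, sub_self, mul_zero, add_zero, abs_mul, abs_of_nonneg hs0]
    refine (mul_le_of_le_one_left (abs_nonneg _) hs1).trans ((abs_sub A B).trans ?_)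
    linarith
  set f : ℝ → ℝ := fun x => if 0 ≤ x then fR x else fL x with hf
  have hfm : Measurable f := Measurable.ite measurableSet_Ici hfRc.measurable hfLc.measurable
  have hfpos : ∀ t, 0 ≤ t → f t = fR t := fun t ht => if_pos ht
  have hfneg : ∀ t, t < 0 → f t = fL t := fun t ht => if_neg (not_le.2 ht)
  have hE : 0 ≤ (C₁ + C₂) * Real.exp (-η * k) := by positivity
  have hcR : ∀ t, |f t - fR t| ≤ (C₁ + C₂) * Real.exp (-η * k) * Real.exp (η * |t|) := fun t => by
    rcases le_or_gt 0 t with ht | ht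
    · rw [hfpos t ht, sub_self, abs_zero]; positivity
    · rw [hfneg t ht, abs_sub_comm]; exact hdiff t
  have hcL : ∀ t, |f t - fL t| ≤ (C₁ + C₂) * Real.exp (-η * k) * Real.exp (η * |t|) := fun t => by
    rcases le_or_gt 0 t with ht | ht
    · rw [hfpos t ht]; exact hdiff t
    · rw [hfneg t ht, sub_self, abs_zero]; positivity
  have hdefect : ∀ x, |f x - ∫ t, f (t + hkfun k x) ∂μ - (Real.log (1 + Real.exp (x - k))
        + Real.log (1 + Real.exp (-x - k))) / 2 + s * ((∫ t, t ^ 2 ∂μ) / 2)|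
      ≤ (((C₁ + C₂) * Real.exp η + (C₁ + C₂)) * M + 1) * Real.exp (-η * k) := by
    intro x
    have hmono : ∀ C, C ≤ C₁ + C₂ → ((C * Real.exp η + (C₁ + C₂)) * M + 1) * Real.exp (-η * k)
        ≤ (((C₁ + C₂) * Real.exp η + (C₁ + C₂)) * M + 1) * Real.exp (-η * k) := fun C hC => by
      gcongr
    rcases le_or_gt 0 x with hx | hx
    · exact (hΨ₁.abs_defect_le h h0 hηγ hhalf hk0 hs0 hs1 hfm (fun t ht => hfpos t ht.le) hcR hx
        (hfpos x hx)).trans (hmono C₁ (by linarith))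
    · have key := hΨ₂.abs_defect_le (β := β) (f := fun t => f (-t)) (D := C₁ + C₂) h' h0 hηγ hhalf
        hk0 hs0 hs1 (hfm.comp measurable_neg) (fun t ht => by
          simp only [hfneg (-t) (by linarith), hfL, neg_neg]) (fun t => by
          have := hcL (-t)
          simp only [hfL, neg_neg, abs_neg] at this
          exact this) (x := -x) (by linarith) (by simp only [neg_neg, hfneg x hx, hfL])
      have hfi : AEStronglyMeasurable (fun t => f (-(t + hkfun k (-x)))) (μ.map Neg.neg) :=
        (hfm.comp (measurable_neg.comp (measurable_add_const _))).aestronglyMeasurable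
      rw [hM', hσ', integral_map measurable_neg.aemeasurable hfi] at key
      simp only [neg_neg, hkfun_neg, neg_add_rev] at key
      refine le_trans (le_of_eq ?_) (key.trans (hmono C₂ (by linarith)))
      simp only [add_comm (hkfun k x)]
      rw [add_comm (Real.log (1 + Real.exp (x - k)))]
  obtain ⟨C, hC⟩ : ∃ C, ∀ t, |t / 2 + f t| ≤ C * Real.exp (η * |t|) := by
    set E := Real.exp (η * k) with hEdef
    refine ⟨1 / η + C₁ * E + k / 2 + (C₁ + C₂) * Real.exp (-η * k), fun t => ?_⟩
    have e1 := abs_pow_le_exp h0 1 t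
    norm_num at e1
    have e2 : 1 ≤ Real.exp (η * |t|) := Real.one_le_exp (by positivity)
    have e3 : |Ψ₁ (t - k)| ≤ C₁ * E * Real.exp (η * |t|) := by
      refine (hΨ₁.growth _).trans ?_
      rw [mul_assoc, hEdef, mul_comm (Real.exp _)]
      refine mul_le_mul_of_nonneg_left ((exp_mul_abs_add_le h0.le t (-k)).trans_eq ?_) hC₁
      rw [abs_neg, abs_of_nonneg hk0]
    have e4 : |s * Ψ₁ (t - k)| ≤ C₁ * E * Real.exp (η * |t|) := by
      rw [abs_mul, abs_of_nonneg hs0]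
      exact (mul_le_of_le_one_left (abs_nonneg _) hs1).trans e3
    have e5 : t / 2 + f t = t + (s * Ψ₁ (t - k) + (f t - fR t)) + -(k / 2) := by
      simp only [hfR]; ring
    have e6 := abs_add_three t (s * Ψ₁ (t - k) + (f t - fR t)) (-(k / 2))
    have e7 := abs_add_le (s * Ψ₁ (t - k)) (f t - fR t)
    have e8 := hcR t
    rw [abs_neg, abs_of_nonneg (by positivity : 0 ≤ k / 2)] at e6
    have e9 : k / 2 ≤ k / 2 * Real.exp (η * |t|) := le_mul_of_one_le_right (by positivity) e2
    have e10 : |t| ≤ 1 / η * Real.exp (η * |t|) := by rw [one_div]; exact e1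
    rw [e5]
    linarith
  have hfi : ∀ u, Integrable (fun t => (t + u) / 2 + f (t + u)) μ := fun u => by
    have := integrable_shift h0.le hexp (F := fun t => t / 2 + f t)
      ((measurable_id.div_const 2).add hfm) hC u
    simpa only [add_comm u] using this
  refine ⟨fun t => t / 2 + f t, C, (measurable_id.div_const 2).add hfm, hC, fun x => ?_⟩
  have i1 : Integrable (fun t => (t + hkfun k x) / 2) μ :=
    (h.integrable_id.add (integrable_const _)).div_const 2
  have i2 : Integrable (fun t => f (t + hkfun k x)) μ := by
    refine ((hfi (hkfun k x)).sub i1).congr (ae_of_all _ fun t => ?_)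
    simp
  have e1 : ∫ t, (t + hkfun k x) / 2 ∂μ = hkfun k x / 2 := by
    rw [integral_div, integral_add h.integrable_id (integrable_const _), h.mean]
    simp
  have e2 : (∫ t, t ^ 2 ∂μ) / 4 / (k + (a₁ + a₂) / 2) = s * ((∫ t, t ^ 2 ∂μ) / 2) := by
    have : k + (a₁ + a₂) / 2 = (2 * k + (a₁ + a₂)) / 2 := by ring
    rw [this, hs]
    field_simp
    ring
  have e3 := hkfun_eq k x
  simp only
  rw [integral_add i1 i2, e1, e2]
  refine le_trans (le_of_eq (congrArg _ ?_)) (hdefect x)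
  rw [e3]
  ring

end IsBalancedLaw

end Gluing

section Matrices

lemma prodMat_succ (ε : ℝ) (zs : ℕ → ℝ) (n : ℕ) :
    prodMat ε zs (n + 1) = prodMat ε zs n * Mmat ε (Real.exp (zs n)) := by
  simp [prodMat, List.range_succ]

lemma prodMat_nonneg {ε : ℝ} (hε : 0 ≤ ε) (zs : ℕ → ℝ) (n : ℕ) (i j : Fin 2) :
    0 ≤ prodMat ε zs n i j := by
  induction n generalizing j with
  | zero => fin_cases i <;> fin_cases j <;> simp [prodMat]
  | succ n ih =>
    rw [prodMat_succ, Matrix.mul_apply]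
    refine Finset.sum_nonneg fun l _ => mul_nonneg (ih l) ?_
    fin_cases l <;> fin_cases j <;> simp [Mmat] <;> positivity

lemma prodMat_neg (ε : ℝ) (zs : ℕ → ℝ) (n : ℕ) :
    prodMat (-ε) zs n = !![prodMat ε zs n 0 0, -prodMat ε zs n 0 1;
      -prodMat ε zs n 1 0, prodMat ε zs n 1 1] := by
  induction n with
  | zero => ext i j; fin_cases i <;> fin_cases j <;> simp [prodMat]
  | succ n ih =>
    rw [prodMat_succ, prodMat_succ, ih]
    ext i j
    fin_cases i <;> fin_cases j <;>
      simp [Mmat, Matrix.mul_apply, Fin.sum_univ_two] <;> ring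

lemma matNorm_prodMat_neg (ε : ℝ) (zs : ℕ → ℝ) (n : ℕ) :
    matNorm (prodMat (-ε) zs n) = matNorm (prodMat ε zs n) := by
  rw [prodMat_neg]
  simp [matNorm, Fin.sum_univ_two]

lemma matNorm_prodMat_abs (ε : ℝ) (zs : ℕ → ℝ) (n : ℕ) :
    matNorm (prodMat |ε| zs n) = matNorm (prodMat ε zs n) := by
  rcases abs_choice ε with h | h <;> rw [h]
  exact matNorm_prodMat_neg ε zs n

/-- The projective action of the matrices `Mmat` on row vectors, in logarithmic coordinates. -/
noncomputable def chain (k : ℝ) (zs : ℕ → ℝ) : ℕ → ℝ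
  | 0 => zs 0
  | n + 1 => zs (n + 1) + hkfun k (chain k zs n)

lemma abs_chain_le {k : ℝ} (hk : 0 ≤ k) (zs : ℕ → ℝ) (n : ℕ) :
    |chain k zs n| ≤ |zs n| + k := by
  cases n with
  | zero => simpa [chain] using hk
  | succ n => exact (abs_add_le _ _).trans (add_le_add_right (abs_hkfun_le hk _) _)

lemma exp_hkfun (k x : ℝ) :
    Real.exp (hkfun k x) * Real.exp (Real.log (1 + Real.exp (x - k)))
      = Real.exp (-k) + Real.exp x := by
  have h : 0 < 1 + Real.exp (x - k) := by positivity
  rw [hkfun, Real.exp_log (by positivity), Real.exp_log h, div_mul_cancel₀ _ h.ne']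

lemma prodMat_col_sum (k : ℝ) (zs : ℕ → ℝ) (n : ℕ) :
    prodMat (Real.exp (-k)) zs (n + 1) 0 0 + prodMat (Real.exp (-k)) zs (n + 1) 1 0
        = Real.exp (∑ j ∈ Finset.range (n + 1), Real.log (1 + Real.exp (chain k zs j - k))) ∧
      prodMat (Real.exp (-k)) zs (n + 1) 0 1 + prodMat (Real.exp (-k)) zs (n + 1) 1 1
        = Real.exp (∑ j ∈ Finset.range (n + 1), Real.log (1 + Real.exp (chain k zs j - k)))
          * Real.exp (hkfun k (chain k zs n)) := by
  have hlog : ∀ x, Real.exp (Real.log (1 + Real.exp (x - k))) = 1 + Real.exp (-k) * Real.exp x := by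
    intro x
    rw [Real.exp_log (by positivity), ← Real.exp_add]
    ring_nf
  induction n with
  | zero =>
    have h := exp_hkfun k (zs 0)
    simp only [zero_add, Finset.sum_range_one, chain]
    rw [mul_comm, h, hlog, prodMat_succ]
    constructor <;> simp [prodMat, Mmat]
  | succ n ih =>
    obtain ⟨h0, h1⟩ := ih
    rw [Finset.sum_range_succ _ (n + 1), Real.exp_add, mul_assoc, mul_comm (Real.exp (Real.log _)),
      exp_hkfun, hlog, prodMat_succ _ _ (n + 1), chain, Real.exp_add]
    simp only [Matrix.mul_apply, Fin.sum_univ_two, Mmat, Matrix.of_apply, Matrix.cons_val',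
      Matrix.cons_val_zero, Matrix.cons_val_one, Matrix.cons_val_fin_one]
    constructor
    · linear_combination h0 + Real.exp (-k) * Real.exp (zs (n + 1)) * h1
    · linear_combination Real.exp (-k) * h0 + Real.exp (zs (n + 1)) * h1

lemma log_matNorm_prodMat (k : ℝ) (zs : ℕ → ℝ) (n : ℕ) :
    Real.log (matNorm (prodMat (Real.exp (-k)) zs (n + 1)))
      = ∑ j ∈ Finset.range (n + 1), Real.log (1 + Real.exp (chain k zs j - k))
        + Real.log (1 + Real.exp (hkfun k (chain k zs n))) := by
  obtain ⟨h0, h1⟩ := prodMat_col_sum k zs n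
  have hnn := prodMat_nonneg (Real.exp_pos (-k)).le zs (n + 1)
  have hm : matNorm (prodMat (Real.exp (-k)) zs (n + 1))
      = Real.exp (∑ j ∈ Finset.range (n + 1), Real.log (1 + Real.exp (chain k zs j - k)))
        * (1 + Real.exp (hkfun k (chain k zs n))) := by
    simp only [matNorm, Fin.sum_univ_two, abs_of_nonneg (hnn _ _)]
    linear_combination h0 + h1
  rw [hm, Real.log_mul (Real.exp_pos _).ne' (by positivity), Real.log_exp]

end Matrices

section Chain

variable {Ω : Type*} [MeasurableSpace Ω] {P : Measure Ω}

lemma integral_comp_add_of_indepFun [IsProbabilityMeasure P] {V W : Ω → ℝ} (hV : Measurable V)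
    (hW : Measurable W) (hVW : IndepFun V W P) {f F : ℝ → ℝ} (hf : Measurable f) (hF : Measurable F)
    (hint : Integrable (fun ω => F (W ω + f (V ω))) P) :
    Integrable (fun ω => ∫ t, F (t + f (V ω)) ∂(P.map W)) P ∧
      ∫ ω, F (W ω + f (V ω)) ∂P = ∫ ω, ∫ t, F (t + f (V ω)) ∂(P.map W) ∂P := by
  have hmap := (indepFun_iff_map_prod_eq_prod_map_map hV.aemeasurable hW.aemeasurable).1 hVW
  have := Measure.isProbabilityMeasure_map (μ := P) hV.aemeasurable
  have := Measure.isProbabilityMeasure_map (μ := P) hW.aemeasurable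
  have hG : Measurable fun p : ℝ × ℝ => F (p.2 + f p.1) :=
    hF.comp (measurable_snd.add (hf.comp measurable_fst))
  have hprod : Integrable (fun p : ℝ × ℝ => F (p.2 + f p.1)) ((P.map V).prod (P.map W)) := by
    rw [← hmap]
    exact (integrable_map_measure hG.aestronglyMeasurable (hV.prodMk hW).aemeasurable).2 hint
  have hleft := hprod.integral_prod_left
  refine ⟨(integrable_map_measure hleft.aestronglyMeasurable hV.aemeasurable).1 hleft, ?_⟩
  have h1 : ∫ ω, F (W ω + f (V ω)) ∂P
      = ∫ p : ℝ × ℝ, F (p.2 + f p.1) ∂((P.map V).prod (P.map W)) := by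
    rw [← hmap, integral_map (hV.prodMk hW).aemeasurable hG.aestronglyMeasurable]
  rw [h1, integral_prod _ hprod, integral_map hV.aemeasurable hleft.aestronglyMeasurable]

lemma measurable_chain (k : ℝ) {z : ℕ → Ω → ℝ} (hz : ∀ i, Measurable (z i)) (n : ℕ) :
    Measurable fun ω => chain k (fun i => z i ω) n := by
  induction n with
  | zero => exact hz 0
  | succ n ih => exact (hz (n + 1)).add ((continuous_hkfun k).measurable.comp ih)

lemma indepFun_chain (k : ℝ) {z : ℕ → Ω → ℝ} (hz : ∀ i, Measurable (z i))
    (hindep : iIndepFun z P) (n : ℕ) :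
    IndepFun (fun ω => chain k (fun i => z i ω) n) (z (n + 1)) P := by
  have hs : ∀ i, StronglyMeasurable (z i) := fun i => (hz i).stronglyMeasurable
  have had : ∀ n, Measurable[Filtration.natural z hs n] fun ω => chain k (fun i => z i ω) n := by
    intro n
    induction n with
    | zero => exact (Filtration.stronglyAdapted_natural hs 0).measurable
    | succ n ih =>
      exact (Filtration.stronglyAdapted_natural hs (n + 1)).measurable.add
        ((continuous_hkfun k).measurable.comp
          (ih.mono ((Filtration.natural z hs).mono n.le_succ) le_rfl))
  rw [IndepFun_iff_Indep]
  exact indep_of_indep_of_le_left (hindep.indep_comap_natural_of_lt hs n.lt_succ_self).symm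
    (had n).comap_le

/-- A solution of the approximate Poisson equation controls the growth rate of
`log (matNorm (prodMat ε zs n))`. -/
lemma abs_sub_le_of_approx_poisson [IsProbabilityMeasure P] {z : ℕ → Ω → ℝ}
    (hz : ∀ i, Measurable (z i)) (hindep : iIndepFun z P) {μ : Measure ℝ}
    (hlaw : ∀ i, P.map (z i) = μ) {k η C c e ℓ : ℝ}
    (hk : 0 ≤ k) (hη : 0 < η) (hexp : Integrable (fun x => Real.exp (η * |x|)) μ) {F : ℝ → ℝ}
    (hF : Measurable F) (hFb : ∀ t, |F t| ≤ C * Real.exp (η * |t|))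
    (hpoisson : ∀ x,
      |F x - ∫ t, F (t + hkfun k x) ∂μ - Real.log (1 + Real.exp (x - k)) + c| ≤ e)
    (hlim : Tendsto (fun n : ℕ => (n : ℝ)⁻¹ *
      ∫ ω, Real.log (matNorm (prodMat (Real.exp (-k)) (fun i => z i ω) n)) ∂P)
      atTop (nhds ℓ)) :
    |ℓ - c| ≤ e := by
  set V : ℕ → Ω → ℝ := fun n ω => chain k (fun i => z i ω) n with hVdef
  have hVm : ∀ n, Measurable (V n) := measurable_chain k hz
  have hC : 0 ≤ C := by
    have := (abs_nonneg _).trans (hFb 0)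
    simpa using this
  have hze : ∀ n, Integrable (fun ω => Real.exp (η * |z n ω|)) P := fun n =>
    (integrable_map_measure (g := fun x => Real.exp (η * |x|)) (by fun_prop)
      (hz n).aemeasurable).1 (by rw [hlaw n]; exact hexp)
  have hzi : ∀ n, ∫ ω, Real.exp (η * |z n ω|) ∂P = ∫ x, Real.exp (η * |x|) ∂μ := fun n => by
    rw [← hlaw n, integral_map (hz n).aemeasurable (by fun_prop)]
  have hVe : ∀ n ω, Real.exp (η * |V n ω|) ≤ Real.exp (η * k) * Real.exp (η * |z n ω|) := by
    intro n ω
    rw [← Real.exp_add]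
    have := abs_chain_le hk (fun i => z i ω) n
    exact Real.exp_le_exp.2 (by nlinarith)
  have hFV : ∀ n ω, ‖F (V n ω)‖ ≤ C * Real.exp (η * k) * Real.exp (η * |z n ω|) := by
    intro n ω
    rw [mul_assoc]
    exact (hFb _).trans (mul_le_mul_of_nonneg_left (hVe n ω) hC)
  have hFVi : ∀ n, Integrable (fun ω => F (V n ω)) P := fun n =>
    ((hze n).const_mul _).mono' (hF.comp (hVm n)).aestronglyMeasurable (ae_of_all _ (hFV n))
  obtain ⟨B, hB⟩ : ∃ B, ∀ n, |∫ ω, F (V n ω) ∂P| ≤ B := by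
    refine ⟨C * Real.exp (η * k) * ∫ x, Real.exp (η * |x|) ∂μ, fun n => ?_⟩
    rw [← hzi n, ← integral_const_mul]
    exact norm_integral_le_of_norm_le ((hze n).const_mul _) (ae_of_all _ (hFV n))
  have hgb : ∀ x, ‖Real.log (1 + Real.exp (x - k))‖ ≤ |x| + 1 := by
    intro x
    rw [Real.norm_eq_abs, abs_of_pos (log_one_add_exp_pos _)]
    refine (log_one_add_exp_le _).trans (add_le_add_left (max_le ?_ (abs_nonneg x)) 1)
    linarith [le_abs_self x]
  have hgi : ∀ n, Integrable (fun ω => Real.log (1 + Real.exp (V n ω - k))) P := by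
    intro n
    refine ((hze n).const_mul (1 / η * Real.exp (η * k) + Real.exp (η * k))).mono'
      ((((hVm n).sub_const k).exp.const_add 1).log.aestronglyMeasurable)
      (ae_of_all _ fun ω => (hgb _).trans ?_)
    have h1 := abs_pow_le_exp hη 1 (V n ω)
    simp only [pow_one, Nat.factorial_one, Nat.cast_one] at h1
    have h2 := hVe n ω
    have h3 : 1 ≤ Real.exp (η * |V n ω|) := Real.one_le_exp (by positivity)
    have h4 : 1 / η * Real.exp (η * |V n ω|)
        ≤ 1 / η * (Real.exp (η * k) * Real.exp (η * |z n ω|)) :=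
      mul_le_mul_of_nonneg_left h2 (by positivity)
    linarith
  have hrb : ∀ x, ‖Real.log (1 + Real.exp (hkfun k x))‖ ≤ k + 1 := by
    intro x
    rw [Real.norm_eq_abs, abs_of_pos (log_one_add_exp_pos _)]
    exact (log_one_add_exp_le _).trans
      (add_le_add_left (max_le ((le_abs_self _).trans (abs_hkfun_le hk x)) hk) 1)
  have hri : ∀ n, Integrable (fun ω => Real.log (1 + Real.exp (hkfun k (V n ω)))) P := fun n =>
    (integrable_const (k + 1)).mono'
      (((continuous_hkfun k).measurable.comp (hVm n)).exp.const_add 1).log.aestronglyMeasurable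
      (ae_of_all _ fun ω => hrb _)
  have hstep : ∀ n, |∫ ω, Real.log (1 + Real.exp (V n ω - k)) ∂P - c
      - (∫ ω, F (V n ω) ∂P - ∫ ω, F (V (n + 1) ω) ∂P)| ≤ e := by
    intro n
    obtain ⟨hi, heq⟩ := integral_comp_add_of_indepFun (hVm n) (hz (n + 1))
      (indepFun_chain k hz hindep n) (continuous_hkfun k).measurable hF (hFVi (n + 1))
    rw [hlaw] at hi heq
    have heq' : ∫ ω, F (V (n + 1) ω) ∂P = ∫ ω, ∫ t, F (t + hkfun k (V n ω)) ∂μ ∂P := heq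
    have h1 : Integrable (fun ω => F (V n ω) - ∫ t, F (t + hkfun k (V n ω)) ∂μ) P :=
      (hFVi n).sub hi
    have h2 : Integrable (fun ω => F (V n ω) - ∫ t, F (t + hkfun k (V n ω)) ∂μ
        - Real.log (1 + Real.exp (V n ω - k))) P := h1.sub (hgi n)
    have h3 : ∫ ω, (F (V n ω) - ∫ t, F (t + hkfun k (V n ω)) ∂μ
        - Real.log (1 + Real.exp (V n ω - k)) + c) ∂P
        = ∫ ω, F (V n ω) ∂P - ∫ ω, F (V (n + 1) ω) ∂P
          - ∫ ω, Real.log (1 + Real.exp (V n ω - k)) ∂P + c := by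
      rw [integral_add h2 (integrable_const c), integral_sub h1 (hgi n),
        integral_sub (hFVi n) hi, heq']
      simp
    have h4 : ∀ ω, ‖F (V n ω) - ∫ t, F (t + hkfun k (V n ω)) ∂μ
        - Real.log (1 + Real.exp (V n ω - k)) + c‖ ≤ e := fun ω => hpoisson _
    have h5 := norm_integral_le_of_norm_le (integrable_const e) (ae_of_all P h4)
    rw [h3, Real.norm_eq_abs] at h5
    rw [abs_sub_comm]
    refine le_trans (le_of_eq ?_) (h5.trans_eq (by simp))
    congr 1
    ring
  have hsum : ∀ n : ℕ, |∑ j ∈ Finset.range n, ∫ ω, Real.log (1 + Real.exp (V j ω - k)) ∂P - n * c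
      - (∫ ω, F (V 0 ω) ∂P - ∫ ω, F (V n ω) ∂P)| ≤ n * e := by
    intro n
    induction n with
    | zero => simp
    | succ n ih =>
      rw [Finset.sum_range_succ]
      have h1 := abs_le.1 ih
      have h2 := abs_le.1 (hstep n)
      push_cast
      exact abs_le.2 ⟨by linarith [h1.1, h2.1], by linarith [h1.2, h2.2]⟩
  have hnorm : ∀ n : ℕ,
      |∫ ω, Real.log (matNorm (prodMat (Real.exp (-k)) (fun i => z i ω) (n + 1))) ∂P
        - ((n + 1 : ℕ) : ℝ) * c| ≤ ((n + 1 : ℕ) : ℝ) * e + (2 * B + (k + 1)) := by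
    intro n
    simp only [log_matNorm_prodMat]
    rw [integral_add (integrable_finsetSum _ fun j _ => hgi j) (hri n),
      integral_finsetSum _ fun j _ => hgi j]
    have h1 := norm_integral_le_of_norm_le (integrable_const (k + 1))
      (ae_of_all P fun ω => hrb (V n ω))
    simp only [integral_const, probReal_univ, one_smul, Real.norm_eq_abs] at h1
    have h2 := abs_le.1 h1
    have h3 := abs_le.1 (hsum (n + 1))
    have h4 := abs_le.1 (hB 0)
    have h5 := abs_le.1 (hB (n + 1))
    exact abs_le.2 ⟨by linarith [h2.1, h3.1, h4.1, h5.2], by linarith [h2.2, h3.2, h4.2, h5.1]⟩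
  have hlim1 : Tendsto (fun n : ℕ => |((n + 1 : ℕ) : ℝ)⁻¹ *
      ∫ ω, Real.log (matNorm (prodMat (Real.exp (-k)) (fun i => z i ω) (n + 1))) ∂P - c|)
      atTop (nhds |ℓ - c|) :=
    (((tendsto_add_atTop_iff_nat 1).2 hlim).sub_const c).abs
  have hlim2 : Tendsto (fun n : ℕ => e + (2 * B + (k + 1)) * ((n + 1 : ℕ) : ℝ)⁻¹)
      atTop (nhds (e + (2 * B + (k + 1)) * 0)) :=
    (((tendsto_add_atTop_iff_nat 1).2 tendsto_inv_atTop_nhds_zero_nat).const_mul _).const_add _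
  rw [mul_zero, add_zero] at hlim2
  refine le_of_tendsto_of_tendsto' hlim1 hlim2 fun n => ?_
  have hn : (0 : ℝ) < ((n + 1 : ℕ) : ℝ) := by positivity
  have h := mul_le_mul_of_nonneg_left (hnorm n) (inv_pos.2 hn).le
  rw [← abs_of_pos (inv_pos.2 hn), ← abs_mul, abs_of_pos (inv_pos.2 hn), mul_sub, mul_add,
    inv_mul_cancel_left₀ hn.ne', inv_mul_cancel_left₀ hn.ne'] at h
  linarith

end Chain

section Tail

variable {Ω : Type*} [MeasurableSpace Ω] {P : Measure Ω}

lemma integrable_exp_of_tail [IsProbabilityMeasure P] {Y : Ω → ℝ} (hY : Measurable Y)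
    {δ C : ℝ} (hδ : 0 < δ) (htail : ∀ x : ℝ, 0 ≤ x →
      P {ω | x < |Y ω|} ≤ ENNReal.ofReal (C * Real.exp (-δ * x))) :
    Integrable (fun ω => Real.exp (δ / 2 * |Y ω|)) P := by
  have hg : ∀ y, ∫ t in (0 : ℝ)..y, δ / 2 * Real.exp (δ / 2 * t)
      = Real.exp (δ / 2 * y) - 1 := by
    intro y
    rw [intervalIntegral.integral_eq_sub_of_hasDerivAt
      (f := fun t => Real.exp (δ / 2 * t)) (fun t _ => ?_)
      (Continuous.intervalIntegrable (by fun_prop) _ _)]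
    · simp
    · exact ((hasDerivAt_id t).const_mul (δ / 2)).exp.congr_deriv (by simp [mul_comm])
  have hint : IntegrableOn (fun t : ℝ => C * (δ / 2) * Real.exp (-(δ / 2) * t)) (Ioi 0) :=
    (exp_neg_integrableOn_Ioi 0 (by positivity)).const_mul _
  have hcake := lintegral_comp_eq_lintegral_meas_lt_mul P (f := fun ω => |Y ω|)
    (g := fun t => δ / 2 * Real.exp (δ / 2 * t)) (ae_of_all _ fun ω => abs_nonneg _)
    hY.abs.aemeasurable (fun t _ => Continuous.intervalIntegrable (by fun_prop) _ _)
    (ae_of_all _ fun t => by positivity)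
  simp only [hg] at hcake
  have hfin : ∫⁻ ω, ENNReal.ofReal (Real.exp (δ / 2 * |Y ω|) - 1) ∂P < ⊤ := by
    rw [hcake]
    refine lt_of_le_of_lt ?_ hint.lintegral_lt_top
    refine setLIntegral_mono' measurableSet_Ioi fun t ht => ?_
    refine (mul_le_mul_left (htail t (le_of_lt ht)) _).trans_eq ?_
    rw [← ENNReal.ofReal_mul' (by positivity)]
    congr 1
    have : Real.exp (-(δ / 2) * t) = Real.exp (-δ * t) * Real.exp (δ / 2 * t) := by
      rw [← Real.exp_add]
      ring_nf
    rw [this]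
    ring
  have hsub : Integrable (fun ω => Real.exp (δ / 2 * |Y ω|) - 1) P := by
    refine ⟨by fun_prop, ?_⟩
    rw [hasFiniteIntegral_iff_ofReal (ae_of_all _ fun ω => ?_)]
    · exact hfin
    · exact sub_nonneg.2 (Real.one_le_exp (by positivity))
  exact (hsub.add (integrable_const (1 : ℝ))).congr (ae_of_all _ fun ω => sub_add_cancel _ _)

end Tail

end BalancedLyapunov

/-- Theorem 1.1: sharp log-Hölder behavior of the top Lyapunov exponent in the
balanced case E[log Z] = 0. -/
theorem stmt0
    {Ω : Type*} [MeasurableSpace Ω] (P : Measure Ω) [IsProbabilityMeasure P]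
    (z : ℕ → Ω → ℝ) (hzmeas : ∀ i, Measurable (z i))
    (hindep : iIndepFun z P)
    (ζ : ℝ → ℝ) (hζmeas : Measurable ζ) (hζnn : ∀ x, 0 ≤ ζ x)
    (hlaw : ∀ i, Measure.map (z i) P = volume.withDensity (fun x => ENNReal.ofReal (ζ x)))
    (hmean : ∫ ω, z 0 ω ∂P = 0)
    (δ : ℝ) (hδ : 0 < δ) (Cδ : ℝ)
    (htail : ∀ x : ℝ, 0 ≤ x → P {ω | x < |z 0 ω|} ≤ ENNReal.ofReal (Cδ * Real.exp (-δ * x)))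
    (θ : ℝ) (hθ0 : 0 < θ) (hθ1 : θ ≤ 1) (Cθ : ℝ)
    (hHolder : ∀ x y : ℝ, |ζ x - ζ y| ≤ Cθ * |x - y| ^ θ)
    (ℒ : ℝ → ℝ)
    (hℒ : ∀ ε : ℝ, 0 < |ε| → |ε| < 1 →
      Tendsto (fun n : ℕ =>
          (n : ℝ)⁻¹ * ∫ ω, Real.log (matNorm (prodMat ε (fun i => z i ω) n)) ∂P)
        atTop (nhds (ℒ ε))) :
    ∃ κ₁ κ₂ η : ℝ, 0 < κ₁ ∧ 0 < η ∧ η < 1 ∧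
      ∃ C > 0, ∃ ε₀ > 0, ∀ ε : ℝ, 0 < |ε| → |ε| < ε₀ →
        |ℒ ε - κ₁ / (Real.log (1 / |ε|) + κ₂)| ≤ C * |ε| ^ η := by
  have hbal : BalancedLyapunov.IsBalancedLaw (P.map (z 0)) ζ (δ / 2) θ Cθ :=
    { prob := Measure.isProbabilityMeasure_map (hzmeas 0).aemeasurable
      meas := hζmeas
      nonneg := hζnn
      law := hlaw 0
      mean := by rwa [integral_map (hzmeas 0).aemeasurable (by fun_prop)]
      γ_pos := by positivity
      exp_int := (integrable_map_measure (by fun_prop) (hzmeas 0).aemeasurable).2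
        (BalancedLyapunov.integrable_exp_of_tail (hzmeas 0) hδ htail)
      θ_pos := hθ0
      θ_le := hθ1
      holder := hHolder }
  obtain ⟨κ, η, K, k₀, hη, hη1, hηγ, hk₀, H⟩ := hbal.exists_approx_poisson
  refine ⟨(∫ t, t ^ 2 ∂(P.map (z 0))) / 4, κ, η, div_pos hbal.variance_pos (by norm_num), hη,
    by linarith, max K 1, by positivity, Real.exp (-k₀), Real.exp_pos _, fun ε hε0 hε => ?_⟩
  set k := Real.log (1 / |ε|) with hk
  have hk' : -k = Real.log |ε| := by rw [hk, one_div, Real.log_inv, neg_neg]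
  have hexp : Real.exp (-k) = |ε| := by rw [hk', Real.exp_log hε0]
  have hkk : k₀ ≤ k := by
    rw [← hexp, Real.exp_lt_exp] at hε
    linarith
  have hε1 : |ε| < 1 := hε.trans_le (Real.exp_le_one_iff.2 (by linarith))
  obtain ⟨F, C, hF, hFb, hFp⟩ := H k hkk
  have hlim := hℒ ε hε0 hε1
  simp only [← BalancedLyapunov.matNorm_prodMat_abs ε, ← hexp] at hlim
  have h := BalancedLyapunov.abs_sub_le_of_approx_poisson hzmeas hindep
    (fun i => (hlaw i).trans (hlaw 0).symm) (hk₀.trans hkk) hη (hbal.exp_int_of_le hηγ) hF hFb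
    hFp hlim
  have hpow : |ε| ^ η = Real.exp (-η * k) := by
    rw [Real.rpow_def_of_pos hε0, ← hk']
    ring_nf
  rw [hpow]
  exact h.trans (mul_le_mul_of_nonneg_right (le_max_left _ _) (Real.exp_pos _).le)
end

section
/- Fix w₀ > 0 and a closed interval I ⊂ (w₀ − 1/2, w₀). Then, as |Im u| → ∞ and uniformly for Re u ∈ I, one has (1/|Γ(u)|) ∫_{w₀ − i∞}^{w₀ + i∞} |Γ(w)| |Γ(u − w)| |dw| = O(|Im u|^{1/2}), where Γ is the complex Gamma function and the integral is over the vertical line Re w = w₀. -/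
open MeasureTheory Real Filter Set

lemma Complex.norm_Gamma_le_Gamma_re {s : ℂ} (hs : 0 < s.re) :
    ‖Complex.Gamma s‖ ≤ Real.Gamma s.re := by
  rw [Complex.Gamma_eq_integral hs, Real.Gamma_eq_integral hs, Complex.GammaIntegral]
  refine (norm_integral_le_integral_norm _).trans_eq
    (setIntegral_congr_fun measurableSet_Ioi fun x hx => ?_)
  simp only [norm_mul, Complex.norm_real, Real.norm_eq_abs, Real.abs_exp]
  rw [Complex.norm_cpow_eq_rpow_re_of_pos hx]
  simp

lemma Complex.norm_Gamma_half_le {s : ℂ} (hs : s.re = 1 / 2) :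
    ‖Complex.Gamma s‖ ≤ √(2 * π) * rexp (-(π / 2) * |s.im|) := by
  have hs' : s = 1 / 2 + s.im * Complex.I := by
    apply Complex.ext <;> simp [hs]
  have hconj : 1 - s = (starRingEnd ℂ) s := by
    apply Complex.ext <;> simp [hs]; norm_num
  have hsin : Complex.sin (π * s) = (Real.cosh (π * s.im) : ℂ) := by
    rw [hs', show (π : ℂ) * (1 / 2 + s.im * Complex.I) = (π * s.im : ℂ) * Complex.I + π / 2 by ring,
      Complex.sin_add_pi_div_two, Complex.cos_mul_I]
    simp
  have h := congrArg norm (Complex.Gamma_mul_Gamma_one_sub s)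
  rw [hconj, Complex.Gamma_conj, norm_mul, RCLike.norm_conj, hsin, norm_div, Complex.norm_real,
    Complex.norm_real, Real.norm_eq_abs, Real.norm_eq_abs, abs_of_pos pi_pos,
    abs_of_pos (Real.cosh_pos _)] at h
  have hcosh : rexp (π * |s.im|) ≤ 2 * Real.cosh (π * s.im) := by
    rw [← Real.cosh_abs, abs_mul, abs_of_pos pi_pos, Real.cosh_eq]
    linarith [Real.exp_pos (-(π * |s.im|))]
  refine abs_le_of_sq_le_sq' ?_ (by positivity) |>.2
  rw [sq, h, mul_pow, Real.sq_sqrt (by positivity), ← Real.exp_nat_mul,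
    show ((2 : ℕ) : ℝ) * (-(π / 2) * |s.im|) = -(π * |s.im|) by push_cast; ring, Real.exp_neg,
    ← div_eq_mul_inv, div_le_div_iff₀ (Real.cosh_pos _) (Real.exp_pos _)]
  nlinarith [pi_pos]

lemma Complex.norm_Gamma_le_of_mem_strip : ∃ K > 0, ∀ s : ℂ, 1 / 2 ≤ s.re → s.re ≤ 3 / 2 →
    ‖Complex.Gamma s‖ ≤ K * (1 + |s.im|) ^ (s.re - 1 / 2) * rexp (-(π / 2) * |s.im|) := by
  set K : ℝ := √(2 * π) * rexp 5 with hK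
  have hKpos : 0 < K := by positivity
  refine ⟨K, hKpos, fun s hs₁ hs₂ => ?_⟩
  set E : ℝ := rexp (-(π / 2) * |s.im|) with hE
  have hEpos : 0 < E := Real.exp_pos _
  set f : ℂ → ℂ := fun z => Complex.Gamma (z + s.im * Complex.I) * Complex.exp (z ^ 2) with hf
  have hexp (z : ℂ) : ‖Complex.exp (z ^ 2)‖ = rexp (z.re ^ 2 - z.im ^ 2) := by
    rw [Complex.norm_exp]; congr 1; simp [sq]
  have hdiff : ∀ z : ℂ, 0 < z.re → DifferentiableAt ℂ f z := by
    intro z hz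
    refine DifferentiableAt.mul (DifferentiableAt.comp z (Complex.differentiableAt_Gamma _ ?_)
      (by fun_prop)) (by fun_prop)
    intro m hm
    have := congrArg Complex.re hm
    simp at this
    have : (0 : ℝ) ≤ m := m.cast_nonneg
    linarith
  have hd : DiffContOnCl ℂ f (Complex.HadamardThreeLines.verticalStrip (1 / 2) (3 / 2)) := by
    refine DifferentiableOn.diffContOnCl fun z hz => (hdiff z ?_).differentiableWithinAt
    rw [Complex.HadamardThreeLines.verticalStrip, Complex.closure_preimage_re,
      closure_Ioo (by norm_num)] at hz
    have := hz.1
    linarith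
  have hB : BddAbove ((norm ∘ f) '' Complex.HadamardThreeLines.verticalClosedStrip
      (1 / 2) (3 / 2)) := by
    obtain ⟨M, hM⟩ := (isCompact_Icc (a := (1 / 2 : ℝ)) (b := 3 / 2)).exists_bound_of_continuousOn
      (f := Real.Gamma) (Real.differentiableOn_Gamma_Ioi.continuousOn.mono fun x hx =>
        lt_of_lt_of_le (by norm_num) hx.1)
    refine ⟨M * rexp 3, ?_⟩
    rintro _ ⟨z, ⟨hz₁, hz₂⟩, rfl⟩
    simp only [Function.comp, hf, norm_mul, hexp]
    have h1 := Complex.norm_Gamma_le_Gamma_re (s := z + s.im * Complex.I) (by simp; linarith)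
    have h2 := (le_abs_self _).trans (hM z.re ⟨hz₁, hz₂⟩)
    simp only [Complex.add_re, Complex.mul_re, Complex.ofReal_re, Complex.I_re, mul_zero,
      Complex.ofReal_im, Complex.I_im, mul_one, sub_self, add_zero] at h1
    have h3 : z.re ^ 2 - z.im ^ 2 ≤ 3 := by nlinarith [sq_nonneg z.im]
    have := h1.trans h2
    exact mul_le_mul this (Real.exp_le_exp.2 h3) (Real.exp_pos _).le ((norm_nonneg _).trans this)
  have hline {z : ℂ} (hz : z.re = 1 / 2) (c d : ℝ) (hc : c ≤ 9 / 4)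
      (hd : 0 ≤ d) (hd' : d ≤ |z.im|) :
      ‖Complex.Gamma (z + s.im * Complex.I)‖ * rexp (c - z.im ^ 2 + d) ≤ K * E := by
    have h1 := Complex.norm_Gamma_half_le (s := z + s.im * Complex.I) (by simp [hz])
    refine (mul_le_mul_of_nonneg_right h1 (Real.exp_pos _).le).trans ?_
    rw [hK, hE, mul_assoc, mul_assoc, ← Real.exp_add, ← Real.exp_add]
    refine mul_le_mul_of_nonneg_left (Real.exp_le_exp.2 ?_) (Real.sqrt_nonneg _)
    have h2 : |s.im| ≤ |z.im + s.im| + |z.im| := by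
      have := abs_sub (z.im + s.im) z.im
      simpa using this
    have h3 : (z + s.im * Complex.I).im = z.im + s.im := by simp
    rw [h3, ← sq_abs z.im]
    have h4 := pi_pos
    have h5 := pi_lt_four
    have h6 := mul_le_mul_of_nonneg_left h2 (by positivity : 0 ≤ π / 2)
    nlinarith [sq_nonneg (|z.im| - 3 / 2), abs_nonneg z.im]
  have ha : ∀ z ∈ Complex.re ⁻¹' {(1 / 2 : ℝ)}, ‖f z‖ ≤ K * E := by
    intro z hz
    replace hz : z.re = 1 / 2 := hz
    have := hline hz (1 / 4) 0 (by norm_num) le_rfl (abs_nonneg _)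
    simp only [hf, norm_mul, hexp, hz]
    convert this using 3
    ring
  have hb : ∀ z ∈ Complex.re ⁻¹' {(3 / 2 : ℝ)}, ‖f z‖ ≤ K * ((1 + |s.im|) * E) := by
    intro z hz
    replace hz : z.re = 3 / 2 := hz
    have h1 := hline (z := z - 1) (by simp [hz]; norm_num) (9 / 4) |z.im| le_rfl
      (abs_nonneg _) (by simp)
    have h0 : z - 1 + s.im * Complex.I ≠ 0 := by
      intro h
      have := congrArg Complex.re h
      simp [hz] at this
      norm_num at this
    have h2 : Complex.Gamma (z + s.im * Complex.I) =
        (z - 1 + s.im * Complex.I) * Complex.Gamma (z - 1 + s.im * Complex.I) := by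
      rw [← Complex.Gamma_add_one _ h0]; congr 1; ring
    have h3 : ‖z - 1 + s.im * Complex.I‖ ≤ (1 + |s.im|) * rexp |z.im| := by
      refine (Complex.norm_le_abs_re_add_abs_im _).trans ?_
      have e1 : (z - 1 + s.im * Complex.I).re = 1 / 2 := by simp [hz]; norm_num
      have e2 : (z - 1 + s.im * Complex.I).im = z.im + s.im := by simp
      rw [e1, e2, abs_of_pos (by norm_num : (0 : ℝ) < 1 / 2)]
      have := abs_add_le z.im s.im
      have := Real.add_one_le_exp |z.im|
      nlinarith [abs_nonneg z.im, abs_nonneg s.im]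
    simp only [hf, norm_mul, hexp, hz, h2]
    simp only [Complex.sub_im, Complex.one_im, sub_zero] at h1
    rw [Real.exp_add] at h1
    calc _ ≤ ((1 + |s.im|) * rexp |z.im|) * ‖Complex.Gamma (z - 1 + s.im * Complex.I)‖ *
          rexp ((3 / 2) ^ 2 - z.im ^ 2) := by gcongr
      _ = (1 + |s.im|) * (‖Complex.Gamma (z - 1 + s.im * Complex.I)‖ *
          (rexp (9 / 4 - z.im ^ 2) * rexp |z.im|)) := by norm_num; ring
      _ ≤ (1 + |s.im|) * (K * E) := by gcongr
      _ = _ := by ring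
  have key := Complex.HadamardThreeLines.norm_le_interp_of_mem_verticalClosedStrip' (f := f)
    (z := (s.re : ℂ)) (by norm_num : (1 / 2 : ℝ) < 3 / 2) ⟨by simpa using hs₁, by simpa using hs₂⟩
    hd hB ha hb
  simp only [hf, norm_mul, hexp, Complex.ofReal_re, Complex.ofReal_im, Complex.re_add_im] at key
  rw [show (s.re - 1 / 2) / (3 / 2 - 1 / 2 : ℝ) = s.re - 1 / 2 by norm_num] at key
  have h1 : 1 ≤ rexp (s.re ^ 2 - 0 ^ 2) := Real.one_le_exp (by nlinarith)
  refine (le_mul_of_one_le_right (norm_nonneg _) h1).trans (key.trans_eq ?_)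
  rw [show K * ((1 + |s.im|) * E) = K * E * (1 + |s.im|) by ring,
    Real.mul_rpow (x := K * E) (by positivity) (by positivity), ← mul_assoc, ← Real.rpow_add (by positivity)]
  rw [sub_add_cancel, Real.rpow_one]
  ring

lemma Complex.norm_Gamma_le_of_mem_strip_nat (n : ℕ) : ∃ K > 0, ∀ s : ℂ, 1 / 2 - n ≤ s.re →
    s.re ≤ 3 / 2 + n → 1 ≤ |s.im| →
    ‖Complex.Gamma s‖ ≤ K * (1 + |s.im|) ^ (s.re - 1 / 2) * rexp (-(π / 2) * |s.im|) := by
  induction n with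
  | zero =>
    obtain ⟨K, hK, h⟩ := Complex.norm_Gamma_le_of_mem_strip
    exact ⟨K, hK, fun s h1 h2 _ => h s (by simpa using h1) (by simpa using h2)⟩
  | succ n ih =>
    obtain ⟨K, hK, h⟩ := ih
    refine ⟨K * (n + 3), by positivity, fun s h1 h2 h3 => ?_⟩
    push_cast at h1 h2
    have hn : (0 : ℝ) ≤ n := n.cast_nonneg
    have hpos : 0 < 1 + |s.im| := by positivity
    rcases lt_or_ge s.re (1 / 2 - n) with hlt | hge
    · have hs0 : s ≠ 0 := by rintro rfl; norm_num at h3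
      have h4 := h (s + 1) (by simp; linarith) (by simp; linarith) (by simpa using h3)
      rw [Complex.Gamma_add_one _ hs0, norm_mul] at h4
      simp only [Complex.add_re, Complex.one_re, Complex.add_im, Complex.one_im, add_zero] at h4
      rw [show s.re + 1 - 1 / 2 = s.re - 1 / 2 + 1 by ring, Real.rpow_add_one hpos.ne'] at h4
      have h5 : 1 + |s.im| ≤ 2 * ‖s‖ := by linarith [Complex.abs_im_le_norm s]
      have h6 : 0 < ‖s‖ := norm_pos_iff.2 hs0
      refine le_of_mul_le_mul_left (h4.trans ?_) h6
      set P := (1 + |s.im|) ^ (s.re - 1 / 2)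
      set E := rexp (-(π / 2) * |s.im|)
      have hP : 0 < P := Real.rpow_pos_of_pos hpos _
      calc K * (P * (1 + |s.im|)) * E = K * P * E * (1 + |s.im|) := by ring
        _ ≤ K * P * E * ((n + 3) * ‖s‖) := by gcongr; nlinarith
        _ = _ := by ring
    · rcases le_or_gt s.re (3 / 2 + n) with hle | hgt
      · refine (h s hge hle h3).trans ?_
        gcongr
        nlinarith
      · have hs0 : s - 1 ≠ 0 := by
          intro h0
          have := congrArg Complex.im h0
          simp at this
          norm_num [this] at h3
        have h4 := h (s - 1) (by simp; linarith) (by simp; linarith) (by simpa using h3)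
        have h5 : Complex.Gamma s = (s - 1) * Complex.Gamma (s - 1) := by
          rw [← Complex.Gamma_add_one _ hs0, sub_add_cancel]
        simp only [Complex.sub_re, Complex.one_re, Complex.sub_im, Complex.one_im, sub_zero] at h4
        have h6 : ‖s - 1‖ ≤ (n + 3) * (1 + |s.im|) := by
          refine (Complex.norm_le_abs_re_add_abs_im _).trans ?_
          simp only [Complex.sub_re, Complex.one_re, Complex.sub_im, Complex.one_im, sub_zero]
          rw [abs_of_nonneg (by linarith)]
          nlinarith
        rw [h5, norm_mul]
        refine (mul_le_mul h6 h4 (norm_nonneg _) (by positivity)).trans_eq ?_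
        rw [show s.re - 1 / 2 = s.re - 1 - 1 / 2 + 1 by ring, Real.rpow_add_one hpos.ne']
        ring

lemma Complex.norm_Gamma_le (A B : ℝ) : ∃ K > 0, ∀ s : ℂ, A ≤ s.re → s.re ≤ B → 1 ≤ |s.im| →
    ‖Complex.Gamma s‖ ≤ K * (1 + |s.im|) ^ (s.re - 1 / 2) * rexp (-(π / 2) * |s.im|) := by
  obtain ⟨n, hn⟩ := exists_nat_ge (max (1 / 2 - A) B)
  obtain ⟨K, hK, h⟩ := Complex.norm_Gamma_le_of_mem_strip_nat n
  exact ⟨K, hK, fun s h1 h2 => h s (by linarith [le_max_left (1 / 2 - A) B])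
    (by linarith [le_max_right (1 / 2 - A) B])⟩

lemma Complex.norm_sin_le (z : ℂ) : ‖Complex.sin z‖ ≤ rexp |z.im| := by
  rw [Complex.sin, norm_div, norm_mul, Complex.norm_I, mul_one]
  have h1 : ‖Complex.exp (-z * Complex.I)‖ ≤ rexp |z.im| := by
    rw [Complex.norm_exp]; simpa using le_abs_self z.im
  have h2 : ‖Complex.exp (z * Complex.I)‖ ≤ rexp |z.im| := by
    rw [Complex.norm_exp]; simpa using neg_le_abs z.im
  have := norm_sub_le (Complex.exp (-z * Complex.I)) (Complex.exp (z * Complex.I))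
  rw [show ‖(2 : ℂ)‖ = 2 by simp]
  linarith

lemma Complex.le_norm_Gamma (A B : ℝ) : ∃ c > 0, ∀ s : ℂ, A ≤ s.re → s.re ≤ B → 1 ≤ |s.im| →
    c * (1 + |s.im|) ^ (s.re - 1 / 2) * rexp (-(π / 2) * |s.im|) ≤ ‖Complex.Gamma s‖ := by
  obtain ⟨K, hK, h⟩ := Complex.norm_Gamma_le (1 - B) (1 - A)
  refine ⟨π / K, by positivity, fun s h1 h2 h3 => ?_⟩
  have h4 := h (1 - s) (by simp; linarith) (by simp; linarith) (by simpa using h3)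
  simp only [Complex.sub_re, Complex.one_re, Complex.sub_im, Complex.one_im, zero_sub, abs_neg]
    at h4
  have him : (π * s : ℂ).im = π * s.im := by simp
  have hsin := Complex.norm_sin_le (π * s)
  rw [him, abs_mul, abs_of_pos pi_pos] at hsin
  have hsin0 : Complex.sin (π * s) ≠ 0 := by
    intro h0
    obtain ⟨k, hk⟩ := Complex.sin_eq_zero_iff.1 h0
    have := congrArg Complex.im hk
    simp [pi_ne_zero] at this
    norm_num [this] at h3
  have hrefl := congrArg norm (Complex.Gamma_mul_Gamma_one_sub s)
  rw [norm_mul, norm_div, Complex.norm_real, Real.norm_eq_abs, abs_of_pos pi_pos,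
    eq_div_iff (norm_ne_zero_iff.2 hsin0)] at hrefl
  have hpos : 0 < 1 + |s.im| := by positivity
  set P := (1 + |s.im|) ^ (s.re - 1 / 2) with hP
  have hPpos : 0 < P := Real.rpow_pos_of_pos hpos _
  have hP' : (1 + |s.im|) ^ (1 - s.re - 1 / 2) = P⁻¹ := by
    rw [hP, ← Real.rpow_neg hpos.le]; congr 1; ring
  rw [hP'] at h4
  set E := rexp (-(π / 2) * |s.im|) with hE
  have hEpos : 0 < E := Real.exp_pos _
  have hE' : rexp (π * |s.im|) = (E * E)⁻¹ := by
    rw [hE, ← Real.exp_add, ← Real.exp_neg]; congr 1; ring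
  rw [hE'] at hsin
  have : π ≤ ‖Complex.Gamma s‖ * (K * P⁻¹ * E) * (E * E)⁻¹ := by
    rw [← hrefl]; gcongr
  calc π / K * P * E ≤ ‖Complex.Gamma s‖ * (K * P⁻¹ * E) * (E * E)⁻¹ / K * P * E := by gcongr
    _ = ‖Complex.Gamma s‖ := by field_simp

lemma Complex.norm_Gamma_le_of_no_pole (A B : ℝ)
    (hAB : ∀ x ∈ Icc A B, ∀ m : ℕ, x ≠ -m) : ∃ K > 0, ∀ s : ℂ, A ≤ s.re → s.re ≤ B →
    ‖Complex.Gamma s‖ ≤ K * (1 + |s.im|) ^ (s.re - 1 / 2) * rexp (-(π / 2) * |s.im|) := by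
  obtain ⟨K, hK, h⟩ := Complex.norm_Gamma_le A B
  have hcompact : IsCompact (Icc A B ×ℂ Icc (-1) 1) := isCompact_Icc.reProdIm isCompact_Icc
  have hpos (s : ℂ) : 0 < (1 + |s.im|) ^ (s.re - 1 / 2) * rexp (-(π / 2) * |s.im|) := by positivity
  have hcont : ContinuousOn (fun s : ℂ => ‖Complex.Gamma s‖ /
      ((1 + |s.im|) ^ (s.re - 1 / 2) * rexp (-(π / 2) * |s.im|))) (Icc A B ×ℂ Icc (-1) 1) := by
    intro s hs
    refine ContinuousAt.continuousWithinAt (ContinuousAt.div ?_ ?_ (hpos s).ne')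
    · refine (Complex.continuousAt_Gamma s fun m hm => hAB s.re hs.1 m ?_).norm
      simp [hm]
    · refine ContinuousAt.mul (ContinuousAt.rpow (by fun_prop) (by fun_prop) (Or.inl ?_))
        (by fun_prop)
      positivity
  obtain ⟨M, hM⟩ := hcompact.exists_bound_of_continuousOn hcont
  refine ⟨max K M, lt_max_of_lt_left hK, fun s h1 h2 => ?_⟩
  rcases le_total 1 |s.im| with h3 | h3
  · refine (h s h1 h2 h3).trans ?_
    gcongr
    exact le_max_left _ _
  · have := (le_abs_self _).trans (hM s ⟨⟨h1, h2⟩, abs_le.1 h3⟩)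
    rw [div_le_iff₀ (hpos s)] at this
    rw [mul_assoc]
    refine this.trans ?_
    gcongr
    exact le_max_right _ _

lemma integrable_indicator_one_add_abs_rpow (p R : ℝ) :
    Integrable fun t : ℝ => (Iic R).indicator (fun x => (1 + x) ^ p) |t| := by
  have hset : (fun t : ℝ => (Iic R).indicator (fun x => (1 + x) ^ p) |t|) =
      (Icc (-R) R).indicator (fun t => (1 + |t|) ^ p) := by
    ext t
    simp only [indicator, mem_Iic, mem_Icc, abs_le]
  rw [hset, integrable_indicator_iff measurableSet_Icc]
  refine ContinuousOn.integrableOn_Icc (Continuous.continuousOn ?_)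
  refine Continuous.rpow_const (by fun_prop) fun t => Or.inl ?_
  positivity

lemma integral_indicator_one_add_abs_rpow_le {p R : ℝ} (hp : -1 < p) (hR : 0 ≤ R) :
    ∫ t : ℝ, (Iic R).indicator (fun x => (1 + x) ^ p) |t| ≤ 2 / (p + 1) * (1 + R) ^ (p + 1) := by
  have hp' : 0 < p + 1 := by linarith
  rw [integral_comp_abs (f := (Iic R).indicator (fun x => (1 + x) ^ p)),
    setIntegral_indicator measurableSet_Iic, Ioi_inter_Iic,
    ← intervalIntegral.integral_of_le hR,
    intervalIntegral.integral_comp_add_left (fun x => x ^ p) 1, integral_rpow (Or.inl hp),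
    add_zero, Real.one_rpow, mul_div_assoc', div_mul_eq_mul_div]
  gcongr
  linarith

lemma integrable_one_add_abs_rpow_mul_exp (p : ℝ) :
    Integrable fun t : ℝ => (1 + |t|) ^ p * rexp (-(π / 2) * |t|) := by
  set r : ℝ := max 1 (p + 2) with hr
  have hr0 : 0 < r := by positivity
  set c : ℝ := π / 2 with hc
  have hc0 : 0 < c := by positivity
  have hbound : Integrable fun t : ℝ => (1 + r / c) ^ r * (1 + ‖t‖) ^ (-2 : ℝ) :=
    (integrable_one_add_norm (by simp)).const_mul _
  refine hbound.mono' (Continuous.aestronglyMeasurable (Continuous.mul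
    (Continuous.rpow_const (by fun_prop) fun t => Or.inl (by positivity)) (by fun_prop)))
    (Eventually.of_forall fun t => ?_)
  rw [Real.norm_eq_abs, Real.norm_eq_abs, abs_of_nonneg (by positivity)]
  have h1 : 1 ≤ 1 + |t| := by linarith [abs_nonneg t]
  have h2 : 1 + |t| ≤ (1 + r / c) * rexp (c * |t| / r) := by
    have h3 := Real.add_one_le_exp (c * |t| / r)
    refine le_trans ?_ (mul_le_mul_of_nonneg_left h3 (by positivity))
    have h4 : (1 + r / c) * (c * |t| / r + 1) = 1 + |t| + r / c + c * |t| / r := by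
      field_simp
      ring
    rw [h4]
    have : 0 ≤ r / c := by positivity
    have : 0 ≤ c * |t| / r := by positivity
    linarith
  have h5 : (1 + |t|) ^ r ≤ (1 + r / c) ^ r * rexp (c * |t|) := by
    refine (Real.rpow_le_rpow (by positivity) h2 hr0.le).trans_eq ?_
    rw [Real.mul_rpow (by positivity) (by positivity), ← Real.exp_mul]
    congr 2
    field_simp
  have h6 : (1 + |t|) ^ p ≤ (1 + |t|) ^ r * (1 + |t|) ^ (-2 : ℝ) := by
    rw [← Real.rpow_add (by positivity)]
    exact Real.rpow_le_rpow_of_exponent_le h1 (by linarith [le_max_right 1 (p + 2)])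
  calc (1 + |t|) ^ p * rexp (-c * |t|)
      ≤ ((1 + r / c) ^ r * rexp (c * |t|) * (1 + |t|) ^ (-2 : ℝ)) * rexp (-c * |t|) := by
        gcongr
        exact h6.trans (by gcongr)
    _ = (1 + r / c) ^ r * (1 + |t|) ^ (-2 : ℝ) * (rexp (c * |t|) * rexp (-c * |t|)) := by ring
    _ = _ := by rw [← Real.exp_add]; simp

/-- Pointwise domination of a convolution of two functions of Stirling type. -/
lemma convolution_integrand_le {p q y t : ℝ} (hq : -1 < q) (hq0 : q ≤ 0) :
    (1 + |t|) ^ p * rexp (-(π / 2) * |t|) * ((1 + |y - t|) ^ q * rexp (-(π / 2) * |y - t|)) ≤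
      rexp (-(π / 2) * |y|) *
        (2 * (1 + |y|) ^ q * (Iic (2 * |y|)).indicator (fun x => (1 + x) ^ p) |t| +
        2 ^ (|p|) * (1 + |y|) ^ p * (Iic |y|).indicator (fun x => (1 + x) ^ q) |y - t| +
        (1 + |y|) ^ q * ((1 + |t|) ^ p * rexp (-(π / 2) * |t|))) := by
  have hy := abs_nonneg y
  have ht := abs_nonneg t
  have hyt := abs_nonneg (y - t)
  have htri : |y| ≤ |t| + |y - t| := by
    have := abs_add_le t (y - t); simpa using this
  have htri1 : |t| ≤ |y| + |y - t| := by
    have := abs_sub y (y - t); simpa using this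
  have htri2 : |y - t| ≤ |y| + |t| := abs_sub y t
  have hE : rexp (-(π / 2) * |t|) * rexp (-(π / 2) * |y - t|) ≤ rexp (-(π / 2) * |y|) := by
    rw [← Real.exp_add]
    apply Real.exp_le_exp.2
    nlinarith [pi_pos]
  have hI1 : 0 ≤ (Iic (2 * |y|)).indicator (fun x : ℝ => (1 + x) ^ p) |t| := by
    rw [indicator_apply]; split_ifs <;> positivity
  have hI2 : 0 ≤ (Iic |y|).indicator (fun x : ℝ => (1 + x) ^ q) |y - t| := by
    rw [indicator_apply]; split_ifs <;> positivity
  set Y := (1 + |y|) with hY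
  have hYpos : 0 < Y := by positivity
  rcases lt_or_ge (2 * |y|) |t| with h1 | h1
  · have h2 : (1 + |y - t|) ^ q ≤ Y ^ q :=
      Real.rpow_le_rpow_of_nonpos hYpos (by linarith) hq0
    have h3 : rexp (-(π / 2) * |y - t|) ≤ rexp (-(π / 2) * |y|) := by
      apply Real.exp_le_exp.2
      nlinarith [pi_pos]
    calc _ ≤ (1 + |t|) ^ p * rexp (-(π / 2) * |t|) * (Y ^ q * rexp (-(π / 2) * |y|)) := by gcongr
      _ = rexp (-(π / 2) * |y|) * (0 + 0 + Y ^ q * ((1 + |t|) ^ p * rexp (-(π / 2) * |t|))) := by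
        ring
      _ ≤ _ := by gcongr <;> positivity
  · rcases le_or_gt (|y| / 2) |y - t| with h2 | h2
    · have h3 : (1 + |y - t|) ^ q ≤ 2 * Y ^ q := by
        calc (1 + |y - t|) ^ q ≤ (Y / 2) ^ q :=
              Real.rpow_le_rpow_of_nonpos (by positivity) (by linarith) hq0
          _ = 2 ^ (-q) * Y ^ q := by
              rw [Real.div_rpow hYpos.le (by norm_num), Real.rpow_neg (by norm_num)]
              ring
          _ ≤ 2 ^ (1 : ℝ) * Y ^ q := by gcongr <;> linarith
          _ = _ := by rw [Real.rpow_one]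
      calc _ = (1 + |t|) ^ p * (1 + |y - t|) ^ q *
            (rexp (-(π / 2) * |t|) * rexp (-(π / 2) * |y - t|)) := by ring
        _ ≤ (1 + |t|) ^ p * (2 * Y ^ q) * rexp (-(π / 2) * |y|) := by gcongr
        _ = rexp (-(π / 2) * |y|) * (2 * Y ^ q * (1 + |t|) ^ p + 0 + 0) := by ring
        _ ≤ _ := by
          rw [indicator_of_mem (show |t| ∈ Iic (2 * |y|) from h1)]
          gcongr <;> positivity
    · have h3 : (1 + |t|) ^ p ≤ 2 ^ |p| * Y ^ p := by
        rcases le_total 0 p with hp0 | hp0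
        · rw [abs_of_nonneg hp0, ← Real.mul_rpow (by norm_num) hYpos.le]
          exact Real.rpow_le_rpow (by positivity) (by linarith) hp0
        · rw [abs_of_nonpos hp0, Real.rpow_neg (by norm_num), mul_comm, ← div_eq_mul_inv,
            ← Real.div_rpow hYpos.le (by norm_num)]
          exact Real.rpow_le_rpow_of_nonpos (by positivity) (by linarith) hp0
      calc _ = (1 + |t|) ^ p * (1 + |y - t|) ^ q *
            (rexp (-(π / 2) * |t|) * rexp (-(π / 2) * |y - t|)) := by ring
        _ ≤ (2 ^ |p| * Y ^ p) * (1 + |y - t|) ^ q * rexp (-(π / 2) * |y|) := by gcongr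
        _ = rexp (-(π / 2) * |y|) * (0 + 2 ^ |p| * Y ^ p * (1 + |y - t|) ^ q + 0) := by ring
        _ ≤ _ := by
          rw [indicator_of_mem (show |y - t| ∈ Iic |y| from by simp only [mem_Iic]; linarith)]
          gcongr <;> positivity

/-- An integrable majorant for a convolution of two functions of Stirling type, with a bound on
its integral that is uniform in the second exponent. -/
lemma exists_integral_convolution_le {p q₀ : ℝ} (hp : -1 < p) (hq₀ : -1 < q₀) :
    ∃ C > 0, ∀ q y : ℝ, q₀ ≤ q → q ≤ 0 → ∃ M : ℝ → ℝ, Integrable M ∧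
      (∀ t, (1 + |t|) ^ p * rexp (-(π / 2) * |t|) *
        ((1 + |y - t|) ^ q * rexp (-(π / 2) * |y - t|)) ≤ M t) ∧
      ∫ t, M t ≤ C * ((1 + |y|) ^ (p + q + 1) * rexp (-(π / 2) * |y|)) := by
  set L := ∫ t : ℝ, (1 + |t|) ^ p * rexp (-(π / 2) * |t|) with hL
  have hL0 : 0 ≤ L := integral_nonneg fun t => by positivity
  have hp' : 0 < p + 1 := by linarith
  have hq' : 0 < q₀ + 1 := by linarith
  refine ⟨2 * (2 / (p + 1) * 2 ^ (p + 1)) + 2 ^ |p| * (2 / (q₀ + 1)) + L, by positivity,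
    fun q y hq hq0 => ⟨_, ?_, fun t => convolution_integrand_le (hq₀.trans_le hq) hq0, ?_⟩⟩
  all_goals
    have i1 := (integrable_indicator_one_add_abs_rpow p (2 * |y|)).const_mul (2 * (1 + |y|) ^ q)
    have i2 := ((integrable_indicator_one_add_abs_rpow q |y|).comp_sub_left y).const_mul
      (2 ^ |p| * (1 + |y|) ^ p)
    have i3 := (integrable_one_add_abs_rpow_mul_exp p).const_mul ((1 + |y|) ^ q)
    have i12 := i1.add i2
    simp only [Pi.add_def] at i12
  · exact (i12.add i3).const_mul _
  · rw [integral_const_mul, integral_add i12 i3, integral_add i1 i2, integral_const_mul,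
      integral_const_mul, integral_const_mul,
      integral_sub_left_eq_self (fun t => (Iic |y|).indicator (fun x => (1 + x) ^ q) |t|) volume y]
    have b1 := integral_indicator_one_add_abs_rpow_le hp (by positivity : 0 ≤ 2 * |y|)
    have b2 := integral_indicator_one_add_abs_rpow_le (hq₀.trans_le hq) (abs_nonneg y)
    set Y := 1 + |y| with hY
    have hY1 : 1 ≤ Y := by linarith [abs_nonneg y]
    have hY0 : 0 < Y := by linarith
    have b1' : (1 + 2 * |y|) ^ (p + 1) ≤ 2 ^ (p + 1) * Y ^ (p + 1) := by
      rw [← Real.mul_rpow (by norm_num) hY0.le]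
      exact Real.rpow_le_rpow (by positivity) (by linarith) hp'.le
    have e1 : Y ^ (p + q + 1) = Y ^ q * Y ^ (p + 1) := by
      rw [← Real.rpow_add hY0]; ring_nf
    have e2 : Y ^ (p + q + 1) = Y ^ p * Y ^ (q + 1) := by
      rw [← Real.rpow_add hY0]; ring_nf
    have e3 : Y ^ q ≤ Y ^ (p + q + 1) := Real.rpow_le_rpow_of_exponent_le hY1 (by linarith)
    have c1 : 2 * Y ^ q * ∫ t : ℝ, (Iic (2 * |y|)).indicator (fun x => (1 + x) ^ p) |t| ≤
        2 * (2 / (p + 1) * 2 ^ (p + 1)) * Y ^ (p + q + 1) := by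
      calc _ ≤ 2 * Y ^ q * (2 / (p + 1) * (2 ^ (p + 1) * Y ^ (p + 1))) := by
            gcongr; exact b1.trans (by gcongr)
        _ = _ := by rw [e1]; ring
    have c2 : 2 ^ |p| * Y ^ p * ∫ t : ℝ, (Iic |y|).indicator (fun x => (1 + x) ^ q) |t| ≤
        2 ^ |p| * (2 / (q₀ + 1)) * Y ^ (p + q + 1) := by
      calc _ ≤ 2 ^ |p| * Y ^ p * (2 / (q₀ + 1) * Y ^ (q + 1)) := by
            gcongr; exact b2.trans (by gcongr)
        _ = _ := by rw [e2]; ring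
    have c3 : Y ^ q * L ≤ L * Y ^ (p + q + 1) := by rw [mul_comm]; gcongr
    calc _ ≤ rexp (-(π / 2) * |y|) * (2 * (2 / (p + 1) * 2 ^ (p + 1)) * Y ^ (p + q + 1) +
          2 ^ |p| * (2 / (q₀ + 1)) * Y ^ (p + q + 1) + L * Y ^ (p + q + 1)) := by gcongr
      _ = _ := by ring

/-- Lemma on the Gamma function: uniform bound on a vertical-line convolution integral. -/
theorem stmt10 (w₀ a b : ℝ) (hw₀ : 0 < w₀) (hab : a ≤ b) (ha : w₀ - 1/2 < a) (hb : b < w₀) :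
    ∃ C > 0, ∃ T₀ : ℝ, ∀ u : ℂ, a ≤ u.re → u.re ≤ b → T₀ ≤ |u.im| →
      (∫ t : ℝ, ‖Complex.Gamma (↑w₀ + ↑t * Complex.I)‖ *
          ‖Complex.Gamma (u - ↑w₀ - ↑t * Complex.I)‖) / ‖Complex.Gamma u‖
        ≤ C * |u.im| ^ (1/2 : ℝ) := by
  obtain ⟨K₁, hK₁, h₁⟩ := Complex.norm_Gamma_le_of_no_pole w₀ w₀ (by
    rintro x ⟨hx, -⟩ m rfl
    linarith [m.cast_nonneg (α := ℝ)])
  obtain ⟨K₂, hK₂, h₂⟩ := Complex.norm_Gamma_le_of_no_pole (a - w₀) (b - w₀) (by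
    rintro x ⟨hx₁, hx₂⟩ m rfl
    rcases m.eq_zero_or_pos with rfl | hm
    · simp at hx₂; linarith
    · have : (1 : ℝ) ≤ m := mod_cast hm
      linarith)
  obtain ⟨c, hc, h₃⟩ := Complex.le_norm_Gamma a b
  obtain ⟨C, hC, h₄⟩ := exists_integral_convolution_le (p := w₀ - 1 / 2) (q₀ := a - w₀ - 1 / 2)
    (by linarith) (by linarith)
  refine ⟨K₁ * K₂ * C / c * 2 ^ (1 / 2 : ℝ), by positivity, 1, fun u hua hub hu => ?_⟩
  obtain ⟨M, hM, hle, hbound⟩ := h₄ (u.re - w₀ - 1 / 2) u.im (by linarith) (by linarith)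
  have hY : 0 < 1 + |u.im| := by positivity
  have hnum : ∫ t : ℝ, ‖Complex.Gamma (↑w₀ + ↑t * Complex.I)‖ *
      ‖Complex.Gamma (u - ↑w₀ - ↑t * Complex.I)‖ ≤
      K₁ * K₂ * (C * ((1 + |u.im|) ^ u.re * rexp (-(π / 2) * |u.im|))) := by
    calc _ ≤ ∫ t, K₁ * K₂ * M t := by
          refine integral_mono_of_nonneg (Eventually.of_forall fun t => by positivity)
            (hM.const_mul _) (Eventually.of_forall fun t => ?_)
          have g₁ := h₁ (w₀ + t * Complex.I) (by simp) (by simp)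
          have g₂ := h₂ (u - w₀ - t * Complex.I) (by simp; linarith) (by simp; linarith)
          simp only [Complex.add_re, Complex.sub_re, Complex.add_im, Complex.sub_im,
            Complex.mul_re, Complex.mul_im, Complex.ofReal_re, Complex.ofReal_im, Complex.I_re,
            Complex.I_im, mul_zero, mul_one, sub_zero, add_zero, zero_add] at g₁ g₂
          refine (mul_le_mul g₁ g₂ (norm_nonneg _) (by positivity)).trans ?_
          refine le_trans (le_of_eq ?_) (mul_le_mul_of_nonneg_left (hle t) (by positivity))
          ring
      _ = K₁ * K₂ * ∫ t, M t := integral_const_mul _ _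
      _ ≤ _ := by
        rw [show w₀ - 1 / 2 + (u.re - w₀ - 1 / 2) + 1 = u.re by ring] at hbound
        gcongr
  have hden := h₃ u hua hub hu
  have hΓ : 0 < ‖Complex.Gamma u‖ := lt_of_lt_of_le (by positivity) hden
  have hroot : (1 + |u.im|) ^ (1 / 2 : ℝ) ≤ 2 ^ (1 / 2 : ℝ) * |u.im| ^ (1 / 2 : ℝ) := by
    rw [← Real.mul_rpow (by norm_num) (abs_nonneg _)]
    exact Real.rpow_le_rpow hY.le (by linarith) (by norm_num)
  have hsplit : (1 + |u.im|) ^ u.re =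
      (1 + |u.im|) ^ (u.re - 1 / 2) * (1 + |u.im|) ^ (1 / 2 : ℝ) := by
    rw [← Real.rpow_add hY, sub_add_cancel]
  rw [div_le_iff₀ hΓ]
  refine hnum.trans ?_
  rw [hsplit]
  calc _ = K₁ * K₂ * C / c * (1 + |u.im|) ^ (1 / 2 : ℝ) *
        (c * (1 + |u.im|) ^ (u.re - 1 / 2) * rexp (-(π / 2) * |u.im|)) := by field_simp
    _ ≤ K₁ * K₂ * C / c * (2 ^ (1 / 2 : ℝ) * |u.im| ^ (1 / 2 : ℝ)) * ‖Complex.Gamma u‖ := by gcongr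
    _ = _ := by ring
end
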